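/- Let s ≥ 0, c ∈ H^{s+2}(T^d) with ∇c ∈ L^∞, and let p be a smooth solution of div((1/η(c))∇p) = div((1/η(c))μ(c)∇c) on T^d. Then ‖∇p‖_{H^s} ≤ F(‖c‖_{L^∞})(1 + ‖∇c‖_{L^∞})(1 + ‖c‖_{H²})^{⌊2s⌋+1} ‖c‖_{H^{s+2}}, where F is an increasing function on [0,∞) depending on η, C, s, d. -/

import Mathlib

open MeasureTheory Complex Real

noncomputable section

abbrev Td (d : ℕ) := Fin d → ℝ

def box (d : ℕ) : Set (Td d) := Set.univ.pi fun _ => Set.Ioc (0:ℝ) 1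

/-- `f` is `ℤ^d`-periodic. -/
def TPer {d : ℕ} (f : Td d → ℝ) : Prop :=
  ∀ (x : Td d) (k : Fin d → ℤ), f (fun i => x i + k i) = f x

/-- The character `e^{2π i k·x}`. -/
def eK {d : ℕ} (k : Fin d → ℤ) (x : Td d) : ℂ :=
  Complex.exp (2 * Real.pi * Complex.I * ∑ i, (k i : ℂ) * (x i : ℂ))

/-- Fourier coefficient of a periodic function on the torus. -/
def fCoeff {d : ℕ} (f : Td d → ℝ) (k : Fin d → ℤ) : ℂ :=
  ∫ x in box d, (f x : ℂ) * Complex.exp (-(2 * Real.pi * Complex.I) * ∑ i, (k i : ℂ) * (x i : ℂ))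

/-- Japanese bracket weight `(1+|k|²)^s`. -/
def wt {d : ℕ} (s : ℝ) (k : Fin d → ℤ) : ℝ := (1 + ∑ i, ((k i : ℝ))^2) ^ s

def hsNormSq {d : ℕ} (s : ℝ) (f : Td d → ℝ) : ℝ :=
  ∑' k : Fin d → ℤ, wt s k * ‖fCoeff f k‖^2

/-- Sobolev `H^s` norm on the torus, via Fourier series. -/
def hsNorm {d : ℕ} (s : ℝ) (f : Td d → ℝ) : ℝ := Real.sqrt (hsNormSq s f)

/-- Membership in `H^s`. -/
def InHs {d : ℕ} (s : ℝ) (f : Td d → ℝ) : Prop :=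
  Summable fun k : Fin d → ℤ => wt s k * ‖fCoeff f k‖^2

def l2Norm {d : ℕ} (f : Td d → ℝ) : ℝ := Real.sqrt (∫ x in box d, (f x)^2)

def l2NormC {d : ℕ} (f : Td d → ℂ) : ℝ := Real.sqrt (∫ x in box d, ‖f x‖^2)

def linf {d : ℕ} (f : Td d → ℝ) : ℝ := ⨆ x : Td d, |f x|

/-- `i`-th partial derivative. -/
def pd {d : ℕ} (i : Fin d) (f : Td d → ℝ) (x : Td d) : ℝ := fderiv ℝ f x (Pi.single i 1)

/-- Laplacian. -/
def lap {d : ℕ} (f : Td d → ℝ) (x : Td d) : ℝ := ∑ i, pd i (pd i f) x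

/-- Pointwise Euclidean norm of the gradient. -/
def gn {d : ℕ} (f : Td d → ℝ) (x : Td d) : ℝ := Real.sqrt (∑ i, (pd i f x)^2)

/-- Chemical potential `μ(c) = f₀'(c) - C Δc` with `f₀(c) = (c²-1)²`. -/
def chemMu {d : ℕ} (Cc : ℝ) (c : Td d → ℝ) (x : Td d) : ℝ :=
  4 * (c x)^3 - 4 * c x - Cc * lap c x

/-- `(c,u,p)` is a classical solution of the Hele-Shaw-Cahn-Hilliard system
on `T^d × [0,T]`:  `div u = 0`, `u = -(1/(12η(c)))(∇p - (1/M) μ(c)∇c)`,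
`∂ₜc + u·∇c = (1/Pe) Δμ(c)`. -/
def IsHSCHSol {d : ℕ} (T Pe Cc M : ℝ) (η : ℝ → ℝ)
    (c : ℝ → Td d → ℝ) (u : ℝ → Td d → Td d) (p : ℝ → Td d → ℝ) : Prop :=
  (∀ t ∈ Set.Icc (0:ℝ) T, ∀ x, (∑ i, pd i (fun y => u t y i) x) = 0) ∧
  (∀ t ∈ Set.Icc (0:ℝ) T, ∀ x, ∀ i, u t x i =
    -(1 / (12 * η (c t x))) *
      (pd i (p t) x - (1/M) * chemMu Cc (c t) x * pd i (c t) x)) ∧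
  (∀ t ∈ Set.Icc (0:ℝ) T, ∀ x,
    deriv (fun s => c s x) t + (∑ i, u t x i * pd i (c t) x)
      = (1/Pe) * lap (chemMu Cc (c t)) x)

/-! ### Part 1: Parseval and Riesz-Fischer on the box -/

/-- the circle carries the normalised Haar measure -/
local instance instMSCircle : MeasureSpace UnitAddCircle := ⟨AddCircle.haarAddCircle⟩
local instance instHaarCircle : Measure.IsAddHaarMeasure (volume : Measure UnitAddCircle) :=
  inferInstanceAs (Measure.IsAddHaarMeasure AddCircle.haarAddCircle)
local instance instProbCircle : IsProbabilityMeasure (volume : Measure UnitAddCircle) :=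
  inferInstanceAs (IsProbabilityMeasure AddCircle.haarAddCircle)

/-- Lebesgue measure on the unit box -/
abbrev muB (d : ℕ) : Measure (Td d) := volume.restrict (box d)

/-- complex Fourier coefficient -/
def fc {d : ℕ} (f : Td d → ℂ) (k : Fin d → ℤ) : ℂ :=
  ∫ x in box d, f x * Complex.exp (-(2 * Real.pi * Complex.I) * ∑ i, (k i : ℂ) * (x i : ℂ))

theorem fCoeff_eq_fc {d : ℕ} (f : Td d → ℝ) : fCoeff f = fc (fun x => (f x : ℂ)) := rfl

/-- representative map -/
def rhoT (d : ℕ) (x : UnitAddTorus (Fin d)) : Td d := fun i => (AddCircle.equivIoc 1 0 (x i)).1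

def piT (d : ℕ) (x : Td d) : UnitAddTorus (Fin d) := fun i => (x i : UnitAddCircle)

theorem piT_rhoT {d : ℕ} (x : UnitAddTorus (Fin d)) : piT d (rhoT d x) = x := by
  funext i
  exact (AddCircle.equivIoc 1 0).symm_apply_apply (x i)

theorem rhoT_mp (d : ℕ) : MeasurePreserving (rhoT d) volume (muB d) := by
  have h1 := UnitAddTorus.measurePreserving_equivPiIoc (d := Fin d) (fun _ => (0:ℝ))
  have hb : MeasurableSet {x : Fin d → ℝ | ∀ i, x i ∈ Set.Ioc ((fun _ => (0:ℝ)) i) ((fun _ => (0:ℝ)) i + 1)} :=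
    MeasurableSet.univ_pi' (fun i => measurableSet_Ioc)
  have h2 : MeasurePreserving (Subtype.val : {x : Fin d → ℝ // ∀ i, x i ∈ Set.Ioc ((fun _ => (0:ℝ)) i) ((fun _ => (0:ℝ)) i + 1)} → (Fin d → ℝ)) (Measure.comap Subtype.val volume) (volume.restrict {x : Fin d → ℝ | ∀ i, x i ∈ Set.Ioc ((fun _ => (0:ℝ)) i) ((fun _ => (0:ℝ)) i + 1)}) :=
    ⟨measurable_subtype_coe, map_comap_subtype_coe hb volume⟩
  have h3 := h2.comp h1
  have hbox : {x : Fin d → ℝ | ∀ i, x i ∈ Set.Ioc ((fun _ => (0:ℝ)) i) ((fun _ => (0:ℝ)) i + 1)} = box d := by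
    ext x; simp [box]
  rw [hbox] at h3
  exact h3

instance muB_prob (d : ℕ) : IsProbabilityMeasure (muB d) := by
  rw [← (rhoT_mp d).map_eq]
  exact Measure.isProbabilityMeasure_map (rhoT_mp d).measurable.aemeasurable

theorem rhoT_piT_ae (d : ℕ) : ∀ᵐ x ∂(muB d), rhoT d (piT d x) = x := by
  have hm : MeasurableSet (box d) := MeasurableSet.univ_pi (fun i => measurableSet_Ioc)
  filter_upwards [ae_restrict_mem hm] with x hx
  funext i
  have := (AddCircle.equivIoc 1 (0:ℝ)).apply_symm_apply ⟨x i, by simpa using hx i (Set.mem_univ i)⟩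
  exact congrArg Subtype.val this

theorem piT_mp (d : ℕ) : MeasurePreserving (piT d) (muB d) volume := by
  have hm : Measurable (piT d) := measurable_pi_lambda _
    (fun i => AddCircle.measurable_mk'.comp (measurable_pi_apply i))
  refine ⟨hm, ?_⟩
  rw [← (rhoT_mp d).map_eq, Measure.map_map hm (rhoT_mp d).measurable]
  have : piT d ∘ rhoT d = id := funext piT_rhoT
  rw [this, Measure.map_id]

theorem mFourier_piT {d : ℕ} (k : Fin d → ℤ) (x : Td d) :
    UnitAddTorus.mFourier k (piT d x) = eK k x := by
  simp only [UnitAddTorus.mFourier, ContinuousMap.coe_mk, piT, eK]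
  rw [Finset.mul_sum, Complex.exp_sum]
  refine Finset.prod_congr rfl fun i _ => ?_
  rw [fourier_coe_apply]
  congr 1
  push_cast; ring

theorem eK_neg {d : ℕ} (k : Fin d → ℤ) (x : Td d) :
    eK (-k) x = Complex.exp (-(2 * Real.pi * Complex.I) * ∑ i, (k i : ℂ) * (x i : ℂ)) := by
  simp [eK]

theorem eK_neg_conj {d : ℕ} (k : Fin d → ℤ) (x : Td d) :
    eK (-k) x = (starRingEnd ℂ) (eK k x) := by
  rw [← mFourier_piT, ← mFourier_piT, UnitAddTorus.mFourier_neg]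

theorem eK_add {d : ℕ} (k l : Fin d → ℤ) (x : Td d) :
    eK (k + l) x = eK k x * eK l x := by
  rw [← mFourier_piT, ← mFourier_piT, ← mFourier_piT, UnitAddTorus.mFourier_add]

theorem eK_norm {d : ℕ} (k : Fin d → ℤ) (x : Td d) : ‖eK k x‖ = 1 := by
  rw [eK]
  have : (2 * (Real.pi:ℂ) * Complex.I * ∑ i, (k i : ℂ) * (x i : ℂ)) = ((2 * Real.pi * ∑ i, (k i:ℝ) * x i : ℝ) : ℂ) * Complex.I := by
    push_cast; ring
  rw [this, Complex.norm_exp_ofReal_mul_I]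

theorem fc_eq {d : ℕ} (f : Td d → ℂ) (k : Fin d → ℤ) : fc f k = ∫ x, f x * eK (-k) x ∂(muB d) := by
  simp only [fc, eK_neg]

theorem eK_cont {d : ℕ} (k : Fin d → ℤ) : Continuous (eK (d := d) k) := by
  unfold eK; fun_prop

theorem fc_mFourier {d : ℕ} (g : UnitAddTorus (Fin d) → ℂ) (k : Fin d → ℤ)
    (hg : AEStronglyMeasurable g volume) :
    fc (g ∘ piT d) k = UnitAddTorus.mFourierCoeff g k := by
  rw [fc_eq, UnitAddTorus.mFourierCoeff]
  rw [← (piT_mp d).map_eq, integral_map (piT_mp d).measurable.aemeasurable]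
  · refine integral_congr_ae (Filter.Eventually.of_forall fun x => ?_)
    simp only [mFourier_piT, Function.comp, smul_eq_mul]; ring
  · rw [(piT_mp d).map_eq]
    exact (UnitAddTorus.mFourier (-k)).continuous.aestronglyMeasurable.smul hg

theorem fc_lift {d : ℕ} (f : Td d → ℂ) (hf : MemLp f 2 (muB d)) (k : Fin d → ℤ) :
    UnitAddTorus.mFourierCoeff ((hf.comp_measurePreserving (rhoT_mp d)).toLp) k = fc f k := by
  rw [← fc_mFourier _ _ (Lp.aestronglyMeasurable _), fc_eq, fc_eq]
  refine integral_congr_ae ?_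
  have h1 := (piT_mp d).quasiMeasurePreserving.ae_eq_comp
    (hf.comp_measurePreserving (rhoT_mp d)).coeFn_toLp
  filter_upwards [h1, rhoT_piT_ae d] with x hx hx2
  rw [hx]; simp [hx2]

/-- Parseval -/
theorem parseval {d : ℕ} {f g : Td d → ℂ} (hf : MemLp f 2 (muB d)) (hg : MemLp g 2 (muB d)) :
    HasSum (fun k => (starRingEnd ℂ) (fc f k) * fc g k) (∫ x, (starRingEnd ℂ) (f x) * g x ∂(muB d)) := by
  have h : HasSum (fun k => (starRingEnd ℂ) (fc f k) * fc g k)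
      (∫ t, (starRingEnd ℂ) ((hf.comp_measurePreserving (rhoT_mp d)).toLp _ t) *
        (hg.comp_measurePreserving (rhoT_mp d)).toLp _ t) := by
    simp only [← fc_lift f hf, ← fc_lift g hg]
    exact UnitAddTorus.hasSum_prod_mFourierCoeff (hf.comp_measurePreserving (rhoT_mp d)).toLp
      (hg.comp_measurePreserving (rhoT_mp d)).toLp
  have h2 : ∫ x, (starRingEnd ℂ) (f x) * g x ∂(muB d) = ∫ x, (starRingEnd ℂ) (f (rhoT d x)) * g (rhoT d x) := by
    conv_lhs => rw [← (rhoT_mp d).map_eq]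
    refine integral_map (rhoT_mp d).measurable.aemeasurable ?_
    rw [(rhoT_mp d).map_eq]
    exact (Complex.continuous_conj.comp_aestronglyMeasurable hf.1).mul hg.1
  convert h using 1
  rw [h2]
  · refine integral_congr_ae ?_
    filter_upwards [(hf.comp_measurePreserving (rhoT_mp d)).coeFn_toLp, (hg.comp_measurePreserving (rhoT_mp d)).coeFn_toLp] with x h1 h2
    rw [h1, h2]; rfl

theorem parseval_sq {d : ℕ} {f : Td d → ℂ} (hf : MemLp f 2 (muB d)) :
    HasSum (fun k => ‖fc f k‖ ^ 2) (∫ x, ‖f x‖ ^ 2 ∂(muB d)) := by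
  have h := Complex.hasSum_re (parseval hf hf)
  convert h using 1
  · funext k; rw [mul_comm, Complex.mul_conj, Complex.normSq_eq_norm_sq, Complex.ofReal_re]
  · have : (fun x => (starRingEnd ℂ) (f x) * f x) = fun x => ((‖f x‖ ^ 2 : ℝ) : ℂ) := by
      funext x; rw [mul_comm, Complex.mul_conj, Complex.normSq_eq_norm_sq]
    rw [this]
    exact (congrArg Complex.re (integral_ofReal (𝕜 := ℂ) (f := fun x => ‖f x‖ ^ 2))).symm

/-- Riesz-Fischer -/
theorem riesz_fischer {d : ℕ} (u : (Fin d → ℤ) → ℂ) (hu : Summable fun k => ‖u k‖ ^ 2) :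
    ∃ U : Td d → ℂ, MemLp U 2 (muB d) ∧ ∀ k, fc U k = u k := by
  have hl : Memℓp u 2 := by
    rw [memℓp_gen_iff (by norm_num)]
    simpa using hu
  let W := UnitAddTorus.mFourierBasis.repr.symm (⟨u, hl⟩ : lp (fun _ : Fin d → ℤ => ℂ) 2)
  refine ⟨W ∘ piT d, (Lp.memLp W).comp_measurePreserving (piT_mp d), fun k => ?_⟩
  rw [fc_mFourier _ _ (Lp.aestronglyMeasurable _), ← UnitAddTorus.mFourierBasis_repr]
  simp [W]

/-! ### Part 2: multiplication operators on the Fourier side -/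

theorem memLp_mul_bdd {d : ℕ} {a : Td d → ℝ} (ha : Continuous a) {K : ℝ} (hK : ∀ x, |a x| ≤ K)
    {v : Td d → ℂ} (hv : MemLp v 2 (muB d)) : MemLp (fun x => (a x : ℂ) * v x) 2 (muB d) := by
  refine MemLp.of_le_mul (c := K) hv ?_ ?_
  · exact (Complex.continuous_ofReal.comp ha).aestronglyMeasurable.mul hv.1
  · refine Filter.Eventually.of_forall fun x => ?_
    rw [norm_mul, Complex.norm_real]
    exact mul_le_mul_of_nonneg_right (hK x) (norm_nonneg _)

theorem memLp_cont_bdd {d : ℕ} {a : Td d → ℂ} (ha : Continuous a) {K : ℝ} (hK : ∀ x, ‖a x‖ ≤ K) :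
    MemLp a 2 (muB d) :=
  MemLp.of_bound ha.aestronglyMeasurable K (Filter.Eventually.of_forall hK)

theorem memLp_real_bdd {d : ℕ} {a : Td d → ℝ} (ha : Continuous a) {K : ℝ} (hK : ∀ x, |a x| ≤ K) :
    MemLp (fun x => (a x : ℂ)) 2 (muB d) :=
  memLp_cont_bdd (Complex.continuous_ofReal.comp ha) (K := K) (fun x => by
    simpa [Complex.norm_real] using hK x)

theorem conv_fc {d : ℕ} {a : Td d → ℝ} (ha : Continuous a) {K : ℝ} (hK : ∀ x, |a x| ≤ K)
    {v : Td d → ℂ} (hv : MemLp v 2 (muB d)) (k : Fin d → ℤ) :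
    HasSum (fun l => fCoeff a (k - l) * fc v l) (fc (fun x => (a x : ℂ) * v x) k) := by
  have h1 : MemLp (fun x => (a x : ℂ) * eK k x) 2 (muB d) :=
    memLp_cont_bdd ((Complex.continuous_ofReal.comp ha).mul (eK_cont k)) (K := K) (fun x => by
      rw [norm_mul, eK_norm, Complex.norm_real, mul_one]; exact hK x)
  have h := parseval h1 hv
  convert h using 1
  · funext l
    congr 1
    rw [fCoeff_eq_fc, fc_eq, fc_eq, ← integral_conj]
    congr 1
    funext x
    rw [map_mul, map_mul, Complex.conj_ofReal, ← eK_neg_conj, ← eK_neg_conj, mul_assoc, ← eK_add]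
    congr 2
    abel
  · rw [fc_eq]
    congr 1
    funext x
    rw [map_mul, Complex.conj_ofReal, ← eK_neg_conj]; ring

/-- Convolution with the Fourier coefficients of `a`. -/
def Tm {d : ℕ} (a : Td d → ℝ) (u : (Fin d → ℤ) → ℂ) (k : Fin d → ℤ) : ℂ :=
  ∑' l, fCoeff a (k - l) * u l

theorem Tm_summable {d : ℕ} {a : Td d → ℝ} (ha : Continuous a) {K : ℝ} (hK : ∀ x, |a x| ≤ K)
    {u : (Fin d → ℤ) → ℂ} (hu : Summable fun k => ‖u k‖ ^ 2) (k : Fin d → ℤ) :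
    Summable (fun l => fCoeff a (k - l) * u l) := by
  obtain ⟨U, hU, hUk⟩ := riesz_fischer u hu
  have := (conv_fc ha hK hU k).summable
  simpa only [hUk] using this

theorem Tm_bound {d : ℕ} {a : Td d → ℝ} (ha : Continuous a) {K : ℝ} (hK : ∀ x, |a x| ≤ K)
    {u : (Fin d → ℤ) → ℂ} (hu : Summable fun k => ‖u k‖ ^ 2) :
    (Summable fun k => ‖Tm a u k‖ ^ 2) ∧ ∑' k, ‖Tm a u k‖ ^ 2 ≤ K ^ 2 * ∑' k, ‖u k‖ ^ 2 := by
  obtain ⟨U, hU, hUk⟩ := riesz_fischer u hu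
  have hT : ∀ k, Tm a u k = fc (fun x => (a x : ℂ) * U x) k := by
    intro k
    rw [← (conv_fc ha hK hU k).tsum_eq, Tm]
    simp only [hUk]
  have h1 := parseval_sq (memLp_mul_bdd ha hK hU)
  have h2 := parseval_sq hU
  simp only [hUk] at h2
  simp only [hT]
  refine ⟨h1.summable, ?_⟩
  rw [h1.tsum_eq, h2.tsum_eq, ← integral_const_mul]
  refine integral_mono_of_nonneg (Filter.Eventually.of_forall fun x => by positivity)
    ((hU.integrable_norm_pow (by norm_num)).const_mul _) (Filter.Eventually.of_forall fun x => ?_)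
  simp only [norm_mul, Complex.norm_real, mul_pow]
  have := hK x
  gcongr
  exact this

theorem Tm_coercive {d : ℕ} {a : Td d → ℝ} (ha : Continuous a) {K m : ℝ} (hK : ∀ x, |a x| ≤ K)
    (hm : ∀ x, m ≤ a x)
    {u : (Fin d → ℤ) → ℂ} (hu : Summable fun k => ‖u k‖ ^ 2) :
    (Summable fun k => ((starRingEnd ℂ) (u k) * Tm a u k).re) ∧
      m * ∑' k, ‖u k‖ ^ 2 ≤ ∑' k, ((starRingEnd ℂ) (u k) * Tm a u k).re := by
  obtain ⟨U, hU, hUk⟩ := riesz_fischer u hu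
  have hT : ∀ k, Tm a u k = fc (fun x => (a x : ℂ) * U x) k := by
    intro k
    rw [← (conv_fc ha hK hU k).tsum_eq, Tm]
    simp only [hUk]
  have h1 := Complex.hasSum_re (parseval hU (memLp_mul_bdd ha hK hU))
  have h2 := parseval_sq hU
  simp only [hUk] at h2 h1
  simp only [hT]
  refine ⟨h1.summable, ?_⟩
  rw [h1.tsum_eq, h2.tsum_eq, ← integral_const_mul]
  have h3 : (fun x => (starRingEnd ℂ) (U x) * ((a x : ℂ) * U x)) = fun x => ((a x * ‖U x‖ ^ 2 : ℝ) : ℂ) := by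
    funext x
    rw [Complex.ofReal_mul, ← Complex.normSq_eq_norm_sq, ← Complex.mul_conj]; ring
  rw [h3]
  have h4 : (∫ x, ((a x * ‖U x‖ ^ 2 : ℝ) : ℂ) ∂(muB d)).re = ∫ x, a x * ‖U x‖ ^ 2 ∂(muB d) :=
    (congrArg Complex.re (integral_ofReal (𝕜 := ℂ) (f := fun x => a x * ‖U x‖ ^ 2)))
  rw [h4]
  have hi := hU.integrable_norm_pow (p := 2) (by norm_num)
  refine integral_mono (hi.const_mul _) ?_ (fun x => mul_le_mul_of_nonneg_right (hm x) (by positivity))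
  refine hi.bdd_mul (c := K) ha.aestronglyMeasurable (Filter.Eventually.of_forall hK)

/-- commutator error -/
def Er {d : ℕ} (a : Td d → ℝ) (w : (Fin d → ℤ) → ℝ) (v : Td d → ℂ) (k : Fin d → ℤ) : ℂ :=
  ∑' l, fCoeff a (k - l) * (((w k - w l : ℝ) : ℂ) * fc v l)

theorem summable_weight {d : ℕ} {w : (Fin d → ℤ) → ℝ} {W : ℝ} (hw : ∀ k, |w k| ≤ W)
    {u : (Fin d → ℤ) → ℂ} (hu : Summable fun k => ‖u k‖ ^ 2) : Summable fun k => ‖(w k : ℂ) * u k‖ ^ 2 := by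
  refine Summable.of_nonneg_of_le (fun k => by positivity) (fun k => ?_) (hu.mul_left (W ^ 2))
  rw [norm_mul, mul_pow, Complex.norm_real, Real.norm_eq_abs]
  gcongr
  exact hw k

theorem Er_split {d : ℕ} {a : Td d → ℝ} (ha : Continuous a) {K : ℝ} (hK : ∀ x, |a x| ≤ K)
    {w : (Fin d → ℤ) → ℝ} {W : ℝ} (hw : ∀ k, |w k| ≤ W)
    {v : Td d → ℂ} (hv : MemLp v 2 (muB d)) (k : Fin d → ℤ) :
    (w k : ℂ) * fc (fun x => (a x : ℂ) * v x) k = Tm a (fun l => (w l : ℂ) * fc v l) k + Er a w v k := by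
  have h1 := conv_fc ha hK hv k
  have h2 := Tm_summable ha hK (summable_weight hw (parseval_sq hv).summable) k
  have h3 : Summable (fun l => fCoeff a (k - l) * (((w k - w l : ℝ) : ℂ) * fc v l)) := by
    refine ((h1.summable.mul_left (w k : ℂ)).sub h2).congr fun l => ?_
    push_cast; ring
  rw [Tm, Er, ← h2.tsum_add h3, ← h1.tsum_eq, ← tsum_mul_left]
  congr 1
  funext l
  push_cast; ring

theorem enorm_Er_le {d : ℕ} (a : Td d → ℝ) (w : (Fin d → ℤ) → ℝ) (v : Td d → ℂ) (k : Fin d → ℤ) :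
    ‖Er a w v k‖ₑ ≤ ∑' l, ENNReal.ofReal (|w k - w l| * ‖fCoeff a (k - l)‖ * ‖fc v l‖) := by
  refine (enorm_tsum_le_tsum_enorm).trans (le_of_eq ?_)
  congr 1
  funext l
  rw [← ofReal_norm_eq_enorm, norm_mul, norm_mul, Complex.norm_real, Real.norm_eq_abs]
  congr 1; ring

/-! ### Part 3: lattice sums, weights and the convolution lemma -/

theorem enn_cs {ι : Type*} (x y : ι → ENNReal) :
    (∑' i, x i * y i) ^ 2 ≤ (∑' i, x i ^ 2) * (∑' i, y i ^ 2) := by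
  let _ : MeasurableSpace ι := ⊤
  have h := ENNReal.lintegral_mul_le_Lp_mul_Lq (Measure.count : Measure ι)
    (p := 2) (q := 2) (Real.holderConjugate_iff.2 (by norm_num)) (f := x) (g := y)
    measurable_from_top.aemeasurable measurable_from_top.aemeasurable
  simp only [lintegral_count, Pi.mul_apply] at h
  calc (∑' i, x i * y i) ^ 2 ≤ ((∑' i, x i ^ (2:ℝ)) ^ (1 / (2:ℝ)) * (∑' i, y i ^ (2:ℝ)) ^ (1 / (2:ℝ))) ^ 2 := by
        gcongr
    _ = _ := by
        rw [mul_pow]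
        simp only [← ENNReal.rpow_natCast, ← ENNReal.rpow_mul]
        norm_num

theorem enn_two_sq (x y : ENNReal) : (x + y) ^ 2 ≤ 2 * x ^ 2 + 2 * y ^ 2 := by
  have h := ENNReal.rpow_add_le_mul_rpow_add_rpow x y (p := 2) (by norm_num)
  have h2 : (2:ENNReal) ^ ((2:ℝ) - 1) = 2 := by norm_num
  rw [h2] at h
  simp only [ENNReal.rpow_ofNat] at h
  rw [mul_add] at h; exact h

/-- bracket squared -/
def br {d : ℕ} (k : Fin d → ℤ) : ℝ := 1 + ∑ i, ((k i : ℝ)) ^ 2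

/-- bracket -/
def jb {d : ℕ} (k : Fin d → ℤ) : ℝ := Real.sqrt (br k)

theorem wt_eq {d : ℕ} (s : ℝ) (k : Fin d → ℤ) : wt s k = br k ^ s := rfl

theorem br_ge_one {d : ℕ} (k : Fin d → ℤ) : 1 ≤ br k := by
  have : 0 ≤ ∑ i, ((k i : ℝ)) ^ 2 := Finset.sum_nonneg fun i _ => by positivity
  unfold br; linarith

theorem jb_ge_one {d : ℕ} (k : Fin d → ℤ) : 1 ≤ jb k := Real.one_le_sqrt.2 (br_ge_one k)

theorem jb_pos {d : ℕ} (k : Fin d → ℤ) : 0 < jb k := lt_of_lt_of_le one_pos (jb_ge_one k)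

theorem jb_sq {d : ℕ} (k : Fin d → ℤ) : jb k ^ 2 = br k :=
  Real.sq_sqrt (by linarith [br_ge_one k])

theorem wt_jb {d : ℕ} (s : ℝ) (k : Fin d → ℤ) : wt s k = jb k ^ (2 * s) := by
  rw [wt_eq, ← jb_sq, ← Real.rpow_natCast (jb k) 2, ← Real.rpow_mul (jb_pos k).le]
  norm_num

theorem wt_pos {d : ℕ} (s : ℝ) (k : Fin d → ℤ) : 0 < wt s k :=
  Real.rpow_pos_of_pos (lt_of_lt_of_le one_pos (br_ge_one k)) _

theorem wt_mono {d : ℕ} {s t : ℝ} (h : s ≤ t) (k : Fin d → ℤ) : wt s k ≤ wt t k :=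
  Real.rpow_le_rpow_of_exponent_le (br_ge_one k) h

theorem wt_add {d : ℕ} (s t : ℝ) (k : Fin d → ℤ) : wt (s + t) k = wt s k * wt t k :=
  Real.rpow_add (lt_of_lt_of_le one_pos (br_ge_one k)) _ _

theorem br_neg {d : ℕ} (k : Fin d → ℤ) : br (-k) = br k := by simp [br]

theorem jb_neg {d : ℕ} (k : Fin d → ℤ) : jb (-k) = jb k := by simp [jb, br_neg]

theorem jb_add {d : ℕ} (l m : Fin d → ℤ) : jb (l + m) ≤ jb l + jb m := by
  have h1 := jb_pos l
  have h2 := jb_pos m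
  refine Real.sqrt_le_iff.2 ⟨by positivity, ?_⟩
  have hcs : (∑ i, (l i : ℝ) * (m i : ℝ)) ^ 2 ≤ (∑ i, (l i : ℝ) ^ 2) * ∑ i, (m i : ℝ) ^ 2 :=
    Finset.sum_mul_sq_le_sq_mul_sq _ _ _
  have hl := jb_sq l
  have hm := jb_sq m
  have hexp : br (l + m) = br l + br m + 2 * (∑ i, (l i : ℝ) * (m i : ℝ)) - 1 := by
    simp only [br, Pi.add_apply, Int.cast_add, add_sq, Finset.sum_add_distrib, Finset.mul_sum]
    have : ∑ i, 2 * (l i : ℝ) * (m i : ℝ) = ∑ i, 2 * ((l i : ℝ) * (m i : ℝ)) := by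
      refine Finset.sum_congr rfl fun i _ => by ring
    rw [this]; ring
  have h3 : (∑ i, (l i : ℝ) * (m i : ℝ)) ≤ jb l * jb m := by
    refine le_trans (le_abs_self _) (abs_le_of_sq_le_sq (hcs.trans ?_) (by positivity))
    rw [mul_pow, hl, hm]
    have : 0 ≤ ∑ i, (l i : ℝ) ^ 2 := Finset.sum_nonneg fun i _ => by positivity
    have : 0 ≤ ∑ i, (m i : ℝ) ^ 2 := Finset.sum_nonneg fun i _ => by positivity
    unfold br; nlinarith
  nlinarith

theorem jb_sub {d : ℕ} (k l : Fin d → ℤ) : |jb k - jb l| ≤ jb (k - l) := by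
  rw [abs_le]
  have h1 := jb_add (k - l) l
  have h2 := jb_add (l - k) k
  have h3 := jb_neg (k - l)
  rw [neg_sub] at h3
  simp only [sub_add_cancel] at h1 h2
  constructor <;> linarith

/-! lattice sums -/

theorem sum_third (N : ℕ) : ∑ n ∈ Finset.Icc (-(N:ℤ)) N, (1 + (n:ℝ) ^ 2) ^ (-(1/3 : ℝ))
    ≤ 1 + 6 * (N : ℝ) ^ (1/3 : ℝ) := by
  induction N with
  | zero => simp
  | succ N ih =>
    have hstep : Finset.Icc (-((N + 1 : ℕ):ℤ)) ((N + 1 : ℕ):ℤ) = Finset.Icc (-(N:ℤ)) N ∪ {-(N + 1 : ℤ), (N + 1 : ℤ)} := by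
      have := Finset.Icc_succ_succ N N
      push_cast at this ⊢; exact this
    rw [hstep, Finset.sum_union (by simp), Finset.sum_pair (by lia)]
    have hv : (0:ℝ) ≤ (N : ℝ) ^ (1/3 : ℝ) := by positivity
    have hu : (0:ℝ) < ((N + 1 : ℕ) : ℝ) ^ (1/3 : ℝ) := by positivity
    have hv3 : ((N : ℝ) ^ (1/3 : ℝ)) ^ 3 = N := by
      rw [← Real.rpow_natCast, ← Real.rpow_mul (by positivity)]; norm_num
    have hu3 : (((N + 1 : ℕ) : ℝ) ^ (1/3 : ℝ)) ^ 3 = N + 1 := by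
      rw [← Real.rpow_natCast, ← Real.rpow_mul (by positivity)]; norm_num
    have hvu : (N : ℝ) ^ (1/3 : ℝ) ≤ ((N + 1 : ℕ) : ℝ) ^ (1/3 : ℝ) := by
      gcongr; simp
    have hg : (1 + ((N:ℝ) + 1) ^ 2) ^ (-(1/3 : ℝ)) ≤ ((((N + 1 : ℕ) : ℝ) ^ (1/3 : ℝ)) ^ 2)⁻¹ := by
      rw [Real.rpow_neg (by positivity)]
      refine inv_anti₀ (by positivity) ?_
      rw [← Real.rpow_natCast, ← Real.rpow_mul (by positivity), mul_comm, Real.rpow_mul (by positivity)]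
      gcongr
      push_cast
      rw [Real.rpow_ofNat]
      linarith [sq_nonneg ((N:ℝ) + 1)]
    set u := ((N + 1 : ℕ) : ℝ) ^ (1/3 : ℝ)
    set v := (N : ℝ) ^ (1/3 : ℝ)
    have hkey : (u ^ 2)⁻¹ ≤ 3 * (u - v) := by
      rw [inv_le_iff_one_le_mul₀ (by positivity)]
      nlinarith [mul_nonneg (sub_nonneg.2 hvu) (sq_nonneg (u - v)), mul_nonneg (sub_nonneg.2 hvu) (mul_nonneg hu.le hv), mul_nonneg (sub_nonneg.2 hvu) (mul_nonneg hu.le (sub_nonneg.2 hvu)), mul_nonneg (sub_nonneg.2 hvu) (mul_nonneg hv (sub_nonneg.2 hvu))]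
    have hc1 : ((-(N + 1 : ℤ) : ℤ) : ℝ) ^ 2 = ((N:ℝ) + 1) ^ 2 := by push_cast; ring
    have hc2 : (((N + 1 : ℤ) : ℤ) : ℝ) ^ 2 = ((N:ℝ) + 1) ^ 2 := by push_cast; ring
    rw [hc1, hc2]
    linarith

theorem mem_piBox {d : ℕ} {l m : Fin d → ℤ} (h : br l ≤ br m) :
    l ∈ Fintype.piFinset (fun _ : Fin d => Finset.Icc (-(⌊jb m⌋₊ : ℤ)) (⌊jb m⌋₊ : ℤ)) := by
  rw [Fintype.mem_piFinset]
  intro i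
  have h1 : |(l i : ℝ)| ≤ jb m := by
    refine abs_le_of_sq_le_sq ?_ (jb_pos m).le
    rw [jb_sq]
    refine le_trans ?_ h
    have : (l i : ℝ) ^ 2 ≤ ∑ i, (l i : ℝ) ^ 2 :=
      Finset.single_le_sum (f := fun i => (l i : ℝ) ^ 2) (fun i _ => by positivity) (Finset.mem_univ i)
    unfold br; linarith
  have h2 : (l i).natAbs ≤ ⌊jb m⌋₊ := by
    refine Nat.le_floor ?_
    rw [Nat.cast_natAbs]; push_cast; exact h1
  rw [Finset.mem_Icc]; omega

theorem tsum_low_le {d : ℕ} (g : (Fin d → ℤ) → ℝ) (hg : ∀ l, 0 ≤ g l) (γ : ℤ → ℝ) (hγ : ∀ l : Fin d → ℤ, g l ≤ ∏ i, γ (l i))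
     (m : Fin d → ℤ) :
    ∑' l, (if br l ≤ br m then ENNReal.ofReal (g l) else 0) ≤
      ENNReal.ofReal ((∑ n ∈ Finset.Icc (-(⌊jb m⌋₊ : ℤ)) (⌊jb m⌋₊ : ℤ), γ n) ^ d) := by
  set B := Fintype.piFinset (fun _ : Fin d => Finset.Icc (-(⌊jb m⌋₊ : ℤ)) (⌊jb m⌋₊ : ℤ))
  calc ∑' l, (if br l ≤ br m then ENNReal.ofReal (g l) else 0)
      = ∑ l ∈ B, (if br l ≤ br m then ENNReal.ofReal (g l) else 0) := by
        refine tsum_eq_sum fun l hl => ?_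
        rw [if_neg]; intro h; exact hl (mem_piBox h)
    _ ≤ ∑ l ∈ B, ENNReal.ofReal (∏ i, γ (l i)) := by
        refine Finset.sum_le_sum fun l _ => ?_
        split_ifs
        · exact ENNReal.ofReal_le_ofReal (hγ l)
        · exact bot_le
    _ = ENNReal.ofReal (∑ l ∈ B, ∏ i, γ (l i)) := by
        rw [ENNReal.ofReal_sum_of_nonneg]
        intro l _; exact (hg l).trans (hγ l)
    _ = _ := by
        have := Finset.prod_univ_sum (fun _ : Fin d => Finset.Icc (-(⌊jb m⌋₊ : ℤ)) (⌊jb m⌋₊ : ℤ)) (fun _ n => γ n)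
        rw [← this]; simp

theorem low0 {d : ℕ} (hd : d ≤ 3) (m : Fin d → ℤ) :
    ∑' l, (if br l ≤ br m then ENNReal.ofReal ((fun _ : Fin d → ℤ => (1:ℝ)) l) else 0) ≤ ENNReal.ofReal (343 * jb m ^ 3) := by
  refine (tsum_low_le (fun _ => 1) (fun _ => zero_le_one) (fun _ => 1) (by simp) m).trans (ENNReal.ofReal_le_ofReal ?_)
  have h1 := jb_ge_one m
  have h2 : (⌊jb m⌋₊ : ℝ) ≤ jb m := Nat.floor_le (jb_pos m).le
  have h3 : ∑ n ∈ Finset.Icc (-(⌊jb m⌋₊ : ℤ)) (⌊jb m⌋₊ : ℤ), (1:ℝ) ≤ 3 * jb m := by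
    simp only [Finset.sum_const, Int.card_Icc, nsmul_eq_mul, mul_one]
    have : (((⌊jb m⌋₊:ℤ) + 1 - (-(⌊jb m⌋₊:ℤ))).toNat : ℝ) = 2 * ⌊jb m⌋₊ + 1 := by
      have h : (((⌊jb m⌋₊:ℤ) + 1 - (-(⌊jb m⌋₊:ℤ))).toNat) = 2 * ⌊jb m⌋₊ + 1 := by lia
      rw [h]; push_cast; ring
    rw [this]; linarith
  calc _ ≤ (3 * jb m) ^ d := by gcongr
    _ ≤ (3 * jb m) ^ 3 := pow_le_pow_right₀ (by linarith) hd
    _ ≤ _ := by rw [mul_pow]; gcongr; norm_num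

theorem low1 {d : ℕ} (hd : d ≤ 3) (m : Fin d → ℤ) :
    ∑' l, (if br l ≤ br m then ENNReal.ofReal ((fun l : Fin d → ℤ => (br l)⁻¹) l) else 0) ≤ ENNReal.ofReal (343 * jb m) := by
  have h1 := jb_ge_one m
  refine (tsum_low_le (fun l => (br l)⁻¹) (fun l => by have := br_ge_one l; positivity) (fun n => (1 + (n:ℝ)^2) ^ (-(1/3:ℝ))) ?_ m).trans (ENNReal.ofReal_le_ofReal ?_)
  · intro l
    have hb := br_ge_one l
    calc (br l)⁻¹ = br l ^ (-1:ℝ) := (Real.rpow_neg_one _).symm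
      _ ≤ br l ^ (-(1/3:ℝ) * d) := by
        refine Real.rpow_le_rpow_of_exponent_le hb ?_
        have : (d:ℝ) ≤ 3 := by exact_mod_cast hd
        linarith
      _ = ∏ i : Fin d, br l ^ (-(1/3:ℝ)) := by
        rw [Real.rpow_mul (by linarith)]; simp
      _ ≤ _ := by
        refine Finset.prod_le_prod (fun i _ => by positivity) fun i _ => ?_
        refine Real.rpow_le_rpow_of_nonpos (by positivity) ?_ (by norm_num)
        have : (l i : ℝ) ^ 2 ≤ ∑ i, (l i : ℝ) ^ 2 :=
          Finset.single_le_sum (f := fun i => (l i : ℝ) ^ 2) (fun i _ => by positivity) (Finset.mem_univ i)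
        unfold br; linarith
  · have h2 : (⌊jb m⌋₊ : ℝ) ≤ jb m := Nat.floor_le (jb_pos m).le
    have h4 : 1 ≤ jb m ^ (1/3:ℝ) := Real.one_le_rpow h1 (by norm_num)
    have h3 : ∑ n ∈ Finset.Icc (-(⌊jb m⌋₊ : ℤ)) (⌊jb m⌋₊ : ℤ), (1 + (n:ℝ)^2) ^ (-(1/3:ℝ)) ≤ 7 * jb m ^ (1/3:ℝ) := by
      refine (sum_third _).trans ?_
      have : (⌊jb m⌋₊ : ℝ) ^ (1/3:ℝ) ≤ jb m ^ (1/3:ℝ) := by gcongr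
      linarith
    calc _ ≤ (7 * jb m ^ (1/3:ℝ)) ^ d := by
          gcongr
      _ ≤ (7 * jb m ^ (1/3:ℝ)) ^ 3 := pow_le_pow_right₀ (by linarith) hd
      _ = _ := by
        rw [mul_pow, ← Real.rpow_natCast (jb m ^ (1/3:ℝ)), ← Real.rpow_mul (jb_pos m).le]; norm_num

/-- convolution restricted to the region where the index `l` is the smaller one -/
theorem conv_low {d : ℕ} (f g : (Fin d → ℤ) → ENNReal) (ω : (Fin d → ℤ) → ℝ) (hω : ∀ l, 0 < ω l)
    (D : (Fin d → ℤ) → ENNReal)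
    (hD : ∀ m, ∑' l, (if br l ≤ br m then ENNReal.ofReal ((fun l => (ω l)⁻¹) l) else 0) ≤ D m) :
    ∑' k, (∑' l, if br l ≤ br (k - l) then g (k - l) * f l else 0) ^ 2 ≤
      (∑' l, ENNReal.ofReal (ω l) * f l ^ 2) * ∑' m, D m * g m ^ 2 := by
  have hw : ∀ l, ENNReal.ofReal (√(ω l)) * ENNReal.ofReal (√(ω l)⁻¹) = 1 := by
    intro l
    rw [← ENNReal.ofReal_mul (Real.sqrt_nonneg _), mul_comm, Real.sqrt_inv, inv_mul_cancel₀ (Real.sqrt_pos.2 (hω l)).ne',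
      ENNReal.ofReal_one]
  have h1 : ∀ k, (∑' l, if br l ≤ br (k - l) then g (k - l) * f l else 0) ^ 2 ≤
      (∑' l, ENNReal.ofReal (ω l) * f l ^ 2) *
      ∑' l, (if br l ≤ br (k - l) then ENNReal.ofReal ((ω l)⁻¹) else 0) * g (k - l) ^ 2 := by
    intro k
    refine le_trans (le_of_eq ?_) ((enn_cs (fun l => ENNReal.ofReal (√(ω l)) * f l)
      (fun l => if br l ≤ br (k - l) then ENNReal.ofReal (√(ω l)⁻¹) * g (k - l) else 0)).trans (le_of_eq ?_))
    · congr 2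
      funext l
      split_ifs
      · calc g (k - l) * f l = (ENNReal.ofReal (√(ω l)) * ENNReal.ofReal (√(ω l)⁻¹)) * (g (k - l) * f l) := by
              rw [hw, one_mul]
          _ = _ := by ring
      · simp
    · congr 1
      · congr 1; funext l
        rw [mul_pow, ← ENNReal.ofReal_pow (Real.sqrt_nonneg _), Real.sq_sqrt (hω l).le]
      · congr 1; funext l
        split_ifs
        · rw [mul_pow, ← ENNReal.ofReal_pow (Real.sqrt_nonneg _), Real.sq_sqrt (inv_nonneg.2 (hω l).le)]
        · simp
  refine (ENNReal.tsum_le_tsum h1).trans ?_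
  rw [ENNReal.tsum_mul_left]
  refine mul_le_mul' le_rfl ?_
  rw [ENNReal.tsum_comm]
  have h2 : ∀ l, ∑' k, (if br l ≤ br (k - l) then ENNReal.ofReal ((ω l)⁻¹) else 0) * g (k - l) ^ 2
      = ∑' m, (if br l ≤ br m then ENNReal.ofReal ((ω l)⁻¹) else 0) * g m ^ 2 := by
    intro l
    exact (Equiv.subRight l).tsum_eq (fun m => (if br l ≤ br m then ENNReal.ofReal ((ω l)⁻¹) else 0) * g m ^ 2)
  simp only [h2]
  rw [ENNReal.tsum_comm]
  refine ENNReal.tsum_le_tsum fun m => ?_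
  rw [ENNReal.tsum_mul_right]
  exact mul_le_mul' (hD m) le_rfl

/-- convolution restricted to the region where `k - l` is the smaller one -/
theorem conv_low' {d : ℕ} (f g : (Fin d → ℤ) → ENNReal) (ω : (Fin d → ℤ) → ℝ) (hω : ∀ l, 0 < ω l)
    (D : (Fin d → ℤ) → ENNReal)
    (hD : ∀ m, ∑' l, (if br l ≤ br m then ENNReal.ofReal ((fun l => (ω l)⁻¹) l) else 0) ≤ D m) :
    ∑' k, (∑' l, if br (k - l) ≤ br l then f (k - l) * g l else 0) ^ 2 ≤
      (∑' l, ENNReal.ofReal (ω l) * f l ^ 2) * ∑' m, D m * g m ^ 2 := by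
  refine le_trans (le_of_eq ?_) (conv_low f g ω hω D hD)
  congr 1; funext k; congr 1
  rw [← (Equiv.subLeft k).tsum_eq]
  congr 1; funext l
  simp [mul_comm]

/-! ### Part 4: truncated weights and the commutator estimate -/

/-- truncated weight -/
def wR {d : ℕ} (σ R : ℝ) (k : Fin d → ℤ) : ℝ := (min (jb k) R) ^ σ

/-- weighted square sum, in `[0,∞]` -/
def SL {d : ℕ} (W : (Fin d → ℤ) → ℝ) (u : (Fin d → ℤ) → ℂ) : ENNReal :=
  ∑' k, ENNReal.ofReal (W k * ‖u k‖ ^ 2)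

/-- drop the zero mode -/
def nz {d : ℕ} (u : (Fin d → ℤ) → ℂ) (k : Fin d → ℤ) : ℂ := if k = 0 then 0 else u k

theorem one_sub_rpow_le {σ t : ℝ} (ht : 0 ≤ t) (ht1 : t ≤ 1) :
    1 - t ^ σ ≤ max 1 σ * (1 - t) := by
  rcases le_total σ 1 with h | h
  · rw [max_eq_left h]
    have : t ≤ t ^ σ := Real.self_le_rpow_of_le_one ht ht1 h
    linarith
  · rw [max_eq_right h]
    have := one_add_mul_self_le_rpow_one_add (s := t - 1) (by linarith) h
    rw [add_sub_cancel] at this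
    linarith

theorem rpow_sub_le {σ a b : ℝ} (ha : 0 < a) (hab : a ≤ b) :
    b ^ σ - a ^ σ ≤ max 1 σ * b ^ σ * ((b - a) / b) := by
  have hb : 0 < b := lt_of_lt_of_le ha hab
  have h := one_sub_rpow_le (σ := σ) (div_nonneg ha.le hb.le) ((div_le_one hb).2 hab)
  rw [Real.div_rpow ha.le hb.le] at h
  have hbs : 0 < b ^ σ := by positivity
  have h2 := mul_le_mul_of_nonneg_left h hbs.le
  have e1 : b ^ σ * (1 - a ^ σ / b ^ σ) = b ^ σ - a ^ σ := by field_simp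
  have e2 : (b - a) / b = 1 - a / b := by field_simp
  rw [e1] at h2; rw [e2]; linarith

theorem wR_pos {d : ℕ} {σ R : ℝ} (hR : 1 ≤ R) (k : Fin d → ℤ) : 0 < wR σ R k :=
  Real.rpow_pos_of_pos (lt_min (jb_pos k) (by linarith)) _

theorem wR_le_R {d : ℕ} {σ R : ℝ} (hσ : 0 ≤ σ) (hR : 1 ≤ R) (k : Fin d → ℤ) : wR σ R k ≤ R ^ σ :=
  Real.rpow_le_rpow (le_min (jb_pos k).le (by linarith)) (min_le_right _ _) hσ

theorem wR_le_jb {d : ℕ} {σ R : ℝ} (hσ : 0 ≤ σ) (hR : 1 ≤ R) (k : Fin d → ℤ) : wR σ R k ≤ jb k ^ σ :=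
  Real.rpow_le_rpow (le_min (jb_pos k).le (by linarith)) (min_le_left _ _) hσ

theorem jb_sq_rpow {d : ℕ} (σ : ℝ) (k : Fin d → ℤ) : (jb k ^ σ) ^ 2 = wt σ k := by
  rw [wt_jb, ← Real.rpow_natCast, ← Real.rpow_mul (jb_pos k).le]; congr 1; push_cast; ring

theorem wR_abs_le {d : ℕ} {σ R : ℝ} (hσ : 0 ≤ σ) (hR : 1 ≤ R) (k : Fin d → ℤ) : |wR σ R k| ≤ R ^ σ := by
  rw [abs_of_pos (wR_pos hR k)]; exact wR_le_R hσ hR k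

theorem wR_sq_le {d : ℕ} {σ R : ℝ} (hσ : 0 ≤ σ) (hR : 1 ≤ R) (k : Fin d → ℤ) : wR σ R k ^ 2 ≤ wt σ k := by
  rw [← jb_sq_rpow]
  exact pow_le_pow_left₀ (wR_pos hR k).le (wR_le_jb hσ hR k) 2

theorem wR_H1 {d : ℕ} {σ R : ℝ} (hσ : 0 ≤ σ) (hR : 1 ≤ R) (k l : Fin d → ℤ) (h : jb (k - l) ≤ jb l) :
    |wR σ R k - wR σ R l| ≤ max 1 σ * 2 ^ σ * (jb (k - l) * (wR σ R l / jb l)) := by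
  have hk := jb_pos k
  have hl := jb_pos l
  have hm := jb_pos (k - l)
  have hR0 : 0 < R := by linarith
  have hs := abs_le.1 (jb_sub k l)
  unfold wR
  set x := min (jb k) R with hx
  set y := min (jb l) R with hy
  have hx0 : 0 < x := lt_min hk hR0
  have hy0 : 0 < y := lt_min hl hR0
  have hxy : x ≤ 2 * y := by
    rw [hx, hy]
    rcases le_total (jb l) R with h1 | h1
    · rw [min_eq_left h1]; exact (min_le_left _ _).trans (by linarith)
    · rw [min_eq_right h1]; exact (min_le_right _ _).trans (by linarith)
  have hp : 1 ≤ max 1 σ := le_max_left _ _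
  have h2 : (1:ℝ) ≤ 2 ^ σ := Real.one_le_rpow (by norm_num) hσ
  rcases le_total x y with hc | hc
  · rw [abs_sub_comm, abs_of_nonneg (sub_nonneg.2 (Real.rpow_le_rpow hx0.le hc hσ))]
    have h3 : (y - x) / y ≤ jb (k - l) / jb l := by
      rw [div_le_div_iff₀ hy0 hl]
      rcases le_total (jb k) R with h4 | h4
      · have : x = jb k := min_eq_left h4
        rw [this]
        have : y ≤ jb l := min_le_left _ _
        nlinarith
      · have : x = R := min_eq_right h4
        have : y ≤ R := min_le_right _ _
        have : y - x ≤ 0 := by linarith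
        have : (y - x) * jb l ≤ 0 := mul_nonpos_of_nonpos_of_nonneg this hl.le
        have : 0 < jb (k - l) * y := by positivity
        linarith
    calc y ^ σ - x ^ σ ≤ max 1 σ * y ^ σ * ((y - x) / y) := rpow_sub_le hx0 hc
      _ ≤ max 1 σ * y ^ σ * (jb (k - l) / jb l) := by gcongr
      _ = max 1 σ * 1 * (jb (k - l) * (y ^ σ / jb l)) := by ring
      _ ≤ _ := by gcongr
  · rw [abs_of_nonneg (sub_nonneg.2 (Real.rpow_le_rpow hy0.le hc hσ))]
    have h3 : (x - y) / x ≤ jb (k - l) / jb l := by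
      rw [div_le_div_iff₀ hx0 hl]
      rcases le_total (jb l) R with h4 | h4
      · have e : y = jb l := min_eq_left h4
        have : x ≤ jb k := min_le_left _ _
        have h5 : x - y ≤ jb (k - l) := by linarith
        have h6 : jb l ≤ x := by linarith
        have : 0 ≤ x - y := by linarith
        nlinarith
      · have e : y = R := min_eq_right h4
        have : x ≤ R := min_le_right _ _
        have : x - y ≤ 0 := by linarith
        have : (x - y) * jb l ≤ 0 := mul_nonpos_of_nonpos_of_nonneg this hl.le
        have : 0 < jb (k - l) * x := by positivity
        linarith
    calc x ^ σ - y ^ σ ≤ max 1 σ * x ^ σ * ((x - y) / x) := rpow_sub_le hy0 hc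
      _ ≤ max 1 σ * (2 * y) ^ σ * (jb (k - l) / jb l) := by gcongr
      _ = _ := by rw [Real.mul_rpow (by norm_num) hy0.le]; ring

theorem wR_H2 {d : ℕ} {σ R : ℝ} (hσ : 0 ≤ σ) (hR : 1 ≤ R) (k l : Fin d → ℤ) (h : jb l ≤ jb (k - l)) :
    |wR σ R k - wR σ R l| ≤ 2 ^ σ * jb (k - l) ^ σ := by
  have hk := jb_pos k
  have hl := jb_pos l
  have hm := jb_pos (k - l)
  have hs := abs_le.1 (jb_sub k l)
  have h1 : wR σ R k ≤ (2 * jb (k - l)) ^ σ := (wR_le_jb hσ hR k).trans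
    (Real.rpow_le_rpow hk.le (by linarith) hσ)
  have h2 : wR σ R l ≤ (2 * jb (k - l)) ^ σ := (wR_le_jb hσ hR l).trans
    (Real.rpow_le_rpow hl.le (by linarith) hσ)
  rw [← Real.mul_rpow (by norm_num) hm.le, abs_le]
  have := wR_pos (σ := σ) hR k
  have := wR_pos (σ := σ) hR l
  constructor <;> linarith

theorem jb_le_iff {d : ℕ} (k l : Fin d → ℤ) : jb k ≤ jb l ↔ br k ≤ br l :=
  Real.sqrt_le_sqrt_iff (by linarith [br_ge_one l])

theorem lowt {d : ℕ} (hd : d ≤ 3) {τ : ℝ} (hτ : τ = 0 ∨ τ = 1) (m : Fin d → ℤ) :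
    ∑' l, (if br l ≤ br m then ENNReal.ofReal ((fun l : Fin d → ℤ => (wt τ l)⁻¹) l) else 0)
      ≤ ENNReal.ofReal (343 * wt (3 / 2 - τ) m) := by
  rcases hτ with rfl | rfl
  · have e : wt (3 / 2 - 0) m = jb m ^ 3 := by
      rw [wt_jb]; norm_num
    rw [e]
    refine le_trans (le_of_eq ?_) (low0 hd m)
    simp [wt_jb]
  · have e : wt (3 / 2 - 1) m = jb m := by
      rw [wt_jb]; norm_num
    rw [e]
    refine le_trans (le_of_eq ?_) (low1 hd m)
    simp [wt_eq]

theorem ofReal_mul_sq (x y : ℝ) (hx : 0 ≤ x) (hy : 0 ≤ y) :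
    ENNReal.ofReal x * ENNReal.ofReal y ^ 2 = ENNReal.ofReal (x * y ^ 2) := by
  rw [ENNReal.ofReal_mul hx, ENNReal.ofReal_pow hy]

theorem comm_est {d : ℕ} (hd : d ≤ 3) {σ R τ : ℝ} (hσ : 0 ≤ σ) (hR : 1 ≤ R) (hτ : τ = 0 ∨ τ = 1)
    (a : Td d → ℝ) (v : Td d → ℂ) :
    SL (fun _ => 1) (Er a (wR σ R) v) ≤
      ENNReal.ofReal (686 * (max 1 σ * 2 ^ σ) ^ 2) * (SL (wt 2) (nz (fCoeff a)) *
        SL (fun l => wR σ R l ^ 2 * (jb l)⁻¹) (fc v)) +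
      ENNReal.ofReal (686 * (2 ^ σ) ^ 2) * (SL (wt τ) (fc v) * SL (wt (σ + (3 / 2 - τ))) (nz (fCoeff a))) := by
  set α := nz (fCoeff a) with hα
  set K := max 1 σ * 2 ^ σ with hKdef
  have hK : 0 ≤ K := by positivity
  set f1 : (Fin d → ℤ) → ENNReal := fun m => ENNReal.ofReal (jb m * ‖α m‖) with hf1
  set g1 : (Fin d → ℤ) → ENNReal := fun l => ENNReal.ofReal (K * (wR σ R l / jb l) * ‖fc v l‖) with hg1
  set f2 : (Fin d → ℤ) → ENNReal := fun l => ENNReal.ofReal ‖fc v l‖ with hf2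
  set g2 : (Fin d → ℤ) → ENNReal := fun m => ENNReal.ofReal (2 ^ σ * jb m ^ σ * ‖α m‖) with hg2
  have hpt : ∀ k, ENNReal.ofReal (1 * ‖Er a (wR σ R) v k‖ ^ 2) ≤
      2 * (∑' l, if br (k - l) ≤ br l then f1 (k - l) * g1 l else 0) ^ 2 +
      2 * (∑' l, if br l ≤ br (k - l) then g2 (k - l) * f2 l else 0) ^ 2 := by
    intro k
    rw [one_mul, ENNReal.ofReal_pow (norm_nonneg _), ofReal_norm]
    refine le_trans (pow_le_pow_left' ?_ 2) (enn_two_sq _ _)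
    refine (enorm_Er_le a (wR σ R) v k).trans ?_
    rw [← ENNReal.tsum_add]
    refine ENNReal.tsum_le_tsum fun l => ?_
    have hjl := jb_pos l
    have hjm := jb_pos (k - l)
    have hwl := wR_pos (σ := σ) hR l
    by_cases hkl : k - l = 0
    · have : k = l := sub_eq_zero.1 hkl
      subst this
      simp
    have hαm : α (k - l) = fCoeff a (k - l) := by rw [hα]; simp [nz, hkl]
    rcases le_total (br (k - l)) (br l) with h | h
    · refine le_trans ?_ le_self_add
      rw [if_pos h, hf1, hg1]
      simp only
      rw [← ENNReal.ofReal_mul (by positivity), hαm]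
      refine ENNReal.ofReal_le_ofReal ?_
      have := wR_H1 hσ hR k l ((jb_le_iff _ _).2 h)
      calc _ ≤ K * (jb (k - l) * (wR σ R l / jb l)) * ‖fCoeff a (k - l)‖ * ‖fc v l‖ := by gcongr
        _ = _ := by ring
    · refine le_trans ?_ le_add_self
      rw [if_pos h, hf2, hg2]
      simp only
      rw [← ENNReal.ofReal_mul (by positivity), hαm]
      refine ENNReal.ofReal_le_ofReal ?_
      have := wR_H2 hσ hR k l ((jb_le_iff _ _).2 h)
      gcongr
  refine (ENNReal.tsum_le_tsum hpt).trans ?_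
  rw [ENNReal.tsum_add, ENNReal.tsum_mul_left, ENNReal.tsum_mul_left]
  have e1 := conv_low' f1 g1 br (fun l => by linarith [br_ge_one l]) (fun m => ENNReal.ofReal (343 * jb m)) (low1 hd)
  have e2 := conv_low f2 g2 (wt τ) (fun l => wt_pos τ l) (fun m => ENNReal.ofReal (343 * wt (3 / 2 - τ) m)) (lowt hd hτ)
  refine add_le_add ?_ ?_
  · refine (mul_le_mul' le_rfl e1).trans (le_of_eq ?_)
    have a1 : (∑' l, ENNReal.ofReal (br l) * f1 l ^ 2) = SL (wt 2) α := by
      unfold SL; congr 1; funext l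
      rw [hf1]; simp only
      have := br_ge_one l
      have := jb_pos l
      rw [ofReal_mul_sq _ _ (by linarith) (by positivity), mul_pow, jb_sq, wt_eq]
      congr 1; norm_num; ring
    have a2 : (∑' m, ENNReal.ofReal (343 * jb m) * g1 m ^ 2) = ENNReal.ofReal (343 * K ^ 2) * SL (fun l => wR σ R l ^ 2 * (jb l)⁻¹) (fc v) := by
      unfold SL; rw [← ENNReal.tsum_mul_left]; congr 1; funext l
      have := jb_pos l
      have := wR_pos (σ := σ) hR l
      rw [hg1]; simp only
      rw [ofReal_mul_sq _ _ (by positivity) (by positivity), ← ENNReal.ofReal_mul (by positivity)]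
      congr 1; field_simp
    rw [a1, a2]
    have : ENNReal.ofReal (686 * K ^ 2) = 2 * ENNReal.ofReal (343 * K ^ 2) := by
      have : (2:ENNReal) = ENNReal.ofReal 2 := by simp
      rw [this, ← ENNReal.ofReal_mul (by norm_num)]; congr 1; ring
    rw [this]; ring
  · refine (mul_le_mul' le_rfl e2).trans (le_of_eq ?_)
    have a1 : (∑' l, ENNReal.ofReal (wt τ l) * f2 l ^ 2) = SL (wt τ) (fc v) := by
      unfold SL; congr 1; funext l
      rw [hf2]; simp only
      rw [ofReal_mul_sq _ _ (wt_pos τ l).le (by positivity)]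
    have a2 : (∑' m, ENNReal.ofReal (343 * wt (3 / 2 - τ) m) * g2 m ^ 2) = ENNReal.ofReal (343 * (2 ^ σ) ^ 2) * SL (wt (σ + (3 / 2 - τ))) α := by
      unfold SL; rw [← ENNReal.tsum_mul_left]; congr 1; funext l
      have := jb_pos l
      have := wt_pos (3 / 2 - τ) l
      have h0 := wt_pos (σ + (3 / 2 - τ)) l
      rw [hg2]; simp only
      rw [ofReal_mul_sq _ _ (by positivity) (by positivity), ← ENNReal.ofReal_mul (by positivity)]
      rw [wt_add, ← jb_sq_rpow σ]
      congr 1; ring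
    rw [a1, a2]
    have : ENNReal.ofReal (686 * (2 ^ σ) ^ 2) = 2 * ENNReal.ofReal (343 * (2 ^ σ) ^ 2) := by
      have : (2:ENNReal) = ENNReal.ofReal 2 := by simp
      rw [this, ← ENNReal.ofReal_mul (by norm_num)]; congr 1; ring
    rw [this]; ring

theorem SL_mono {d : ℕ} {W W' : (Fin d → ℤ) → ℝ} (h : ∀ k, W k ≤ W' k) (u : (Fin d → ℤ) → ℂ) :
    SL W u ≤ SL W' u :=
  ENNReal.tsum_le_tsum fun k => ENNReal.ofReal_le_ofReal (mul_le_mul_of_nonneg_right (h k) (by positivity))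

theorem SL_wt_mono {d : ℕ} {s t : ℝ} (h : s ≤ t) (u : (Fin d → ℤ) → ℂ) : SL (wt s) u ≤ SL (wt t) u :=
  SL_mono (wt_mono h) u

theorem SL_nz_le {d : ℕ} {W : (Fin d → ℤ) → ℝ} (u : (Fin d → ℤ) → ℂ) :
    SL W (nz u) ≤ SL W u := by
  refine ENNReal.tsum_le_tsum fun k => ?_
  by_cases h : k = 0
  · simp [nz, h]
  · simp [nz, h]

theorem SL_const_mul {d : ℕ} (C : ℝ) (hC : 0 ≤ C) (W : (Fin d → ℤ) → ℝ) (u : (Fin d → ℤ) → ℂ) :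
    SL (fun k => C * W k) u = ENNReal.ofReal C * SL W u := by
  unfold SL
  rw [← ENNReal.tsum_mul_left]
  congr 1; funext k
  rw [← ENNReal.ofReal_mul hC]; congr 1; ring

theorem SL_add {d : ℕ} {W W' : (Fin d → ℤ) → ℝ} (h : ∀ k, 0 ≤ W k) (h' : ∀ k, 0 ≤ W' k) (u : (Fin d → ℤ) → ℂ) :
    SL (fun k => W k + W' k) u = SL W u + SL W' u := by
  unfold SL
  rw [← ENNReal.tsum_add]
  congr 1; funext k
  rw [add_mul, ENNReal.ofReal_add (mul_nonneg (h k) (by positivity)) (mul_nonneg (h' k) (by positivity))]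

theorem SL_wmul {d : ℕ} (w : (Fin d → ℤ) → ℝ) (u : (Fin d → ℤ) → ℂ) :
    SL (fun _ => 1) (fun k => (w k : ℂ) * u k) = SL (fun k => w k ^ 2) u := by
  unfold SL
  congr 1; funext k
  rw [norm_mul, mul_pow, Complex.norm_real, Real.norm_eq_abs, sq_abs, one_mul]

theorem SL_vadd {d : ℕ} {W : (Fin d → ℤ) → ℝ} (h : ∀ k, 0 ≤ W k) (u v : (Fin d → ℤ) → ℂ) :
    SL W (fun k => u k + v k) ≤ 2 * SL W u + 2 * SL W v := by
  unfold SL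
  rw [← ENNReal.tsum_mul_left, ← ENNReal.tsum_mul_left, ← ENNReal.tsum_add]
  refine ENNReal.tsum_le_tsum fun k => ?_
  have h2 : (2:ENNReal) = ENNReal.ofReal 2 := by simp
  have := h k
  rw [h2, ← ENNReal.ofReal_mul (by norm_num), ← ENNReal.ofReal_mul (by norm_num), ← ENNReal.ofReal_add (by positivity) (by positivity)]
  refine ENNReal.ofReal_le_ofReal ?_
  have h3 : ‖u k + v k‖ ^ 2 ≤ 2 * ‖u k‖ ^ 2 + 2 * ‖v k‖ ^ 2 := by
    have := norm_add_le (u k) (v k)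
    nlinarith [sq_nonneg (‖u k‖ - ‖v k‖), norm_nonneg (u k + v k)]
  nlinarith

theorem SL_eq_ofReal {d : ℕ} {W : (Fin d → ℤ) → ℝ} (h : ∀ k, 0 ≤ W k) {u : (Fin d → ℤ) → ℂ}
    (hs : Summable fun k => W k * ‖u k‖ ^ 2) : SL W u = ENNReal.ofReal (∑' k, W k * ‖u k‖ ^ 2) :=
  (ENNReal.ofReal_tsum_of_nonneg (fun k => mul_nonneg (h k) (by positivity)) hs).symm

theorem SL_summable {d : ℕ} {W : (Fin d → ℤ) → ℝ} (h : ∀ k, 0 ≤ W k) {u : (Fin d → ℤ) → ℂ}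
    (hs : SL W u ≠ ⊤) : Summable fun k => W k * ‖u k‖ ^ 2 := by
  have := ENNReal.summable_toReal hs
  refine this.congr fun k => ?_
  rw [ENNReal.toReal_ofReal (mul_nonneg (h k) (by positivity))]

theorem SL_le_real {d : ℕ} {W : (Fin d → ℤ) → ℝ} (h : ∀ k, 0 ≤ W k) {u : (Fin d → ℤ) → ℂ} {X : ℝ} (hX : 0 ≤ X)
    (hs : SL W u ≤ ENNReal.ofReal X) : ∑' k, W k * ‖u k‖ ^ 2 ≤ X := by
  have hs2 := SL_summable h (ne_top_of_le_ne_top ENNReal.ofReal_ne_top hs)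
  rw [SL_eq_ofReal h hs2] at hs
  exact (ENNReal.ofReal_le_ofReal_iff hX).1 hs

/-- the truncation parameter may be removed -/
theorem SL_sup {d : ℕ} {σ : ℝ} {u : (Fin d → ℤ) → ℂ} {X : ENNReal}
    (h : ∀ R : ℝ, 1 ≤ R → SL (fun k => wR σ R k ^ 2) u ≤ X) : SL (wt σ) u ≤ X := by
  unfold SL
  rw [ENNReal.tsum_eq_iSup_sum]
  refine iSup_le fun s => ?_
  set R := 1 + ∑ k ∈ s, jb k with hR
  have hR1 : 1 ≤ R := by
    have : 0 ≤ ∑ k ∈ s, jb k := Finset.sum_nonneg fun k _ => (jb_pos k).le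
    linarith
  refine le_trans (le_of_eq ?_) ((ENNReal.sum_le_tsum s).trans (h R hR1))
  refine Finset.sum_congr rfl fun k hk => ?_
  have : jb k ≤ R := by
    have := Finset.single_le_sum (f := fun k => jb k) (fun k _ => (jb_pos k).le) hk
    linarith
  simp only [wR]
  rw [min_eq_left this, jb_sq_rpow]

/-! ### Part 5: derivatives and periodicity -/

theorem per_bdd {d : ℕ} {E : Type*} [NormedAddCommGroup E] {f : Td d → E} (hf : Continuous f)
    (hp : ∀ (x : Td d) (k : Fin d → ℤ), f (fun i => x i + k i) = f x) : ∃ K, 0 ≤ K ∧ ∀ x, ‖f x‖ ≤ K := by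
  obtain ⟨K, hK⟩ := (isCompact_Icc (a := (0 : Td d)) (b := 1)).exists_bound_of_continuousOn hf.continuousOn
  refine ⟨max K 0, le_max_right _ _, fun x => ?_⟩
  have h1 := hp x (fun i => -⌊x i⌋)
  rw [← h1]
  refine (hK _ ⟨fun i => ?_, fun i => ?_⟩).trans (le_max_left _ _)
  · simp only [Pi.zero_apply]; push_cast; linarith [Int.floor_le (x i)]
  · simp only [Pi.one_apply]; push_cast; linarith [Int.lt_floor_add_one (x i)]

theorem per_bdd_real {d : ℕ} {f : Td d → ℝ} (hf : Continuous f) (hp : TPer f) : ∃ K, 0 ≤ K ∧ ∀ x, |f x| ≤ K :=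
  per_bdd hf hp

theorem le_linf {d : ℕ} {f : Td d → ℝ} (hf : Continuous f) (hp : TPer f) (x : Td d) : |f x| ≤ linf f := by
  obtain ⟨K, _, hK⟩ := per_bdd_real hf hp
  exact le_ciSup (f := fun x => |f x|) ⟨K, by rintro _ ⟨y, rfl⟩; exact hK y⟩ x

theorem linf_nonneg {d : ℕ} (f : Td d → ℝ) : 0 ≤ linf f := Real.iSup_nonneg fun _ => abs_nonneg _

theorem fderiv_per {d : ℕ} {E : Type*} [NormedAddCommGroup E] [NormedSpace ℝ E] {f : Td d → E}
    (hp : ∀ (x : Td d) (k : Fin d → ℤ), f (fun i => x i + k i) = f x) (x : Td d) (k : Fin d → ℤ) :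
    fderiv ℝ f (fun i => x i + k i) = fderiv ℝ f x := by
  have h : (fun y : Td d => f (y + fun i => (k i : ℝ))) = f := by
    funext y; exact hp y k
  have := fderiv_comp_add_right (𝕜 := ℝ) (f := f) (x := x) (fun i => (k i : ℝ))
  rw [h] at this
  exact this.symm

theorem TPer.pd {d : ℕ} {f : Td d → ℝ} (hp : TPer f) (i : Fin d) : TPer (pd i f) := by
  intro x k
  unfold _root_.pd
  rw [fderiv_per hp]

theorem contDiff_pd {d : ℕ} {f : Td d → ℝ} {n m : WithTop ℕ∞} (hf : ContDiff ℝ n f) (h : m + 1 ≤ n) (i : Fin d) :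
    ContDiff ℝ m (pd i f) :=
  (hf.fderiv_right h).clm_apply contDiff_const

theorem box_ae_Icc (d : ℕ) : box d =ᵐ[volume] Set.Icc (0 : Td d) 1 :=
  Measure.univ_pi_Ioc_ae_eq_Icc (μ := fun _ : Fin d => (volume : Measure ℝ)) (f := 0) (g := 1)

theorem integral_pd_zero {d : ℕ} {E : Type} [NormedAddCommGroup E] [NormedSpace ℝ E] [CompleteSpace E]
    {F : Td d → E} (hF : ContDiff ℝ 1 F)
    (hp : ∀ (x : Td d) (k : Fin d → ℤ), F (fun i => x i + k i) = F x) (i : Fin d) :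
    ∫ x, fderiv ℝ F x (Pi.single i 1) ∂(muB d) = 0 := by
  rw [setIntegral_congr_set (box_ae_Icc d)]
  cases d with
  | zero => exact i.elim0
  | succ n =>
    have hcont : Continuous fun x => fderiv ℝ F x (Pi.single i 1) :=
      (hF.continuous_fderiv (by norm_num)).clm_apply continuous_const
    have h := integral_divergence_of_hasFDerivAt_off_countable' (E := E) (0 : Td (n+1)) 1 zero_le_one
      (fun j => if j = i then F else 0) (fun j x => if j = i then fderiv ℝ F x else 0) ∅ Set.countable_empty
      (fun j => by
        by_cases hj : j = i
        · simp only [hj, if_true]; exact hF.continuous.continuousOn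
        · simp only [hj, if_false]; exact continuousOn_const)
      (fun x _ j => by
        by_cases hj : j = i
        · simp only [hj, if_true]; exact (hF.differentiable (by norm_num) x).hasFDerivAt
        · simp only [hj, if_false]; exact hasFDerivAt_const _ _)
      (by
        refine (Continuous.continuousOn ?_).integrableOn_compact isCompact_Icc
        refine continuous_finsetSum _ fun j _ => ?_
        by_cases hj : j = i
        · simp only [hj, if_true]; exact hcont
        · simp only [hj, if_false]; exact continuous_const)
    have e1 : ∀ x : Td (n+1), ∑ j, (if j = i then fderiv ℝ F x else 0) (Pi.single j 1) = fderiv ℝ F x (Pi.single i 1) := by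
      intro x
      rw [Finset.sum_eq_single i]
      · simp
      · intro j _ hj; simp [hj]
      · simp
    simp only [e1] at h
    rw [h]
    refine Finset.sum_eq_zero fun j _ => ?_
    by_cases hj : j = i
    · subst hj
      simp only [if_true]
      rw [sub_eq_zero]
      congr 1
      funext x
      have := hp (j.insertNth 0 x) (Pi.single j 1)
      simp only [Pi.one_apply, Pi.zero_apply]
      rw [← this]
      congr 1
      funext l
      refine Fin.succAboveCases j ?_ (fun m => ?_) l
      · simp
      · simp
    · simp [hj]

theorem pd_mul {d : ℕ} {f g : Td d → ℝ} (hf : ContDiff ℝ 1 f) (hg : ContDiff ℝ 1 g) (i : Fin d) (x : Td d) :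
    pd i (fun y => f y * g y) x = f x * pd i g x + pd i f x * g x := by
  unfold pd
  rw [fderiv_fun_mul (hf.differentiable (by norm_num) x) (hg.differentiable (by norm_num) x)]
  simp [mul_comm]

theorem pd_add {d : ℕ} {f g : Td d → ℝ} (hf : ContDiff ℝ 1 f) (hg : ContDiff ℝ 1 g) (i : Fin d) (x : Td d) :
    pd i (fun y => f y + g y) x = pd i f x + pd i g x := by
  unfold pd
  rw [fderiv_fun_add (hf.differentiable (by norm_num) x) (hg.differentiable (by norm_num) x)]
  simp

theorem pd_sub {d : ℕ} {f g : Td d → ℝ} (hf : ContDiff ℝ 1 f) (hg : ContDiff ℝ 1 g) (i : Fin d) (x : Td d) :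
    pd i (fun y => f y - g y) x = pd i f x - pd i g x := by
  unfold pd
  rw [fderiv_fun_sub (hf.differentiable (by norm_num) x) (hg.differentiable (by norm_num) x)]
  simp

theorem pd_comp {d : ℕ} {φ : ℝ → ℝ} {c : Td d → ℝ} (hφ : ContDiff ℝ 1 φ) (hc : ContDiff ℝ 1 c) (i : Fin d) (x : Td d) :
    pd i (fun y => φ (c y)) x = deriv φ (c x) * pd i c x := by
  unfold pd
  have h1 : HasDerivAt φ (deriv φ (c x)) (c x) := (hφ.differentiable (by norm_num) _).hasDerivAt
  have h := h1.comp_hasFDerivAt x (hc.differentiable (by norm_num) x).hasFDerivAt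
  have e : (fun y => φ (c y)) = φ ∘ c := rfl
  rw [e, h.fderiv]
  simp

theorem int_of_cont {d : ℕ} {E : Type*} [NormedAddCommGroup E] {f : Td d → E} (hf : Continuous f) : Integrable f (muB d) := by
  have : IntegrableOn f (Set.Icc (0 : Td d) 1) := hf.continuousOn.integrableOn_compact isCompact_Icc
  exact this.congr_set_ae (box_ae_Icc d)

theorem int_by_parts {d : ℕ} {f g : Td d → ℝ} (hf : ContDiff ℝ 1 f) (hg : ContDiff ℝ 1 g)
    (pf : TPer f) (pg : TPer g) (i : Fin d) :
    ∫ x, pd i f x * g x ∂(muB d) = - ∫ x, f x * pd i g x ∂(muB d) := by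
  have h := integral_pd_zero (F := fun y => f y * g y) (hf.mul hg) (fun x k => by rw [pf, pg]) i
  have h2 : ∀ x, fderiv ℝ (fun y => f y * g y) x (Pi.single i 1) = f x * pd i g x + pd i f x * g x := pd_mul hf hg i
  simp only [h2] at h
  rw [integral_add] at h
  · linarith
  · exact int_of_cont (hf.continuous.mul (contDiff_pd (m := 0) hg (by simp) i).continuous)
  · exact int_of_cont ((contDiff_pd (m := 0) hf (by simp) i).continuous.mul hg.continuous)

theorem eK_per {d : ℕ} (k : Fin d → ℤ) (x : Td d) (n : Fin d → ℤ) : eK k (fun i => x i + n i) = eK k x := by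
  rw [← mFourier_piT, ← mFourier_piT]
  congr 1
  funext i
  simp [piT]

theorem eK_hasFDeriv {d : ℕ} (k : Fin d → ℤ) (i : Fin d) (x : Td d) :
    fderiv ℝ (eK (d := d) k) x (Pi.single i 1) = 2 * Real.pi * Complex.I * k i * eK k x := by
  have h1 : HasFDerivAt (fun x : Td d => 2 * Real.pi * Complex.I * ∑ i, (k i : ℂ) * (x i : ℂ))
      ((2 * Real.pi * Complex.I) • ∑ i, (k i : ℂ) • (Complex.ofRealCLM.comp (ContinuousLinearMap.proj (R := ℝ) (φ := fun _ : Fin d => ℝ) i))) x := by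
    refine HasFDerivAt.const_mul ?_ _
    refine HasFDerivAt.fun_sum fun i _ => ?_
    refine HasFDerivAt.const_mul ?_ _
    exact (Complex.ofRealCLM.comp (ContinuousLinearMap.proj (R := ℝ) (φ := fun _ : Fin d => ℝ) i)).hasFDerivAt
  have h2 := h1.cexp
  have e : (eK (d := d) k) = fun x : Td d => Complex.exp (2 * Real.pi * Complex.I * ∑ i, (k i : ℂ) * (x i : ℂ)) := rfl
  rw [e, h2.fderiv]
  have e2 : ∑ j, (k j : ℂ) * (((Pi.single i (1:ℝ) : Td d) j : ℝ) : ℂ) = k i := by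
    rw [Finset.sum_eq_single i]
    · simp
    · intro j _ hj; simp [hj]
    · simp
  simp only [smul_apply, sum_apply, smul_eq_mul, ContinuousLinearMap.comp_apply,
    ContinuousLinearMap.proj_apply, Complex.ofRealCLM_apply, e2]
  ring

theorem eK_contDiff {d : ℕ} (k : Fin d → ℤ) : ContDiff ℝ 1 (eK (d := d) k) := by
  unfold eK
  refine ContDiff.cexp ?_
  refine contDiff_const.mul (ContDiff.sum fun i _ => contDiff_const.mul ?_)
  exact Complex.ofRealCLM.contDiff.comp (contDiff_apply ℝ ℝ i)

theorem fCoeff_pd {d : ℕ} {f : Td d → ℝ} (hf : ContDiff ℝ 1 f) (pf : TPer f) (i : Fin d) (k : Fin d → ℤ) :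
    fCoeff (pd i f) k = 2 * Real.pi * Complex.I * k i * fCoeff f k := by
  have hfc : ContDiff ℝ 1 (fun x => (f x : ℂ)) := Complex.ofRealCLM.contDiff.comp hf
  have h := integral_pd_zero (F := fun y => (f y : ℂ) * eK (-k) y) (hfc.mul (eK_contDiff _)) (fun x k => by rw [pf, eK_per]) i
  have hd : ∀ x, fderiv ℝ (fun x => (f x : ℂ)) x (Pi.single i 1) = (pd i f x : ℂ) := by
    intro x
    have h1 := (Complex.ofRealCLM.hasFDerivAt (x := f x)).comp x (hf.differentiable (by norm_num) x).hasFDerivAt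
    have e : (fun x => (f x : ℂ)) = Complex.ofRealCLM ∘ f := rfl
    rw [e, h1.fderiv]
    simp [pd]
  have h2 : ∀ x, fderiv ℝ (fun y => (f y : ℂ) * eK (-k) y) x (Pi.single i 1) =
      (pd i f x : ℂ) * eK (-k) x - (2 * Real.pi * Complex.I * k i) * ((f x : ℂ) * eK (-k) x) := by
    intro x
    rw [fderiv_fun_mul (hfc.differentiable (by norm_num) x) ((eK_contDiff _).differentiable (by norm_num) x)]
    simp only [add_apply, smul_apply, smul_eq_mul, hd, eK_hasFDeriv, Pi.neg_apply]
    push_cast; ring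
  simp only [h2] at h
  rw [integral_sub, integral_const_mul] at h
  · rw [fCoeff_eq_fc, fCoeff_eq_fc, fc_eq, fc_eq]
    exact sub_eq_zero.1 h
  · exact int_of_cont ((Complex.continuous_ofReal.comp (contDiff_pd (m := 0) hf (by simp) i).continuous).mul (eK_cont _))
  · exact int_of_cont (continuous_const.mul (hfc.continuous.mul (eK_cont _)))

theorem norm_fCoeff_pd {d : ℕ} {f : Td d → ℝ} (hf : ContDiff ℝ 1 f) (pf : TPer f) (i : Fin d) (k : Fin d → ℤ) :
    ‖fCoeff (pd i f) k‖ ^ 2 = 4 * Real.pi ^ 2 * (k i : ℝ) ^ 2 * ‖fCoeff f k‖ ^ 2 := by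
  rw [fCoeff_pd hf pf, norm_mul, norm_mul, norm_mul, norm_mul, mul_pow, mul_pow, mul_pow, mul_pow]
  simp only [Complex.norm_I, Complex.norm_ofNat, Complex.norm_real, Complex.norm_intCast, Real.norm_eq_abs, sq_abs]
  ring

theorem SL_pd_le {d : ℕ} {f : Td d → ℝ} (hf : ContDiff ℝ 1 f) (pf : TPer f) (i : Fin d) (r : ℝ) :
    SL (wt r) (fCoeff (pd i f)) ≤ ENNReal.ofReal 40 * SL (wt (r + 1)) (nz (fCoeff f)) := by
  rw [← SL_const_mul _ (by norm_num)]
  refine ENNReal.tsum_le_tsum fun k => ENNReal.ofReal_le_ofReal ?_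
  rw [norm_fCoeff_pd hf pf]
  by_cases hk : k = 0
  · subst hk; simp [nz]
  simp only [nz, hk, if_false]
  rw [wt_add, wt_eq 1, Real.rpow_one]
  have h1 : (k i : ℝ) ^ 2 ≤ br k := by
    have : (k i : ℝ) ^ 2 ≤ ∑ i, (k i : ℝ) ^ 2 :=
      Finset.single_le_sum (f := fun i => (k i : ℝ) ^ 2) (fun i _ => by positivity) (Finset.mem_univ i)
    unfold br; linarith
  have h2 : 4 * Real.pi ^ 2 ≤ 40 := by
    have := Real.pi_lt_d2
    have := Real.pi_pos
    nlinarith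
  have hw := wt_pos r k
  have := br_ge_one k
  calc wt r k * (4 * Real.pi ^ 2 * (k i : ℝ) ^ 2 * ‖fCoeff f k‖ ^ 2)
      ≤ wt r k * (40 * br k * ‖fCoeff f k‖ ^ 2) := by gcongr
    _ = _ := by ring

theorem SL_nz_le_pd {d : ℕ} {f : Td d → ℝ} (hf : ContDiff ℝ 1 f) (pf : TPer f) (r : ℝ) :
    SL (wt (r + 1)) (nz (fCoeff f)) ≤ ∑ i, SL (wt r) (fCoeff (pd i f)) := by
  unfold SL
  rw [← Summable.tsum_finsetSum (fun i _ => ENNReal.summable)]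
  refine ENNReal.tsum_le_tsum fun k => ?_
  rw [← ENNReal.ofReal_sum_of_nonneg (fun i _ => mul_nonneg (wt_pos r k).le (by positivity))]
  refine ENNReal.ofReal_le_ofReal ?_
  simp only [norm_fCoeff_pd hf pf]
  by_cases hk : k = 0
  · subst hk; simp [nz]
  simp only [nz, hk, if_false]
  have e : ∑ i, wt r k * (4 * Real.pi ^ 2 * (k i : ℝ) ^ 2 * ‖fCoeff f k‖ ^ 2) =
      4 * Real.pi ^ 2 * (∑ i, (k i : ℝ) ^ 2) * (wt r k * ‖fCoeff f k‖ ^ 2) := by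
    rw [Finset.mul_sum, Finset.sum_mul]
    refine Finset.sum_congr rfl fun i _ => by ring
  rw [e, wt_add, wt_eq 1, Real.rpow_one]
  have h1 : 1 ≤ ∑ i, (k i : ℝ) ^ 2 := by
    obtain ⟨i, hi⟩ := Function.ne_iff.1 hk
    have : (k i : ℝ) ^ 2 ≤ ∑ i, (k i : ℝ) ^ 2 :=
      Finset.single_le_sum (f := fun i => (k i : ℝ) ^ 2) (fun i _ => by positivity) (Finset.mem_univ i)
    refine le_trans ?_ this
    have h3 : 1 ≤ |k i| := Int.one_le_abs hi
    have h4 : (1:ℝ) ≤ |(k i : ℝ)| := by exact_mod_cast h3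
    rw [← sq_abs]; nlinarith
  have h2 : 2 ≤ 4 * Real.pi ^ 2 := by
    have := Real.pi_gt_three
    nlinarith
  have hw := wt_pos r k
  have : br k ≤ 4 * Real.pi ^ 2 * (∑ i, (k i : ℝ) ^ 2) := by unfold br; nlinarith
  calc _ = br k * (wt r k * ‖fCoeff f k‖ ^ 2) := by ring
    _ ≤ _ := by gcongr

theorem SL_split0 {d : ℕ} (r : ℝ) (u : (Fin d → ℤ) → ℂ) :
    SL (wt r) u ≤ SL (wt r) (nz u) + SL (fun _ => 1) u := by
  have h0 : SL (fun _ => 1) (fun k => if k = 0 then u k else 0) ≤ SL (fun _ => 1) u := by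
    refine ENNReal.tsum_le_tsum fun k => ?_
    by_cases h : k = 0 <;> simp [h]
  refine le_trans ?_ (add_le_add le_rfl h0)
  unfold SL
  rw [← ENNReal.tsum_add]
  refine ENNReal.tsum_le_tsum fun k => ?_
  by_cases h : k = 0
  · subst h
    simp [nz, wt]
  · simp [nz, h]

theorem SL_one_eq {d : ℕ} {v : Td d → ℂ} (hv : MemLp v 2 (muB d)) : SL (fun _ => 1) (fc v) = ENNReal.ofReal (∫ x, ‖v x‖ ^ 2 ∂(muB d)) := by
  have h := parseval_sq hv
  rw [SL_eq_ofReal (fun _ => zero_le_one) (by simpa using h.summable)]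
  simp only [one_mul, h.tsum_eq]

theorem memLp_per {d : ℕ} {f : Td d → ℝ} (hf : Continuous f) (hp : TPer f) : MemLp (fun x => (f x : ℂ)) 2 (muB d) := by
  obtain ⟨K, _, hK⟩ := per_bdd_real hf hp
  exact memLp_real_bdd hf hK

theorem SL_one_real {d : ℕ} {f : Td d → ℝ} (hf : Continuous f) (hp : TPer f) :
    SL (fun _ => 1) (fCoeff f) = ENNReal.ofReal (∫ x, f x ^ 2 ∂(muB d)) := by
  rw [fCoeff_eq_fc, SL_one_eq (memLp_per hf hp)]
  simp

/-- smooth periodic functions -/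
def SP {d : ℕ} (f : Td d → ℝ) : Prop := ContDiff ℝ (⊤ : ℕ∞) f ∧ TPer f

theorem SP.c1 {d : ℕ} {f : Td d → ℝ} (h : SP f) : ContDiff ℝ 1 f := h.1.of_le (by exact_mod_cast le_top)

theorem SP.cont {d : ℕ} {f : Td d → ℝ} (h : SP f) : Continuous f := h.1.continuous

theorem SP.pd {d : ℕ} {f : Td d → ℝ} (h : SP f) (i : Fin d) : SP (pd i f) :=
  ⟨contDiff_pd h.1 (by norm_cast) i, h.2.pd i⟩

theorem SP.comp {d : ℕ} {φ : ℝ → ℝ} {f : Td d → ℝ} (hφ : ContDiff ℝ (⊤ : ℕ∞) φ) (h : SP f) : SP (fun x => φ (f x)) :=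
  ⟨hφ.comp h.1, fun x k => by simp only [h.2 x k]⟩

theorem SP.mul {d : ℕ} {f g : Td d → ℝ} (hf : SP f) (hg : SP g) : SP (fun x => f x * g x) :=
  ⟨hf.1.mul hg.1, fun x k => by simp only [hf.2 x k, hg.2 x k]⟩

theorem SP.add {d : ℕ} {f g : Td d → ℝ} (hf : SP f) (hg : SP g) : SP (fun x => f x + g x) :=
  ⟨hf.1.add hg.1, fun x k => by simp only [hf.2 x k, hg.2 x k]⟩

theorem SP.sub {d : ℕ} {f g : Td d → ℝ} (hf : SP f) (hg : SP g) : SP (fun x => f x - g x) :=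
  ⟨hf.1.sub hg.1, fun x k => by simp only [hf.2 x k, hg.2 x k]⟩

theorem SP.const {d : ℕ} (a : ℝ) : SP (fun _ : Td d => a) := ⟨contDiff_const, fun _ _ => rfl⟩

theorem SP.sum {d : ℕ} {ι : Type*} (s : Finset ι) {f : ι → Td d → ℝ} (h : ∀ i ∈ s, SP (f i)) : SP (fun x => ∑ i ∈ s, f i x) :=
  ⟨ContDiff.sum fun i hi => (h i hi).1, fun x k => Finset.sum_congr rfl fun i hi => (h i hi).2 x k⟩

theorem SP.fin_nat {d : ℕ} (n : ℕ) : ∀ {f : Td d → ℝ}, SP f → SL (wt (n:ℝ)) (fCoeff f) ≠ ⊤ := by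
  induction n with
  | zero =>
    intro f hf
    have : (wt ((0:ℕ):ℝ) : (Fin d → ℤ) → ℝ) = fun _ => 1 := by funext k; simp [wt_eq]
    rw [this, SL_one_real hf.cont hf.2]
    exact ENNReal.ofReal_ne_top
  | succ n ih =>
    intro f hf
    refine ne_top_of_le_ne_top ?_ (SL_split0 _ _)
    refine ENNReal.add_ne_top.2 ⟨?_, ?_⟩
    · push_cast
      refine ne_top_of_le_ne_top ?_ (SL_nz_le_pd hf.c1 hf.2 n)
      exact ENNReal.sum_ne_top.2 fun i _ => ih (hf.pd i)
    · rw [SL_one_real hf.cont hf.2]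
      exact ENNReal.ofReal_ne_top

theorem SP.fin {d : ℕ} (r : ℝ) {f : Td d → ℝ} (hf : SP f) : SL (wt r) (fCoeff f) ≠ ⊤ := by
  obtain ⟨n, hn⟩ := exists_nat_ge r
  exact ne_top_of_le_ne_top (hf.fin_nat n) (SL_wt_mono hn _)

theorem SP.hs {d : ℕ} (r : ℝ) {f : Td d → ℝ} (hf : SP f) : SL (wt r) (fCoeff f) = ENNReal.ofReal (hsNorm r f ^ 2) := by
  have h := SL_summable (fun k => (wt_pos r k).le) (hf.fin r)
  rw [SL_eq_ofReal (fun k => (wt_pos r k).le) h, hsNorm, Real.sq_sqrt, hsNormSq]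
  exact tsum_nonneg fun k => mul_nonneg (wt_pos r k).le (by positivity)

/-! ### Part 6: composition estimates -/

/-- monotone functions bounded below by one -/
def MF (F : ℝ → ℝ) : Prop := Monotone F ∧ ∀ r, 1 ≤ F r

theorem MF.pos {F : ℝ → ℝ} (h : MF F) (r : ℝ) : 0 < F r := lt_of_lt_of_le one_pos (h.2 r)

theorem MF.mul {F G : ℝ → ℝ} (hF : MF F) (hG : MF G) : MF (fun r => F r * G r) :=
  ⟨fun x y hxy => mul_le_mul (hF.1 hxy) (hG.1 hxy) (hG.pos x).le (hF.pos y).le,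
    fun r => one_le_mul_of_one_le_of_one_le (hF.2 r) (hG.2 r)⟩

theorem MF.add {F G : ℝ → ℝ} (hF : MF F) (hG : MF G) : MF (fun r => F r + G r) :=
  ⟨fun x y hxy => add_le_add (hF.1 hxy) (hG.1 hxy), fun r => by linarith [hF.2 r, hG.2 r]⟩

theorem MF.const {C : ℝ} (hC : 1 ≤ C) : MF (fun _ => C) := ⟨monotone_const, fun _ => hC⟩

theorem MF.pow {F : ℝ → ℝ} (hF : MF F) (n : ℕ) : MF (fun r => F r ^ n) :=
  ⟨fun x y hxy => pow_le_pow_left₀ (hF.pos x).le (hF.1 hxy) n, fun r => one_le_pow₀ (hF.2 r)⟩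

theorem MF.rpow {F : ℝ → ℝ} (hF : MF F) {p : ℝ} (hp : 0 ≤ p) : MF (fun r => F r ^ p) :=
  ⟨fun x y hxy => Real.rpow_le_rpow (hF.pos x).le (hF.1 hxy) hp, fun r => Real.one_le_rpow (hF.2 r) hp⟩

theorem MF.lin : MF (fun r => 1 + max r 0) :=
  ⟨fun x y hxy => by simp only; gcongr, fun r => by simp⟩

theorem exists_MF {φ : ℝ → ℝ} (hφ : Continuous φ) : ∃ F, MF F ∧ ∀ M t, |t| ≤ M → |φ t| ≤ F M := by
  have hb : ∀ M : ℝ, BddAbove (insert 0 ((fun t => |φ t|) '' Set.Icc (-M) M)) := fun M =>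
    (BddAbove.insert _ (isCompact_Icc.image hφ.abs).bddAbove)
  refine ⟨fun M => 1 + sSup (insert 0 ((fun t => |φ t|) '' Set.Icc (-M) M)), ⟨?_, ?_⟩, ?_⟩
  · intro x y hxy
    simp only
    gcongr
    · exact hb y
    · exact Set.insert_nonempty _ _
  · intro r
    have := le_csSup (hb r) (Set.mem_insert _ _)
    linarith
  · intro M t ht
    have := le_csSup (hb M) (Set.mem_insert_of_mem _ ⟨t, abs_le.1 ht, rfl⟩)
    simp only at this ⊢
    linarith

theorem eb_mul {x y : ENNReal} {X Y : ℝ} (hX : 0 ≤ X) (h1 : x ≤ ENNReal.ofReal X) (h2 : y ≤ ENNReal.ofReal Y) :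
    x * y ≤ ENNReal.ofReal (X * Y) := by
  rw [ENNReal.ofReal_mul hX]; exact mul_le_mul' h1 h2

theorem eb_add {x y : ENNReal} {X Y : ℝ} (hX : 0 ≤ X) (hY : 0 ≤ Y) (h1 : x ≤ ENNReal.ofReal X) (h2 : y ≤ ENNReal.ofReal Y) :
    x + y ≤ ENNReal.ofReal (X + Y) := by
  rw [ENNReal.ofReal_add hX hY]; exact add_le_add h1 h2

theorem eb_cmul {y : ENNReal} {X Y : ℝ} (hX : 0 ≤ X) (h2 : y ≤ ENNReal.ofReal Y) :
    ENNReal.ofReal X * y ≤ ENNReal.ofReal (X * Y) := eb_mul hX le_rfl h2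

theorem eb_two {y : ENNReal} {Y : ℝ} (h2 : y ≤ ENNReal.ofReal Y) :
    2 * y ≤ ENNReal.ofReal (2 * Y) := by
  have := eb_cmul (X := 2) (by norm_num) h2
  simpa using this

theorem eb_sum {ι : Type*} (s : Finset ι) {x : ι → ENNReal} {X : ι → ℝ} (hX : ∀ i ∈ s, 0 ≤ X i) (h : ∀ i ∈ s, x i ≤ ENNReal.ofReal (X i)) :
    ∑ i ∈ s, x i ≤ ENNReal.ofReal (∑ i ∈ s, X i) := by
  rw [ENNReal.ofReal_sum_of_nonneg hX]; exact Finset.sum_le_sum h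

theorem hs_nonneg {d : ℕ} (r : ℝ) (f : Td d → ℝ) : 0 ≤ hsNorm r f := Real.sqrt_nonneg _

theorem hs_mono {d : ℕ} {r t : ℝ} (h : r ≤ t) {f : Td d → ℝ} (hf : SP f) : hsNorm r f ≤ hsNorm t f := by
  have := SL_wt_mono h (fCoeff f)
  rw [hf.hs, hf.hs, ENNReal.ofReal_le_ofReal_iff (by positivity)] at this
  exact (pow_le_pow_iff_left₀ (hs_nonneg _ _) (hs_nonneg _ _) (by norm_num)).1 this

theorem wt_zero_eq (d : ℕ) : (wt (0:ℝ) : (Fin d → ℤ) → ℝ) = fun _ => 1 := by funext k; simp [wt_eq]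

theorem SL_pd_hs {d : ℕ} {f : Td d → ℝ} (hf : SP f) (i : Fin d) (r : ℝ) :
    SL (wt r) (fCoeff (pd i f)) ≤ ENNReal.ofReal (40 * hsNorm (r + 1) f ^ 2) := by
  refine (SL_pd_le hf.c1 hf.2 i r).trans (eb_cmul (by norm_num) ?_)
  exact (SL_nz_le _).trans (hf.hs _).le

theorem int_pd_sq {d : ℕ} {f : Td d → ℝ} (hf : SP f) (i : Fin d) :
    ∫ x, pd i f x ^ 2 ∂(muB d) ≤ 40 * hsNorm 1 f ^ 2 := by
  have := SL_pd_hs hf i 0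
  rw [wt_zero_eq, SL_one_real (hf.pd i).cont (hf.pd i).2, ENNReal.ofReal_le_ofReal_iff (by positivity)] at this
  simpa using this

theorem hs_pd {d : ℕ} {f : Td d → ℝ} (hf : SP f) (i : Fin d) (r : ℝ) :
    hsNorm r (pd i f) ^ 2 ≤ 40 * hsNorm (r + 1) f ^ 2 := by
  have := SL_pd_hs hf i r
  rwa [(hf.pd i).hs, ENNReal.ofReal_le_ofReal_iff (by positivity)] at this

theorem int_pd2_sq {d : ℕ} {f : Td d → ℝ} (hf : SP f) (i j : Fin d) :
    ∫ x, pd j (pd i f) x ^ 2 ∂(muB d) ≤ 1600 * hsNorm 2 f ^ 2 := by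
  have h1 := int_pd_sq (hf.pd i) j
  have h2 := hs_pd hf i 1
  norm_num at h2
  linarith

/-- Gagliardo-Nirenberg -/
theorem int_pd_four {d : ℕ} {c : Td d → ℝ} (hc : SP c) (i : Fin d) :
    ∫ x, pd i c x ^ 4 ∂(muB d) ≤ 9 * linf c ^ 2 * (1600 * hsNorm 2 c ^ 2) := by
  have hg := hc.pd i
  have hh := hg.pd i
  have h1 := int_by_parts hc.c1 (hg.mul (hg.mul hg)).c1 hc.2 (hg.mul (hg.mul hg)).2 i
  have e2 : ∀ x, pd i (fun y => pd i c y * (pd i c y * pd i c y)) x = 3 * pd i c x ^ 2 * pd i (pd i c) x := by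
    intro x
    rw [pd_mul hg.c1 (hg.mul hg).c1, pd_mul hg.c1 hg.c1]; ring
  simp only [e2] at h1
  rw [← integral_neg] at h1
  have h3 : ∫ x, pd i c x ^ 4 ∂(muB d) ≤ ∫ x, (1 / 2 * pd i c x ^ 4 + 9 / 2 * linf c ^ 2 * pd i (pd i c) x ^ 2) ∂(muB d) := by
    have e3 : ∫ x, pd i c x ^ 4 ∂(muB d) = ∫ x, pd i c x * (pd i c x * (pd i c x * pd i c x)) ∂(muB d) := by
      congr 1; funext x; ring
    rw [e3, h1]
    refine integral_mono (int_of_cont ?_) (int_of_cont ?_) fun x => ?_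
    · exact (hc.cont.mul ((continuous_const.mul (hg.cont.pow 2)).mul hh.cont)).neg
    · exact (continuous_const.mul (hg.cont.pow 4)).add (continuous_const.mul (hh.cont.pow 2))
    · have hM := le_linf hc.cont hc.2 x
      have hM2 : (c x) ^ 2 ≤ linf c ^ 2 := by rw [← sq_abs]; gcongr
      have h4 := mul_le_mul_of_nonneg_right hM2 (sq_nonneg (pd i (pd i c) x))
      simp only
      nlinarith [sq_nonneg (pd i c x ^ 2 + 3 * c x * pd i (pd i c) x)]
  rw [integral_add, integral_const_mul, integral_const_mul] at h3
  · have h5 := int_pd2_sq hc i i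
    have := mul_le_mul_of_nonneg_left h5 (sq_nonneg (linf c))
    nlinarith
  · exact int_of_cont (continuous_const.mul (hg.cont.pow 4))
  · exact int_of_cont (continuous_const.mul (hh.cont.pow 2))

theorem nz_pd {d : ℕ} {f : Td d → ℝ} (hf : ContDiff ℝ 1 f) (pf : TPer f) (i : Fin d) : nz (fCoeff (pd i f)) = fCoeff (pd i f) := by
  funext k
  by_cases h : k = 0
  · subst h; simp [nz, fCoeff_pd hf pf]
  · simp [nz, h]

theorem SL_two_le {d : ℕ} {f : Td d → ℝ} (hf : SP f) {X : ℝ} (hX : 0 ≤ X)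
    (h : ∀ i j, ∫ x, pd j (pd i f) x ^ 2 ∂(muB d) ≤ X) :
    SL (wt 2) (nz (fCoeff f)) ≤ ENNReal.ofReal (d * (d * X)) := by
  have h1 := SL_nz_le_pd hf.c1 hf.2 1
  norm_num at h1
  refine h1.trans ?_
  refine (eb_sum Finset.univ (X := fun _ => (d * X : ℝ)) (fun i _ => by positivity) fun i _ => ?_).trans_eq (by simp)
  have h2 := SL_nz_le_pd (hf.pd i).c1 (hf.pd i).2 0
  rw [nz_pd hf.c1 hf.2, zero_add] at h2
  refine h2.trans ?_
  refine (eb_sum Finset.univ (X := fun _ => (X : ℝ)) (fun i _ => by positivity) fun j _ => ?_).trans_eq (by simp)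
  rw [wt_zero_eq, SL_one_real ((hf.pd i).pd j).cont ((hf.pd i).pd j).2]
  exact ENNReal.ofReal_le_ofReal (h i j)

theorem smooth_deriv {φ : ℝ → ℝ} (hφ : ContDiff ℝ (⊤ : ℕ∞) φ) : ContDiff ℝ (⊤ : ℕ∞) (deriv φ) :=
  (contDiff_infty_iff_deriv.1 hφ).2

theorem smooth_c1 {φ : ℝ → ℝ} (hφ : ContDiff ℝ (⊤ : ℕ∞) φ) : ContDiff ℝ 1 φ := hφ.of_le (by exact_mod_cast le_top)

theorem comp_base (d : ℕ) {φ : ℝ → ℝ} (hφ : ContDiff ℝ (⊤ : ℕ∞) φ) :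
    ∃ F, MF F ∧ ∀ c : Td d → ℝ, SP c →
      SL (wt 2) (nz (fCoeff (fun x => φ (c x)))) ≤ ENNReal.ofReal (F (linf c) * hsNorm 2 c ^ 2) := by
  obtain ⟨F1, hF1, b1⟩ := exists_MF (smooth_deriv hφ).continuous
  obtain ⟨F2, hF2, b2⟩ := exists_MF (smooth_deriv (smooth_deriv hφ)).continuous
  refine ⟨fun r => (1 + (d:ℝ)) * ((1 + (d:ℝ)) * (3200 * F1 r ^ 2 + 28800 * (F2 r ^ 2 * (1 + max r 0) ^ 2))), ?_, ?_⟩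
  · have hd : (1:ℝ) ≤ 1 + (d:ℝ) := by simp
    exact (MF.const hd).mul ((MF.const hd).mul (((MF.const (by norm_num)).mul (hF1.pow 2)).add
      ((MF.const (by norm_num)).mul ((hF2.pow 2).mul (MF.lin.pow 2)))))
  intro c hc
  have hM := linf_nonneg c
  have p1 := hF1.pos (linf c)
  have p2 := hF2.pos (linf c)
  have hX : 0 ≤ (3200 * F1 (linf c) ^ 2 + 28800 * (F2 (linf c) ^ 2 * (1 + max (linf c) 0) ^ 2)) * hsNorm 2 c ^ 2 := by
    have : 0 ≤ max (linf c) 0 := le_max_right _ _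
    positivity
  refine (SL_two_le (SP.comp hφ hc) hX fun i j => ?_).trans (ENNReal.ofReal_le_ofReal ?_)
  · have e1 : pd i (fun x => φ (c x)) = fun x => deriv φ (c x) * pd i c x := by
      funext x; exact pd_comp (smooth_c1 hφ) hc.c1 i x
    have e2 : ∀ x, pd j (pd i (fun x => φ (c x))) x =
        deriv φ (c x) * pd j (pd i c) x + deriv (deriv φ) (c x) * pd j c x * pd i c x := by
      intro x
      rw [e1, pd_mul (SP.comp (smooth_deriv hφ) hc).c1 (hc.pd i).c1, pd_comp (smooth_c1 (smooth_deriv hφ)) hc.c1]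
    have h1 := int_pd2_sq hc i j
    have h2 := int_pd_four hc i
    have h3 := int_pd_four hc j
    have hi : Continuous (pd i c) := (hc.pd i).cont
    have hj : Continuous (pd j c) := (hc.pd j).cont
    have hij : Continuous (pd j (pd i c)) := ((hc.pd i).pd j).cont
    have hle : ∫ x, pd j (pd i (fun x => φ (c x))) x ^ 2 ∂(muB d) ≤
        ∫ x, (2 * F1 (linf c) ^ 2 * pd j (pd i c) x ^ 2 + F2 (linf c) ^ 2 * (pd i c x ^ 4 + pd j c x ^ 4)) ∂(muB d) := by
      refine integral_mono (int_of_cont (((SP.comp hφ hc).pd i).pd j |>.cont.pow 2)) (int_of_cont (by fun_prop)) fun x => ?_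
      simp only
      rw [e2]
      have hM := le_linf hc.cont hc.2 x
      have q1 : (deriv φ (c x)) ^ 2 ≤ F1 (linf c) ^ 2 := by rw [← sq_abs]; gcongr; exact b1 _ _ hM
      have q2 : (deriv (deriv φ) (c x)) ^ 2 ≤ F2 (linf c) ^ 2 := by rw [← sq_abs]; gcongr; exact b2 _ _ hM
      set A := deriv φ (c x)
      set B := deriv (deriv φ) (c x)
      set p := pd j (pd i c) x
      set u := pd i c x
      set v := pd j c x
      have k1 := mul_le_mul_of_nonneg_right q1 (sq_nonneg p)
      have k2 := mul_le_mul_of_nonneg_right q2 (by positivity : 0 ≤ u ^ 4 + v ^ 4)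
      have k3 : B ^ 2 * (2 * (u ^ 2 * v ^ 2)) ≤ B ^ 2 * (u ^ 4 + v ^ 4) := by
        gcongr; nlinarith [sq_nonneg (u ^ 2 - v ^ 2)]
      nlinarith [sq_nonneg (A * p - B * v * u)]
    refine hle.trans ?_
    rw [integral_add, integral_const_mul, integral_const_mul, integral_add]
    · have k1 := mul_le_mul_of_nonneg_left h1 (by positivity : 0 ≤ 2 * F1 (linf c) ^ 2)
      have k2 := mul_le_mul_of_nonneg_left (add_le_add h2 h3) (by positivity : 0 ≤ F2 (linf c) ^ 2)
      have k3 : linf c ^ 2 ≤ (1 + max (linf c) 0) ^ 2 := by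
        rw [max_eq_left hM]; gcongr; linarith
      have k4 := mul_le_mul_of_nonneg_left k3 (by positivity : 0 ≤ F2 (linf c) ^ 2 * hsNorm 2 c ^ 2)
      nlinarith
    · exact int_of_cont (by fun_prop)
    · exact int_of_cont (by fun_prop)
    · exact int_of_cont (by fun_prop)
    · exact int_of_cont (by fun_prop)
  · have h0 : (d:ℝ) ≤ 1 + (d:ℝ) := by simp
    calc _ ≤ (1 + (d:ℝ)) * ((1 + (d:ℝ)) * ((3200 * F1 (linf c) ^ 2 + 28800 * (F2 (linf c) ^ 2 * (1 + max (linf c) 0) ^ 2)) * hsNorm 2 c ^ 2)) := by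
          gcongr
      _ = _ := by ring

/-- weighted product estimate, with the commutator kept -/
theorem prod_split {d : ℕ} {σ R : ℝ} (hσ : 0 ≤ σ) (hR : 1 ≤ R) {a : Td d → ℝ} (ha : Continuous a) {K : ℝ} (hK0 : 0 ≤ K) (hK : ∀ x, |a x| ≤ K)
    {v : Td d → ℂ} (hv : MemLp v 2 (muB d)) :
    SL (fun k => wR σ R k ^ 2) (fc (fun x => (a x : ℂ) * v x)) ≤
      2 * (ENNReal.ofReal (K ^ 2) * SL (fun k => wR σ R k ^ 2) (fc v)) + 2 * SL (fun _ => 1) (Er a (wR σ R) v) := by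
  rw [← SL_wmul, ← SL_wmul]
  have e : (fun k => ((wR σ R k : ℝ) : ℂ) * fc (fun x => (a x : ℂ) * v x) k) =
      fun k => Tm a (fun l => ((wR σ R l : ℝ) : ℂ) * fc v l) k + Er a (wR σ R) v k := by
    funext k
    exact Er_split ha hK (wR_abs_le hσ hR) hv k
  rw [e]
  refine (SL_vadd (fun _ => zero_le_one) _ _).trans ?_
  refine add_le_add (mul_le_mul' le_rfl ?_) le_rfl
  have hs := summable_weight (wR_abs_le hσ hR) (parseval_sq hv).summable
  have hT := Tm_bound ha hK hs
  rw [SL_eq_ofReal (fun _ => zero_le_one) (by simpa using hT.1), SL_eq_ofReal (fun _ => zero_le_one) (by simpa using hs),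
    ← ENNReal.ofReal_mul (by positivity)]
  refine ENNReal.ofReal_le_ofReal ?_
  simpa using hT.2

theorem comp_est {d : ℕ} (hd : d ≤ 3) (n : ℕ) : ∀ r : ℝ, r ≤ 2 + n / 2 → ∀ {φ : ℝ → ℝ}, ContDiff ℝ (⊤ : ℕ∞) φ →
    ∃ F, MF F ∧ ∀ c : Td d → ℝ, SP c →
      SL (wt r) (nz (fCoeff (fun x => φ (c x)))) ≤
        ENNReal.ofReal (F (linf c) * (1 + hsNorm 2 c) ^ (2 * n) * hsNorm (max r 2) c ^ 2) := by
  induction n with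
  | zero =>
    intro r hr φ hφ
    obtain ⟨F, hF, h⟩ := comp_base d hφ
    refine ⟨F, hF, fun c hc => (SL_wt_mono (by simpa using hr) _).trans ((h c hc).trans (ENNReal.ofReal_le_ofReal ?_))⟩
    have := hs_mono (le_max_right r 2) hc
    have := hs_nonneg 2 c
    have := hF.pos (linf c)
    simp only [mul_zero, pow_zero, mul_one]
    gcongr
  | succ n ih =>
    intro r hr φ hφ
    rcases le_or_gt r 2 with h2 | h2
    · obtain ⟨F, hF, h⟩ := comp_base d hφ
      refine ⟨F, hF, fun c hc => (SL_wt_mono h2 _).trans ((h c hc).trans (ENNReal.ofReal_le_ofReal ?_))⟩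
      have := hs_mono (le_max_right r 2) hc
      have hb := hs_nonneg 2 c
      have := hF.pos (linf c)
      have : 1 ≤ (1 + hsNorm 2 c) ^ (2 * (n + 1)) := one_le_pow₀ (by linarith)
      calc F (linf c) * hsNorm 2 c ^ 2 = F (linf c) * 1 * hsNorm 2 c ^ 2 := by ring
        _ ≤ _ := by gcongr
    obtain ⟨F1, hF1, b1⟩ := exists_MF (smooth_deriv hφ).continuous
    obtain ⟨F2, hF2, b2⟩ := comp_base d (smooth_deriv hφ)
    obtain ⟨F3, hF3, b3⟩ := ih (r - 1 / 2) (by push_cast at hr; linarith) (smooth_deriv hφ)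
    set σ := r - 1 with hσd
    have hσ : 0 ≤ σ := by linarith
    set C1 := 686 * (max 1 σ * 2 ^ σ) ^ 2 with hC1
    set C2 := 686 * (2 ^ σ : ℝ) ^ 2 with hC2
    have h2σ : (1:ℝ) ≤ 2 ^ σ := Real.one_le_rpow (by norm_num) hσ
    have hC2' : 1 ≤ C2 := by rw [hC2]; nlinarith
    have hC1' : 1 ≤ C1 := by
      have : 1 ≤ max 1 σ * 2 ^ σ := one_le_mul_of_one_le_of_one_le (le_max_left _ _) h2σ
      rw [hC1]; nlinarith
    refine ⟨fun m => (1 + (d:ℝ)) * (80 * F1 m ^ 2 + (80 * C1 * F2 m + 80 * C2 * F3 m)), ?_, ?_⟩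
    · have hd : (1:ℝ) ≤ 1 + (d:ℝ) := by simp
      exact (MF.const hd).mul (((MF.const (by norm_num)).mul (hF1.pow 2)).add
        (((MF.const (by nlinarith)).mul hF2).add ((MF.const (by nlinarith)).mul hF3)))
    intro c hc
    have p1 := hF1.pos (linf c)
    have p2 := hF2.pos (linf c)
    have p3 := hF3.pos (linf c)
    have hmax : max r 2 = r := max_eq_left h2.le
    rw [hmax]
    set B := hsNorm 2 c with hB
    set A := hsNorm r c with hA
    have hB0 : 0 ≤ B := hs_nonneg _ _
    have hA0 : 0 ≤ A := hs_nonneg _ _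
    set X := (80 * F1 (linf c) ^ 2 + (80 * C1 * F2 (linf c) + 80 * C2 * F3 (linf c))) * (1 + B) ^ (2 * (n + 1)) * A ^ 2 with hX
    have hX0 : 0 ≤ X := by positivity
    have hstep : SL (wt r) (nz (fCoeff (fun x => φ (c x)))) ≤ ENNReal.ofReal (d * X) := by
      have h1 := SL_nz_le_pd (SP.comp hφ hc).c1 (SP.comp hφ hc).2 σ
      rw [hσd, sub_add_cancel] at h1
      refine h1.trans ((eb_sum Finset.univ (X := fun _ => X) (fun i _ => hX0) fun i _ => ?_).trans_eq (by simp))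
      have e1 : fCoeff (pd i (fun x => φ (c x))) = fc (fun x => ((deriv φ (c x) : ℝ) : ℂ) * ((pd i c x : ℝ) : ℂ)) := by
        rw [fCoeff_eq_fc]
        congr 1
        funext x
        rw [pd_comp (smooth_c1 hφ) hc.c1 i x]; push_cast; rfl
      rw [e1]
      refine SL_sup fun R hR => ?_
      have hvm := memLp_per (hc.pd i).cont (hc.pd i).2
      have hsm := SP.comp (smooth_deriv hφ) hc
      refine (prod_split hσ hR hsm.cont p1.le (fun x => b1 _ _ (le_linf hc.cont hc.2 x)) hvm).trans ?_
      have hv : ∀ t, t + 1 ≤ r → SL (wt t) (fc (fun x => ((pd i c x : ℝ) : ℂ))) ≤ ENNReal.ofReal (40 * A ^ 2) := by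
        intro t ht
        refine (SL_pd_hs hc i t).trans (ENNReal.ofReal_le_ofReal ?_)
        have := hs_mono ht hc
        have := hs_nonneg (t + 1) c
        gcongr
      have t1 : SL (fun k => wR σ R k ^ 2) (fc (fun x => ((pd i c x : ℝ) : ℂ))) ≤ ENNReal.ofReal (40 * A ^ 2) :=
        (SL_mono (wR_sq_le hσ hR) _).trans (hv σ (by linarith))
      have t2 : SL (fun l => wR σ R l ^ 2 * (jb l)⁻¹) (fc (fun x => ((pd i c x : ℝ) : ℂ))) ≤ ENNReal.ofReal (40 * A ^ 2) := by
        refine (SL_mono (fun k => ?_) _).trans t1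
        have := inv_le_one_of_one_le₀ (jb_ge_one k)
        exact mul_le_of_le_one_right (by positivity) this
      have t3 : SL (wt 1) (fc (fun x => ((pd i c x : ℝ) : ℂ))) ≤ ENNReal.ofReal (40 * B ^ 2) := by
        have := SL_pd_hs hc i 1
        rw [show (1:ℝ)+1 = 2 by norm_num] at this
        exact this
      have t4 : SL (wt (σ + (3 / 2 - 1))) (nz (fCoeff (fun x => deriv φ (c x)))) ≤
          ENNReal.ofReal (F3 (linf c) * (1 + B) ^ (2 * n) * A ^ 2) := by
        have e : σ + (3 / 2 - 1) = r - 1 / 2 := by rw [hσd]; ring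
        rw [e]
        refine (b3 c hc).trans (ENNReal.ofReal_le_ofReal ?_)
        have := hs_mono (show max (r - 1 / 2) 2 ≤ r from max_le (by linarith) h2.le) hc
        have := hs_nonneg (max (r - 1 / 2) 2) c
        gcongr
      have t5 := b2 c hc
      have t6 := comm_est hd hσ hR (Or.inr rfl) (fun x => deriv φ (c x)) (fun x => ((pd i c x : ℝ) : ℂ))
      have t7 : SL (fun _ => 1) (Er (fun x => deriv φ (c x)) (wR σ R) (fun x => ((pd i c x : ℝ) : ℂ))) ≤
          ENNReal.ofReal (C1 * (F2 (linf c) * B ^ 2 * (40 * A ^ 2)) + C2 * (40 * B ^ 2 * (F3 (linf c) * (1 + B) ^ (2 * n) * A ^ 2))) := by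
        refine t6.trans (eb_add (by positivity) (by positivity) ?_ ?_)
        · exact eb_cmul (by positivity) (eb_mul (by positivity) t5 t2)
        · exact eb_cmul (by positivity) (eb_mul (by positivity) t3 t4)
      refine (eb_add (by positivity) (by positivity) (eb_two (eb_cmul (by positivity) t1)) (eb_two t7)).trans (ENNReal.ofReal_le_ofReal ?_)
      have q1 : 1 ≤ (1 + B) ^ (2 * (n + 1)) := one_le_pow₀ (by linarith)
      have q2 : B ^ 2 ≤ (1 + B) ^ (2 * (n + 1)) := by
        calc B ^ 2 ≤ (1 + B) ^ 2 := by gcongr; linarith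
          _ ≤ _ := pow_le_pow_right₀ (by linarith) (by omega)
      have q3 : B ^ 2 * (1 + B) ^ (2 * n) ≤ (1 + B) ^ (2 * (n + 1)) := by
        calc B ^ 2 * (1 + B) ^ (2 * n) ≤ (1 + B) ^ 2 * (1 + B) ^ (2 * n) := by gcongr; linarith
          _ = _ := by rw [← pow_add]; congr 1; ring
      set Q := (1 + B) ^ (2 * (n + 1))
      calc _ = 80 * F1 (linf c) ^ 2 * A ^ 2 * 1 + 80 * C1 * F2 (linf c) * A ^ 2 * B ^ 2 + 80 * C2 * F3 (linf c) * A ^ 2 * (B ^ 2 * (1 + B) ^ (2 * n)) := by ring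
        _ ≤ 80 * F1 (linf c) ^ 2 * A ^ 2 * Q + 80 * C1 * F2 (linf c) * A ^ 2 * Q + 80 * C2 * F3 (linf c) * A ^ 2 * Q := by gcongr
        _ = X := by rw [hX]; ring
    refine hstep.trans (ENNReal.ofReal_le_ofReal ?_)
    have h0 : (d:ℝ) ≤ 1 + (d:ℝ) := by simp
    calc _ ≤ (1 + (d:ℝ)) * X := by gcongr
      _ = _ := by rw [hX]; ring

/-- sup norm of a frequency -/
def mfr {d : ℕ} (k : Fin d → ℤ) : ℕ := Finset.univ.sup (fun i => (k i).natAbs)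

def cube (d N : ℕ) : Finset (Fin d → ℤ) := Fintype.piFinset fun _ => Finset.Icc (-(N:ℤ)) N

theorem mfr_le {d : ℕ} (k : Fin d → ℤ) (N : ℕ) : mfr k ≤ N ↔ ∀ i, (k i).natAbs ≤ N := by
  simp [mfr]

theorem mem_cube {d N : ℕ} (k : Fin d → ℤ) : k ∈ cube d N ↔ mfr k ≤ N := by
  rw [mfr_le]
  simp only [cube, Fintype.mem_piFinset, Finset.mem_Icc]
  refine forall_congr' fun i => ?_
  omega

theorem card_cube (d N : ℕ) : (cube d N).card = (2 * N + 1) ^ d := by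
  simp only [cube, Fintype.card_piFinset, Int.card_Icc, Finset.prod_const, Finset.card_univ, Fintype.card_fin]
  congr 1
  omega

theorem mfr_add_le {d : ℕ} {k l : Fin d → ℤ} {M N : ℕ} (hk : mfr k ≤ M) (hl : mfr l ≤ N) : mfr (k + l) ≤ M + N := by
  rw [mfr_le] at *
  intro i
  have := hk i
  have := hl i
  simp only [Pi.add_apply]
  omega

theorem mfr_sub_le {d : ℕ} {k l : Fin d → ℤ} {M N : ℕ} (hk : mfr k ≤ M) (hl : mfr l ≤ N) : mfr (k - l) ≤ M + N := by
  rw [mfr_le] at *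
  intro i
  have := hk i
  have := hl i
  simp only [Pi.sub_apply]
  omega

theorem fc_eK {d : ℕ} (l k : Fin d → ℤ) : fc (eK l) k = if l = k then 1 else 0 := by
  rw [fc_eq]
  have e : ∀ x, eK l x * eK (-k) x = eK (l - k) x := fun x => by rw [← eK_add, sub_eq_add_neg]
  simp only [e]
  split_ifs with h
  · subst h
    simp [eK]
  · have : ∃ i, (l - k) i ≠ 0 := by
      by_contra hh
      push Not at hh
      exact h (sub_eq_zero.1 (funext hh))
    obtain ⟨i, hi⟩ := this
    have h0 := integral_pd_zero (eK_contDiff (l - k)) (eK_per (l - k)) i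
    simp only [eK_hasFDeriv] at h0
    rw [integral_const_mul] at h0
    refine (mul_eq_zero.1 h0).resolve_left ?_
    have hi' : (((l - k) i : ℤ) : ℂ) ≠ 0 := by exact_mod_cast hi
    exact mul_ne_zero (by simp [Real.pi_ne_zero]) hi'

theorem fc_poly {d : ℕ} {ι : Type*} (P : Finset ι) (α : ι → ℂ) (g : ι → Fin d → ℤ) (k : Fin d → ℤ) :
    fc (fun x => ∑ p ∈ P, α p * eK (g p) x) k = ∑ p ∈ P, if g p = k then α p else 0 := by
  rw [fc_eq]
  simp only [Finset.sum_mul]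
  rw [integral_finsetSum _ (fun p _ => int_of_cont (by have := eK_cont (g p); have := eK_cont (-k); fun_prop))]
  refine Finset.sum_congr rfl fun p _ => ?_
  simp only [mul_assoc]
  rw [integral_const_mul, ← fc_eq, fc_eK]
  split_ifs <;> simp

theorem poly_cont {d : ℕ} {ι : Type*} (P : Finset ι) (α : ι → ℂ) (g : ι → Fin d → ℤ) :
    Continuous (fun x : Td d => ∑ p ∈ P, α p * eK (g p) x) :=
  continuous_finsetSum _ fun p _ => continuous_const.mul (eK_cont _)

theorem poly_memLp {d : ℕ} {ι : Type*} (P : Finset ι) (α : ι → ℂ) (g : ι → Fin d → ℤ) :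
    MemLp (fun x : Td d => ∑ p ∈ P, α p * eK (g p) x) 2 (muB d) := by
  refine memLp_cont_bdd (poly_cont P α g) (K := ∑ p ∈ P, ‖α p‖) fun x => ?_
  refine (norm_sum_le _ _).trans (Finset.sum_le_sum fun p _ => ?_)
  rw [norm_mul, eK_norm, mul_one]

theorem dirichlet_sq {d : ℕ} (B : Finset (Fin d → ℤ)) (x : Td d) :
    ∫ y, ‖∑ l ∈ B, eK (-l) x * eK l y‖ ^ 2 ∂(muB d) = B.card := by
  have h := parseval_sq (poly_memLp B (fun l => eK (-l) x) (fun l => l))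
  rw [← h.tsum_eq, tsum_eq_sum (s := B)]
  · rw [Finset.card_eq_sum_ones]; push_cast
    refine Finset.sum_congr rfl fun k hk => ?_
    rw [fc_poly]
    simp [hk, eK_norm]
  · intro k hk
    rw [fc_poly]
    simp [hk]

/-- de la Vallée-Poussin mean -/
def Sg {d : ℕ} (N : ℕ) (g : Td d → ℂ) (x : Td d) : ℂ :=
  ∑ p ∈ cube d N ×ˢ cube d (2 * N), (((cube d N).card : ℂ)⁻¹ * fc g (p.1 + p.2)) * eK (p.1 + p.2) x

theorem Sg_bound {d : ℕ} (hd : d ≤ 3) (N : ℕ) {g : Td d → ℂ} (hg : Continuous g) {G : ℝ} (hG : ∀ x, ‖g x‖ ≤ G) (x : Td d) :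
    ‖Sg N g x‖ ≤ 5 * G := by
  set D := fun (B : Finset (Fin d → ℤ)) (y : Td d) => ∑ l ∈ B, eK (-l) x * eK l y with hD
  have hDc : ∀ B, Continuous (D B) := fun B => poly_cont B _ _
  have hG0 : 0 ≤ G := (norm_nonneg _).trans (hG 0)
  have e : Sg N g x = ((cube d N).card : ℂ)⁻¹ * ∫ y, g y * (starRingEnd ℂ) (D (cube d N) y * D (cube d (2 * N)) y) ∂(muB d) := by
    have e1 : ∀ y, g y * (starRingEnd ℂ) (D (cube d N) y * D (cube d (2 * N)) y) =
        ∑ p ∈ cube d N ×ˢ cube d (2 * N), eK (p.1 + p.2) x * (g y * eK (-(p.1 + p.2)) y) := by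
      intro y
      simp only [hD]
      rw [Finset.sum_mul_sum, map_sum, Finset.mul_sum, Finset.sum_product]
      refine Finset.sum_congr rfl fun l _ => ?_
      rw [map_sum, Finset.mul_sum]
      refine Finset.sum_congr rfl fun m _ => ?_
      simp only [map_mul, ← eK_neg_conj, neg_neg, neg_add, eK_add]
      ring
    simp only [e1]
    rw [integral_finsetSum _ (fun p _ => int_of_cont (by have := eK_cont (-(p.1 + p.2)); fun_prop)), Finset.mul_sum]
    unfold Sg
    refine Finset.sum_congr rfl fun p _ => ?_
    rw [integral_const_mul, ← fc_eq]
    ring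
  have hB : (0:ℝ) < (cube d N).card := by rw [card_cube]; positivity
  have hBB : ((cube d (2 * N)).card : ℝ) ≤ 8 * (cube d N).card := by
    rw [card_cube, card_cube]
    push_cast
    calc ((2 * (2 * N) + 1 : ℝ)) ^ d ≤ (2 * (2 * N + 1)) ^ d := by gcongr; linarith
      _ = 2 ^ d * (2 * N + 1) ^ d := mul_pow _ _ _
      _ ≤ 2 ^ 3 * (2 * N + 1) ^ d := by gcongr; norm_num
      _ = _ := by norm_num
  have h2 : ‖∫ y, g y * (starRingEnd ℂ) (D (cube d N) y * D (cube d (2 * N)) y) ∂(muB d)‖ ≤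
      ∫ y, G / 2 * ‖D (cube d N) y‖ ^ 2 + G / 2 * ‖D (cube d (2 * N)) y‖ ^ 2 ∂(muB d) := by
    refine norm_integral_le_of_norm_le (int_of_cont (by have := hDc (cube d N); have := hDc (cube d (2 * N)); fun_prop)) (Filter.Eventually.of_forall fun y => ?_)
    rw [norm_mul, RCLike.norm_conj, norm_mul]
    have a1 := two_mul_le_add_sq ‖D (cube d N) y‖ ‖D (cube d (2 * N)) y‖
    calc _ ≤ G * (‖D (cube d N) y‖ * ‖D (cube d (2 * N)) y‖) := by gcongr; exact hG y
      _ ≤ G * ((‖D (cube d N) y‖ ^ 2 + ‖D (cube d (2 * N)) y‖ ^ 2) / 2) := by gcongr; linarith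
      _ = _ := by ring
  rw [integral_add (int_of_cont (by have := hDc (cube d N); fun_prop)) (int_of_cont (by have := hDc (cube d (2 * N)); fun_prop)),
    integral_const_mul, integral_const_mul, dirichlet_sq, dirichlet_sq] at h2
  rw [e, norm_mul, norm_inv, Complex.norm_natCast, inv_mul_le_iff₀ hB]
  refine h2.trans ?_
  nlinarith

/-- tail weight -/
def tl {d : ℕ} (N : ℕ) (k : Fin d → ℤ) : ℝ := if mfr k ≤ N then 0 else 1

theorem Sg_memLp {d : ℕ} (N : ℕ) (g : Td d → ℂ) : MemLp (Sg N g) 2 (muB d) := poly_memLp _ _ _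

theorem Sg_cont {d : ℕ} (N : ℕ) (g : Td d → ℂ) : Continuous (Sg N g) := poly_cont _ _ _

theorem fc_sub {d : ℕ} {f g : Td d → ℂ} (hf : Continuous f) (hg : Continuous g) (k : Fin d → ℤ) :
    fc (fun x => f x - g x) k = fc f k - fc g k := by
  have := eK_cont (d := d) (-k)
  rw [fc_eq, fc_eq, fc_eq, ← integral_sub (int_of_cont (by fun_prop)) (int_of_cont (by fun_prop))]
  simp only [sub_mul]

theorem Sg_tail {d : ℕ} (N : ℕ) {g : Td d → ℂ} (hg : Continuous g) :
    SL (fun _ => 1) (fc (fun x => g x - Sg N g x)) ≤ SL (tl N) (fc g) := by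
  refine ENNReal.tsum_le_tsum fun k => ENNReal.ofReal_le_ofReal ?_
  have hB : (0:ℝ) < (cube d N).card := by rw [card_cube]; positivity
  rw [fc_sub hg (Sg_cont N g)]
  set P := (cube d N ×ˢ cube d (2 * N)).filter (fun p => p.1 + p.2 = k) with hP
  have e : fc (Sg N g) k = (((P.card : ℝ) / (cube d N).card : ℝ) : ℂ) * fc g k := by
    unfold Sg
    rw [fc_poly, ← Finset.sum_filter]
    rw [Finset.sum_congr rfl (g := fun _ => ((cube d N).card : ℂ)⁻¹ * fc g k)]
    · rw [Finset.sum_const, nsmul_eq_mul]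
      push_cast
      ring
    · intro p hp
      rw [(Finset.mem_filter.1 hp).2]
  have inj : Set.InjOn (fun p : (Fin d → ℤ) × (Fin d → ℤ) => p.1) P := by
    rintro ⟨a, b⟩ hp ⟨a', b'⟩ hq h
    simp only [hP, Finset.coe_filter, Set.mem_ofPred_eq] at hp hq h
    subst h
    have : b = b' := add_left_cancel (hp.2.trans hq.2.symm)
    rw [this]
  have hle : P.card ≤ (cube d N).card := by
    refine Finset.card_le_card_of_injOn (fun p => p.1) (fun p hp => ?_) inj
    simp only [hP, Finset.coe_filter, Set.mem_ofPred_eq, Finset.mem_product] at hp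
    exact hp.1.1
  have hv1 : (P.card : ℝ) / (cube d N).card ≤ 1 := (div_le_one hB).2 (by exact_mod_cast hle)
  have hv0 : 0 ≤ (P.card : ℝ) / (cube d N).card := by positivity
  have e2 : fc g k - fc (Sg N g) k = ((1 - (P.card : ℝ) / (cube d N).card : ℝ) : ℂ) * fc g k := by
    rw [e]; push_cast; ring
  rw [e2, norm_mul, Complex.norm_real, Real.norm_of_nonneg (by linarith), mul_pow, one_mul]
  refine mul_le_mul_of_nonneg_right ?_ (by positivity)
  unfold tl
  split_ifs with h
  · have : (cube d N).card ≤ P.card := by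
      refine Finset.card_le_card_of_injOn (fun l => (l, k - l)) (fun l hl => ?_) (fun a _ b _ h => (Prod.ext_iff.1 h).1)
      have hl' := (mem_cube l).1 hl
      simp only [hP, Finset.coe_filter, Set.mem_ofPred_eq, Finset.mem_product, mem_cube]
      exact ⟨⟨hl', (mfr_sub_le h hl').trans (by omega)⟩, by abel⟩
    have : (P.card : ℝ) / (cube d N).card = 1 := by
      rw [le_antisymm hle this]; exact div_self hB.ne'
    rw [this]; norm_num
  · exact pow_le_one₀ (by linarith) (by linarith)

theorem Sg_mul_zero {d : ℕ} (N : ℕ) (f g : Td d → ℂ) (k : Fin d → ℤ) (hk : 6 * N < mfr k) :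
    fc (fun x => Sg N f x * Sg N g x) k = 0 := by
  have e : (fun x => Sg N f x * Sg N g x) = fun x => ∑ p ∈ (cube d N ×ˢ cube d (2 * N)) ×ˢ (cube d N ×ˢ cube d (2 * N)),
      ((((cube d N).card : ℂ)⁻¹ * fc f (p.1.1 + p.1.2)) * (((cube d N).card : ℂ)⁻¹ * fc g (p.2.1 + p.2.2))) *
        eK ((p.1.1 + p.1.2) + (p.2.1 + p.2.2)) x := by
    funext x
    unfold Sg
    rw [Finset.sum_mul_sum, Finset.sum_product (s := cube d N ×ˢ cube d (2 * N))]
    refine Finset.sum_congr rfl fun p _ => Finset.sum_congr rfl fun q _ => ?_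
    rw [eK_add (p.1 + p.2) (q.1 + q.2)]
    ring
  rw [e, fc_poly]
  refine Finset.sum_eq_zero fun p hp => if_neg ?_
  simp only [Finset.mem_product, mem_cube] at hp
  intro h
  have := mfr_add_le (mfr_add_le hp.1.1 hp.1.2) (mfr_add_le hp.2.1 hp.2.2)
  rw [h] at this
  omega

theorem prod_tail {d : ℕ} (hd : d ≤ 3) (N : ℕ) {f g : Td d → ℂ} (hf : Continuous f) (hg : Continuous g) {G : ℝ}
    (hfG : ∀ x, ‖f x‖ ≤ G) (hgG : ∀ x, ‖g x‖ ≤ G) :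
    SL (tl (6 * N)) (fc (fun x => f x * g x)) ≤ ENNReal.ofReal (50 * G ^ 2) * (SL (tl N) (fc f) + SL (tl N) (fc g)) := by
  have hG0 : 0 ≤ G := (norm_nonneg _).trans (hfG 0)
  have cf := Sg_cont N f
  have cg := Sg_cont N g
  have mf : MemLp (fun x => f x - Sg N f x) 2 (muB d) := (memLp_cont_bdd hf hfG).sub (Sg_memLp N f)
  have mg : MemLp (fun x => g x - Sg N g x) 2 (muB d) := (memLp_cont_bdd hg hgG).sub (Sg_memLp N g)
  have mm : MemLp (fun x => f x * g x - Sg N f x * Sg N g x) 2 (muB d) := by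
    refine memLp_cont_bdd (by fun_prop) (K := G * G + (5 * G) * (5 * G)) fun x => ?_
    refine (norm_sub_le _ _).trans ?_
    rw [norm_mul, norm_mul]
    have := Sg_bound hd N hf hfG x
    have := Sg_bound hd N hg hgG x
    have := hfG x
    have := hgG x
    gcongr
  have h1 : SL (tl (6 * N)) (fc (fun x => f x * g x)) ≤ SL (fun _ => 1) (fc (fun x => f x * g x - Sg N f x * Sg N g x)) := by
    refine ENNReal.tsum_le_tsum fun k => ENNReal.ofReal_le_ofReal ?_
    unfold tl
    split_ifs with h
    · rw [zero_mul]; positivity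
    · rw [fc_sub (f := fun x => f x * g x) (g := fun x => Sg N f x * Sg N g x) (hf.mul hg) (cf.mul cg), Sg_mul_zero N f g k (by omega), sub_zero]
  refine h1.trans ?_
  have h2 : SL (fun _ => 1) (fc (fun x => f x * g x - Sg N f x * Sg N g x)) ≤
      ENNReal.ofReal (50 * G ^ 2) * (SL (fun _ => 1) (fc (fun x => f x - Sg N f x)) + SL (fun _ => 1) (fc (fun x => g x - Sg N g x))) := by
    rw [SL_one_eq mm, SL_one_eq mf, SL_one_eq mg, ← ENNReal.ofReal_add (integral_nonneg fun _ => by positivity) (integral_nonneg fun _ => by positivity),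
      ← ENNReal.ofReal_mul (by positivity)]
    refine ENNReal.ofReal_le_ofReal ?_
    rw [← integral_add (int_of_cont (by fun_prop)) (int_of_cont (by fun_prop)), ← integral_const_mul]
    refine integral_mono (int_of_cont (by fun_prop)) (int_of_cont (by fun_prop)) fun x => ?_
    have e : f x * g x - Sg N f x * Sg N g x = f x * (g x - Sg N g x) + (f x - Sg N f x) * Sg N g x := by ring
    have b1 := Sg_bound hd N hg hgG x
    have b2 := hfG x
    simp only
    rw [e]
    have t : ‖f x * (g x - Sg N g x) + (f x - Sg N f x) * Sg N g x‖ ≤ G * ‖g x - Sg N g x‖ + ‖f x - Sg N f x‖ * (5 * G) := by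
      refine (norm_add_le _ _).trans ?_
      rw [norm_mul, norm_mul]
      gcongr
    refine (pow_le_pow_left₀ (norm_nonneg _) t 2).trans ?_
    nlinarith [sq_nonneg (G * ‖g x - Sg N g x‖ - ‖f x - Sg N f x‖ * (5 * G)), mul_nonneg (sq_nonneg G) (sq_nonneg ‖g x - Sg N g x‖)]
  refine h2.trans ?_
  gcongr
  · exact Sg_tail N hf
  · exact Sg_tail N hg

theorem br_le_mfr {d : ℕ} (hd : d ≤ 3) (k : Fin d → ℤ) : br k ≤ 1 + 3 * (mfr k : ℝ) ^ 2 := by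
  unfold br
  have h : ∀ i, ((k i : ℝ)) ^ 2 ≤ (mfr k : ℝ) ^ 2 := by
    intro i
    have h1 := (mfr_le k (mfr k)).1 le_rfl i
    rw [← sq_abs]
    have h2 : |(k i : ℝ)| = ((k i).natAbs : ℝ) := by rw [Nat.cast_natAbs]; simp
    rw [h2]
    gcongr
  have h2 : ∑ i, ((k i : ℝ)) ^ 2 ≤ d * (mfr k : ℝ) ^ 2 := by
    refine (Finset.sum_le_sum fun i _ => h i).trans ?_
    simp
  have h3 : (d : ℝ) ≤ 3 := by exact_mod_cast hd
  nlinarith [sq_nonneg (mfr k : ℝ)]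

theorem mfr_le_br {d : ℕ} (k : Fin d → ℤ) : (mfr k : ℝ) ^ 2 ≤ br k := by
  rcases Nat.eq_zero_or_pos (mfr k) with h | h
  · rw [h]; have := br_ge_one k; norm_num; linarith
  · have : ∃ i, mfr k ≤ (k i).natAbs := by
      by_contra hh
      push Not at hh
      have := (mfr_le k (mfr k - 1)).2 (fun i => by have := hh i; omega)
      omega
    obtain ⟨i, hi⟩ := this
    have h2 : |(k i : ℝ)| = ((k i).natAbs : ℝ) := by rw [Nat.cast_natAbs]; simp
    have h3 : (mfr k : ℝ) ^ 2 ≤ (k i : ℝ) ^ 2 := by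
      rw [← sq_abs (k i : ℝ), h2]
      gcongr
    have h4 := Finset.single_le_sum (f := fun i => (k i : ℝ) ^ 2) (fun i _ => sq_nonneg _) (Finset.mem_univ i)
    unfold br
    linarith

theorem four_rpow_pow (r : ℝ) (j : ℕ) : ((4:ℝ) ^ r) ^ j = ((4:ℝ) ^ j) ^ r := by
  rw [← Real.rpow_natCast, ← Real.rpow_natCast, ← Real.rpow_mul (by norm_num), ← Real.rpow_mul (by norm_num), mul_comm]

theorem wt_dyadic {d : ℕ} (hd : d ≤ 3) {r : ℝ} (hr : 0 ≤ r) (k : Fin d → ℤ) :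
    ENNReal.ofReal (wt r k) ≤ ENNReal.ofReal (589 ^ r) * (1 + ∑' j : ℕ, ENNReal.ofReal (((4:ℝ) ^ r) ^ j * tl (6 * 2 ^ j) k)) := by
  have hb := br_le_mfr hd k
  have hb0 : 0 ≤ br k := zero_le_one.trans (br_ge_one k)
  rcases lt_or_ge (mfr k) 7 with h | h
  · refine le_mul_of_le_of_one_le ?_ le_self_add
    refine ENNReal.ofReal_le_ofReal ?_
    rw [wt_eq]
    have h' : (mfr k : ℝ) ≤ 7 := by exact_mod_cast h.le
    exact Real.rpow_le_rpow hb0 (by nlinarith [Nat.cast_nonneg (α := ℝ) (mfr k)]) hr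
  · have h7 : (1:ℝ) ≤ (mfr k : ℝ) / 7 := by
      rw [le_div_iff₀ (by norm_num)]; exact_mod_cast (by omega)
    obtain ⟨j, hj1, hj2⟩ := exists_nat_pow_near h7 (by norm_num : (1:ℝ) < 2)
    have ht : tl (6 * 2 ^ j) k = 1 := by
      unfold tl
      rw [if_neg]
      rw [le_div_iff₀ (by norm_num)] at hj1
      have : 2 ^ j * 7 ≤ mfr k := by exact_mod_cast hj1
      have : 0 < 2 ^ j := by positivity
      omega
    calc ENNReal.ofReal (wt r k) ≤ ENNReal.ofReal (589 ^ r) * ENNReal.ofReal (((4:ℝ) ^ r) ^ j * tl (6 * 2 ^ j) k) := by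
          rw [ht, mul_one, ← ENNReal.ofReal_mul (by positivity), four_rpow_pow, ← Real.mul_rpow (by norm_num) (by positivity), wt_eq]
          refine ENNReal.ofReal_le_ofReal (Real.rpow_le_rpow hb0 ?_ hr)
          refine hb.trans ?_
          rw [div_lt_iff₀ (by norm_num), pow_succ] at hj2
          have e : (4:ℝ) ^ j = (2 ^ j) ^ 2 := by rw [← pow_mul, mul_comm j 2, pow_mul]; norm_num
          have e1 : (1:ℝ) ≤ 2 ^ j := one_le_pow₀ (by norm_num)
          rw [e]
          have e2 : (mfr k : ℝ) ^ 2 ≤ (2 ^ j * 2 * 7) ^ 2 := by gcongr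
          nlinarith
      _ ≤ _ := by
          gcongr
          refine le_trans ?_ le_add_self
          exact ENNReal.le_tsum (f := fun j : ℕ => ENNReal.ofReal (((4:ℝ) ^ r) ^ j * tl (6 * 2 ^ j) k)) j

theorem geom2_le {q : ℝ} (hq : 2 ≤ q) (n : ℕ) : ∑ j ∈ Finset.range (n + 1), q ^ j ≤ 2 * q ^ n := by
  induction n with
  | zero => simp
  | succ n ih =>
    rw [Finset.sum_range_succ, pow_succ]
    have : 0 ≤ q ^ n := by positivity
    nlinarith

theorem tl_dyadic {d : ℕ} {r : ℝ} (hr : 1 ≤ r) (k : Fin d → ℤ) :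
    ∑' j : ℕ, ENNReal.ofReal (((4:ℝ) ^ r) ^ j * tl (2 ^ j) k) ≤ ENNReal.ofReal (2 * wt r k) := by
  have hq : (2:ℝ) ≤ 4 ^ r := by
    have := Real.rpow_le_rpow_of_exponent_le (x := 4) (by norm_num) hr
    rw [Real.rpow_one] at this
    linarith
  have hz : ∀ j, j ∉ Finset.range (Nat.clog 2 (mfr k)) → ENNReal.ofReal (((4:ℝ) ^ r) ^ j * tl (2 ^ j) k) = 0 := by
    intro j hj
    have : mfr k ≤ 2 ^ j := (Nat.clog_le_iff_le_pow (by norm_num)).1 (by simpa using hj)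
    simp [tl, this]
  rw [tsum_eq_sum hz]
  rcases Nat.eq_zero_or_pos (Nat.clog 2 (mfr k)) with h | h
  · rw [h]; simp
  · obtain ⟨n, hn⟩ := Nat.exists_eq_succ_of_ne_zero h.ne'
    rw [hn, ← ENNReal.ofReal_sum_of_nonneg]
    · refine ENNReal.ofReal_le_ofReal ?_
      have hlt : 2 ^ n < mfr k := by
        by_contra hh
        push Not at hh
        have := (Nat.clog_le_iff_le_pow (b := 2) (by norm_num)).2 hh
        omega
      calc _ ≤ ∑ j ∈ Finset.range (n + 1), ((4:ℝ) ^ r) ^ j := by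
            refine Finset.sum_le_sum fun j _ => mul_le_of_le_one_right (by positivity) ?_
            unfold tl; split_ifs <;> norm_num
        _ ≤ 2 * ((4:ℝ) ^ r) ^ n := geom2_le hq n
        _ ≤ _ := by
            gcongr
            rw [four_rpow_pow, wt_eq]
            refine Real.rpow_le_rpow (by positivity) (le_trans ?_ (mfr_le_br k)) (by linarith)
            have e : (4:ℝ) ^ n = (2 ^ n) ^ 2 := by rw [← pow_mul, mul_comm n 2, pow_mul]; norm_num
            rw [e]
            have : (2:ℝ) ^ n ≤ mfr k := by exact_mod_cast hlt.le
            gcongr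
    · intro j _
      unfold tl; split_ifs <;> positivity

theorem tl_nonneg {d : ℕ} (N : ℕ) (k : Fin d → ℤ) : 0 ≤ tl N k := by unfold tl; split_ifs <;> norm_num

theorem SL_dyadic_up {d : ℕ} (hd : d ≤ 3) {r : ℝ} (hr : 0 ≤ r) (u : (Fin d → ℤ) → ℂ) :
    SL (wt r) u ≤ ENNReal.ofReal (589 ^ r) * (SL (fun _ => 1) u + ∑' j : ℕ, ENNReal.ofReal (((4:ℝ) ^ r) ^ j) * SL (tl (6 * 2 ^ j)) u) := by
  have e : ∀ j : ℕ, ENNReal.ofReal (((4:ℝ) ^ r) ^ j) * SL (tl (6 * 2 ^ j)) u = ∑' k, ENNReal.ofReal (((4:ℝ) ^ r) ^ j * tl (6 * 2 ^ j) k) * ENNReal.ofReal (‖u k‖ ^ 2) := by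
    intro j
    unfold SL
    rw [← ENNReal.tsum_mul_left]
    congr 1; funext k
    rw [ENNReal.ofReal_mul (tl_nonneg _ _), ENNReal.ofReal_mul (by positivity), mul_assoc]
  simp only [e]
  rw [ENNReal.tsum_comm]
  unfold SL
  rw [← ENNReal.tsum_add, ← ENNReal.tsum_mul_left]
  refine ENNReal.tsum_le_tsum fun k => ?_
  rw [ENNReal.ofReal_mul (wt_pos r k).le, ENNReal.tsum_mul_right, one_mul]
  refine (mul_le_mul_left (wt_dyadic hd hr k) _).trans (le_of_eq ?_)
  ring

theorem SL_dyadic_dn {d : ℕ} {r : ℝ} (hr : 1 ≤ r) (u : (Fin d → ℤ) → ℂ) :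
    ∑' j : ℕ, ENNReal.ofReal (((4:ℝ) ^ r) ^ j) * SL (tl (2 ^ j)) u ≤ 2 * SL (wt r) u := by
  have e : ∀ j : ℕ, ENNReal.ofReal (((4:ℝ) ^ r) ^ j) * SL (tl (2 ^ j)) u = ∑' k, ENNReal.ofReal (((4:ℝ) ^ r) ^ j * tl (2 ^ j) k) * ENNReal.ofReal (‖u k‖ ^ 2) := by
    intro j
    unfold SL
    rw [← ENNReal.tsum_mul_left]
    congr 1; funext k
    rw [ENNReal.ofReal_mul (tl_nonneg _ _), ENNReal.ofReal_mul (by positivity), mul_assoc]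
  simp only [e]
  rw [ENNReal.tsum_comm]
  unfold SL
  rw [← ENNReal.tsum_mul_left]
  refine ENNReal.tsum_le_tsum fun k => ?_
  rw [ENNReal.tsum_mul_right]
  refine (mul_le_mul_left (tl_dyadic hr k) _).trans (le_of_eq ?_)
  rw [ENNReal.ofReal_mul (by norm_num), ENNReal.ofReal_mul (wt_pos r k).le, mul_assoc]
  simp

/-- Moser type product estimate. -/
theorem prod_est {d : ℕ} (hd : d ≤ 3) {r : ℝ} (hr : 1 ≤ r) {f g : Td d → ℝ} (hf : SP f) (hg : SP g) {G : ℝ}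
    (hfG : ∀ x, |f x| ≤ G) (hgG : ∀ x, |g x| ≤ G) :
    SL (wt r) (fCoeff (fun x => f x * g x)) ≤ ENNReal.ofReal (101 * 589 ^ r * G ^ 2) * (SL (wt r) (fCoeff f) + SL (wt r) (fCoeff g)) := by
  have hG0 : 0 ≤ G := (abs_nonneg _).trans (hfG 0)
  have cf : Continuous (fun x => (f x : ℂ)) := Complex.continuous_ofReal.comp hf.cont
  have cg : Continuous (fun x => (g x : ℂ)) := Complex.continuous_ofReal.comp hg.cont
  have e : fCoeff (fun x => f x * g x) = fc (fun x => (f x : ℂ) * (g x : ℂ)) := by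
    rw [fCoeff_eq_fc]; congr 1; funext x; push_cast; rfl
  have h0 : SL (fun _ => 1) (fCoeff (fun x => f x * g x)) ≤ ENNReal.ofReal (G ^ 2) * SL (wt r) (fCoeff g) := by
    have h1 : SL (fun _ => 1) (fCoeff g) ≤ SL (wt r) (fCoeff g) := by
      rw [← wt_zero_eq]; exact SL_wt_mono (by linarith) _
    refine le_trans ?_ (mul_le_mul_right h1 _)
    rw [SL_one_real (hf.mul hg).cont (hf.mul hg).2, SL_one_real hg.cont hg.2, ← ENNReal.ofReal_mul (by positivity), ← integral_const_mul]
    refine ENNReal.ofReal_le_ofReal ?_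
    have := hf.cont
    have := hg.cont
    refine integral_mono (int_of_cont (by fun_prop)) (int_of_cont (by fun_prop)) fun x => ?_
    simp only [mul_pow]
    have := sq_le_sq' (by linarith [neg_abs_le (f x), hfG x]) ((le_abs_self _).trans (hfG x))
    gcongr
  refine (SL_dyadic_up hd (by linarith) _).trans ?_
  have h1 : ∑' j : ℕ, ENNReal.ofReal (((4:ℝ) ^ r) ^ j) * SL (tl (6 * 2 ^ j)) (fCoeff (fun x => f x * g x)) ≤
      ENNReal.ofReal (50 * G ^ 2) * (2 * SL (wt r) (fCoeff f) + 2 * SL (wt r) (fCoeff g)) := by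
    refine le_trans ?_ (mul_le_mul_right (add_le_add (SL_dyadic_dn hr (fCoeff f)) (SL_dyadic_dn hr (fCoeff g))) _)
    rw [← ENNReal.tsum_add, ← ENNReal.tsum_mul_left]
    refine ENNReal.tsum_le_tsum fun j => ?_
    rw [e]
    refine (mul_le_mul_right (prod_tail hd (2 ^ j) cf cg (fun x => by simpa using hfG x) (fun x => by simpa using hgG x)) _).trans (le_of_eq ?_)
    rw [fCoeff_eq_fc, fCoeff_eq_fc]
    ring
  refine (mul_le_mul_right (add_le_add h0 h1) _).trans ?_
  have e1 : ENNReal.ofReal (101 * 589 ^ r * G ^ 2) = ENNReal.ofReal (589 ^ r) * (101 * ENNReal.ofReal (G ^ 2)) := by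
    rw [show (101 * 589 ^ r * G ^ 2 : ℝ) = 589 ^ r * (101 * G ^ 2) by ring, ENNReal.ofReal_mul (by positivity), ENNReal.ofReal_mul (by norm_num)]
    simp
  have e2 : ENNReal.ofReal (50 * G ^ 2) = 50 * ENNReal.ofReal (G ^ 2) := by
    rw [ENNReal.ofReal_mul (by norm_num)]; simp
  rw [e1, e2, mul_assoc (ENNReal.ofReal (589 ^ r))]
  refine mul_le_mul' le_rfl ?_
  calc _ = ENNReal.ofReal (G ^ 2) * (100 * SL (wt r) (fCoeff f) + 101 * SL (wt r) (fCoeff g)) := by ring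
    _ ≤ ENNReal.ofReal (G ^ 2) * (101 * SL (wt r) (fCoeff f) + 101 * SL (wt r) (fCoeff g)) := by
        gcongr; norm_num
    _ = _ := by ring

theorem hs_le_of_SL {d : ℕ} {r : ℝ} {f : Td d → ℝ} (hf : SP f) {X : ℝ} (hX : 0 ≤ X)
    (h : SL (wt r) (fCoeff f) ≤ ENNReal.ofReal X) : hsNorm r f ^ 2 ≤ X := by
  rwa [hf.hs, ENNReal.ofReal_le_ofReal_iff hX] at h

theorem fCoeff_add {d : ℕ} {f g : Td d → ℝ} (hf : Continuous f) (hg : Continuous g) (k : Fin d → ℤ) :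
    fCoeff (fun x => f x + g x) k = fCoeff f k + fCoeff g k := by
  have := eK_cont (d := d) (-k)
  rw [fCoeff_eq_fc, fCoeff_eq_fc, fCoeff_eq_fc, fc_eq, fc_eq, fc_eq, ← integral_add (int_of_cont (by fun_prop)) (int_of_cont (by fun_prop))]
  congr 1; funext x; push_cast; ring

theorem fCoeff_smul {d : ℕ} (a : ℝ) (f : Td d → ℝ) (k : Fin d → ℤ) :
    fCoeff (fun x => a * f x) k = a * fCoeff f k := by
  rw [fCoeff_eq_fc, fCoeff_eq_fc, fc_eq, fc_eq, ← integral_const_mul]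
  congr 1; funext x; push_cast; ring

theorem fCoeff_sum {d : ℕ} {ι : Type*} (P : Finset ι) {f : ι → Td d → ℝ} (hf : ∀ i, Continuous (f i)) (k : Fin d → ℤ) :
    fCoeff (fun x => ∑ i ∈ P, f i x) k = ∑ i ∈ P, fCoeff (f i) k := by
  have := eK_cont (d := d) (-k)
  simp only [fCoeff_eq_fc, fc_eq]
  rw [← integral_finsetSum _ (fun i _ => int_of_cont (by have := hf i; fun_prop))]
  congr 1; funext x; push_cast; rw [Finset.sum_mul]

theorem hs_add {d : ℕ} (r : ℝ) {f g : Td d → ℝ} (hf : SP f) (hg : SP g) :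
    hsNorm r (fun x => f x + g x) ^ 2 ≤ 2 * hsNorm r f ^ 2 + 2 * hsNorm r g ^ 2 := by
  refine hs_le_of_SL (hf.add hg) (by positivity) ?_
  have e : fCoeff (fun x => f x + g x) = fun k => fCoeff f k + fCoeff g k := funext (fCoeff_add hf.cont hg.cont)
  rw [e]
  exact (SL_vadd (fun k => (wt_pos r k).le) _ _).trans
    (eb_add (by positivity) (by positivity) (eb_two (hf.hs r).le) (eb_two (hg.hs r).le))

theorem hs_smul {d : ℕ} (r a : ℝ) (f : Td d → ℝ) :
    hsNorm r (fun x => a * f x) ^ 2 = a ^ 2 * hsNorm r f ^ 2 := by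
  have h : ∀ g : Td d → ℝ, hsNorm r g ^ 2 = hsNormSq r g := fun g => by
    rw [hsNorm, Real.sq_sqrt]
    exact tsum_nonneg fun k => mul_nonneg (wt_pos r k).le (by positivity)
  rw [h, h, hsNormSq, hsNormSq, ← tsum_mul_left]
  congr 1; funext k
  rw [fCoeff_smul, norm_mul, Complex.norm_real, mul_pow, Real.norm_eq_abs, sq_abs]
  ring

theorem hs_sum {d : ℕ} (r : ℝ) {ι : Type*} [Fintype ι] {f : ι → Td d → ℝ} (hf : ∀ i, SP (f i)) :
    hsNorm r (fun x => ∑ i, f i x) ^ 2 ≤ Fintype.card ι * ∑ i, hsNorm r (f i) ^ 2 := by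
  refine hs_le_of_SL (SP.sum _ fun i _ => hf i) (by positivity) ?_
  have e : ∑ i, hsNorm r (f i) ^ 2 = ∑' k, ∑ i, wt r k * ‖fCoeff (f i) k‖ ^ 2 := by
    have hs : ∀ i, Summable fun k => wt r k * ‖fCoeff (f i) k‖ ^ 2 := fun i => SL_summable (fun k => (wt_pos r k).le) ((hf i).fin r)
    rw [Summable.tsum_finsetSum (fun i _ => hs i)]
    refine Finset.sum_congr rfl fun i _ => ?_
    rw [hsNorm, Real.sq_sqrt, hsNormSq]
    exact tsum_nonneg fun k => mul_nonneg (wt_pos r k).le (by positivity)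
  rw [ENNReal.ofReal_mul (by positivity), ENNReal.ofReal_sum_of_nonneg (fun i _ => by positivity)]
  simp only [← (hf _).hs r]
  unfold SL
  rw [← Summable.tsum_finsetSum (fun i _ => ENNReal.summable), ← ENNReal.tsum_mul_left]
  refine ENNReal.tsum_le_tsum fun k => ?_
  rw [← ENNReal.ofReal_sum_of_nonneg (fun i _ => mul_nonneg (wt_pos r k).le (by positivity)), ← ENNReal.ofReal_mul (by positivity)]
  refine ENNReal.ofReal_le_ofReal ?_
  rw [fCoeff_sum _ (fun i => (hf i).cont), ← Finset.mul_sum]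
  have h1 : ‖∑ i, fCoeff (f i) k‖ ^ 2 ≤ Fintype.card ι * ∑ i, ‖fCoeff (f i) k‖ ^ 2 := by
    refine (pow_le_pow_left₀ (norm_nonneg _) (norm_sum_le _ _) 2).trans ?_
    exact sq_sum_le_card_mul_sum_sq
  calc _ ≤ wt r k * (Fintype.card ι * ∑ i, ‖fCoeff (f i) k‖ ^ 2) := mul_le_mul_of_nonneg_left h1 (wt_pos r k).le
    _ = _ := by ring

theorem hs_prod {d : ℕ} (hd : d ≤ 3) {r : ℝ} (hr : 1 ≤ r) {f g : Td d → ℝ} (hf : SP f) (hg : SP g) {G : ℝ}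
    (hfG : ∀ x, |f x| ≤ G) (hgG : ∀ x, |g x| ≤ G) :
    hsNorm r (fun x => f x * g x) ^ 2 ≤ 101 * 589 ^ r * G ^ 2 * (hsNorm r f ^ 2 + hsNorm r g ^ 2) := by
  refine hs_le_of_SL (hf.mul hg) (by positivity) ?_
  refine (prod_est hd hr hf hg hfG hgG).trans (eb_cmul (by positivity) ?_)
  exact eb_add (by positivity) (by positivity) (hf.hs r).le (hg.hs r).le

theorem two_le_top : (2 : WithTop ℕ∞) ≤ ((⊤ : ℕ∞) : WithTop ℕ∞) := by
  have h : (((2 : ℕ) : ℕ∞) : WithTop ℕ∞) ≤ ((⊤ : ℕ∞) : WithTop ℕ∞) := WithTop.coe_le_coe.2 le_top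
  exact h

theorem pd_comm {d : ℕ} {c : Td d → ℝ} (hc : SP c) (i j : Fin d) (x : Td d) : pd i (pd j c) x = pd j (pd i c) x := by
  have hs : IsSymmSndFDerivAt ℝ c x := by
    refine (hc.1.contDiffAt).isSymmSndFDerivAt ?_
    simp only [minSmoothness_of_isRCLikeNormedField]
    exact two_le_top
  have hd : DifferentiableAt ℝ (fderiv ℝ c) x :=
    (hc.1.fderiv_right (m := 1) (by rw [one_add_one_eq_two]; exact two_le_top)).differentiable (by norm_num) x
  have e : ∀ i j : Fin d, pd i (pd j c) x = fderiv ℝ (fderiv ℝ c) x (Pi.single i 1) (Pi.single j 1) := by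
    intro i j
    change fderiv ℝ (fun y => fderiv ℝ c y (Pi.single j 1)) x (Pi.single i 1) = _
    rw [fderiv_clm_apply hd (differentiableAt_const _)]
    simp
  rw [e, e]
  exact hs _ _

theorem pd_le_gn {d : ℕ} (c : Td d → ℝ) (j : Fin d) (x : Td d) : |pd j c x| ≤ gn c x := by
  rw [gn]
  refine Real.abs_le_sqrt ?_
  exact Finset.single_le_sum (f := fun i => pd i c x ^ 2) (fun i _ => sq_nonneg _) (Finset.mem_univ j)

theorem pd_le_linf {d : ℕ} {c : Td d → ℝ} (hc : SP c) (j : Fin d) (x : Td d) : |pd j c x| ≤ linf (gn c) := by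
  refine (pd_le_gn c j x).trans ((le_abs_self _).trans (le_linf ?_ ?_ x))
  · unfold gn
    have := fun i => (hc.pd i).cont
    fun_prop
  · intro y k
    unfold gn
    simp only [(hc.pd _).2 y k]

theorem SP.smul {d : ℕ} (a : ℝ) {f : Td d → ℝ} (hf : SP f) : SP (fun x => a * f x) := (SP.const a).mul hf

theorem SP.lap {d : ℕ} {c : Td d → ℝ} (hc : SP c) : SP (lap c) := SP.sum _ fun i _ => (hc.pd i).pd i

theorem SP.chemMu {d : ℕ} (Cc : ℝ) {c : Td d → ℝ} (hc : SP c) : SP (chemMu Cc c) := by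
  have h1 : SP (fun x => 4 * c x ^ 3 - 4 * c x) := SP.comp (φ := fun t => 4 * t ^ 3 - 4 * t) (by fun_prop) hc
  exact h1.sub (hc.lap.smul Cc)

theorem h_eq {d : ℕ} (Cc : ℝ) {c : Td d → ℝ} (hc : SP c) (j : Fin d) (x : Td d) :
    chemMu Cc c x * pd j c x = pd j (fun y => (c y ^ 2 - 1) ^ 2) x +
      Cc * ∑ i, ((1 / 2) * pd j (fun y => pd i c y * pd i c y) x + (-1) * pd i (fun y => pd i c y * pd j c y) x) := by
  have h1 : pd j (fun y => (c y ^ 2 - 1) ^ 2) x = (4 * c x ^ 3 - 4 * c x) * pd j c x := by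
    rw [pd_comp (φ := fun t => (t ^ 2 - 1) ^ 2) (by fun_prop) hc.c1]
    congr 1
    have : HasDerivAt (fun t : ℝ => (t ^ 2 - 1) ^ 2) (2 * (c x ^ 2 - 1) * (2 * c x)) (c x) := by
      have h0 := (((hasDerivAt_id (c x)).pow 2).sub_const 1).pow 2
      have e0 : 2 * (c x ^ 2 - 1) * (2 * c x) = ((2:ℕ):ℝ) * ((id ^ 2) (c x) - 1) ^ (2 - 1) * (((2:ℕ):ℝ) * id (c x) ^ (2 - 1) * 1) := by
        simp
      rw [e0]
      exact h0
    rw [this.deriv]; ring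
  have h2 : ∀ i, (1 / 2) * pd j (fun y => pd i c y * pd i c y) x + (-1) * pd i (fun y => pd i c y * pd j c y) x =
      - (pd i (pd i c) x * pd j c x) := by
    intro i
    rw [pd_mul (hc.pd i).c1 (hc.pd i).c1, pd_mul (hc.pd i).c1 (hc.pd j).c1, pd_comm hc j i]
    ring
  rw [h1]
  simp only [h2]
  rw [Finset.sum_neg_distrib, ← Finset.sum_mul]
  unfold chemMu lap
  ring

theorem h_est {d : ℕ} (hd : d ≤ 3) (Cc : ℝ) {s : ℝ} (hs : 0 ≤ s) (n : ℕ) (hn : s + 1 ≤ 2 + n / 2) :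
    ∃ F, MF F ∧ ∀ c : Td d → ℝ, SP c → ∀ j,
      hsNorm s (fun x => chemMu Cc c x * pd j c x) ^ 2 ≤
        F (linf c) * (1 + linf (gn c)) ^ 2 * (1 + hsNorm 2 c) ^ (2 * n) * hsNorm (s + 2) c ^ 2 := by
  obtain ⟨F, hF, b⟩ := comp_est hd n (s + 1) hn (φ := fun t => (t ^ 2 - 1) ^ 2) (by fun_prop)
  set K : ℝ := 101 * 589 ^ (s + 1) with hK
  have hK0 : 0 < K := by positivity
  refine ⟨fun m => 80 * F m + (1 + 2 * Cc ^ 2 * (3 * (3 * (8000 * K)))),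
    ((MF.const (by norm_num)).mul hF).add (MF.const (by nlinarith [mul_nonneg (sq_nonneg Cc) hK0.le])), fun c hc j => ?_⟩
  set A := hsNorm (s + 2) c
  set B := hsNorm 2 c
  set G := linf (gn c)
  have hA : 0 ≤ A := hs_nonneg _ _
  have hB : 0 ≤ B := hs_nonneg _ _
  have hG : 0 ≤ G := linf_nonneg _
  have hP : ∀ i j, SP (fun y => pd i c y * pd j c y) := fun i j => (hc.pd i).mul (hc.pd j)
  have hφ : SP (fun y => (c y ^ 2 - 1) ^ 2) := SP.comp (φ := fun t => (t ^ 2 - 1) ^ 2) (by fun_prop) hc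
  have hX : ∀ i, SP (fun x => (1 / 2) * pd j (fun y => pd i c y * pd i c y) x + (-1) * pd i (fun y => pd i c y * pd j c y) x) :=
    fun i => (((hP i i).pd j).smul _).add (((hP i j).pd i).smul _)
  rw [funext (h_eq Cc hc j)]
  have p1 : ∀ i j l, hsNorm s (pd l (fun y => pd i c y * pd j c y)) ^ 2 ≤ 40 * (K * G ^ 2 * (40 * A ^ 2 + 40 * A ^ 2)) := by
    intro i j l
    refine (hs_pd (hP i j) l s).trans ?_
    gcongr
    refine (hs_prod hd (by linarith) (hc.pd i) (hc.pd j) (pd_le_linf hc i) (pd_le_linf hc j)).trans ?_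
    have q1 := hs_pd hc i (s + 1)
    have q2 := hs_pd hc j (s + 1)
    rw [show s + 1 + 1 = s + 2 by ring] at q1 q2
    rw [hK]
    gcongr
  have p2 : ∀ i, hsNorm s (fun x => (1 / 2) * pd j (fun y => pd i c y * pd i c y) x + (-1) * pd i (fun y => pd i c y * pd j c y) x) ^ 2 ≤
      8000 * K * G ^ 2 * A ^ 2 := by
    intro i
    refine (hs_add s (((hP i i).pd j).smul _) (((hP i j).pd i).smul _)).trans ?_
    rw [hs_smul, hs_smul]
    nlinarith [p1 i i j, p1 i j i, mul_nonneg (mul_nonneg hK0.le (sq_nonneg G)) (sq_nonneg A)]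
  have p3 := hs_sum s hX
  have p4 : hsNorm s (fun x => ∑ i, ((1 / 2) * pd j (fun y => pd i c y * pd i c y) x + (-1) * pd i (fun y => pd i c y * pd j c y) x)) ^ 2 ≤
      3 * (3 * (8000 * K * G ^ 2 * A ^ 2)) := by
    refine p3.trans ?_
    have h3 : (d : ℝ) ≤ 3 := by exact_mod_cast hd
    have : ∑ i, hsNorm s (fun x => (1 / 2) * pd j (fun y => pd i c y * pd i c y) x + (-1) * pd i (fun y => pd i c y * pd j c y) x) ^ 2 ≤
        3 * (8000 * K * G ^ 2 * A ^ 2) := by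
      refine (Finset.sum_le_sum fun i _ => p2 i).trans ?_
      simp only [Finset.sum_const, Finset.card_univ, Fintype.card_fin, nsmul_eq_mul]
      gcongr
    rw [Fintype.card_fin]
    gcongr
  have p5 : hsNorm s (pd j (fun y => (c y ^ 2 - 1) ^ 2)) ^ 2 ≤ 40 * (F (linf c) * (1 + B) ^ (2 * n) * A ^ 2) := by
    have := hF.pos (linf c)
    refine hs_le_of_SL (hφ.pd j) (by positivity) ?_
    refine (SL_pd_le hφ.c1 hφ.2 j s).trans (eb_cmul (by norm_num) ?_)
    refine (b c hc).trans (ENNReal.ofReal_le_ofReal ?_)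
    have q1 := hs_mono (show max (s + 1) 2 ≤ s + 2 from max_le (by linarith) (by linarith)) hc
    have q2 := hs_nonneg (max (s + 1) 2) c
    gcongr
  refine (hs_add s (hφ.pd j) ((SP.sum _ fun i _ => hX i).smul Cc)).trans ?_
  rw [hs_smul]
  have w1 : 1 ≤ (1 + B) ^ (2 * n) := one_le_pow₀ (by linarith)
  have w2 : 1 ≤ (1 + G) ^ 2 := one_le_pow₀ (by linarith)
  have w3 : G ^ 2 ≤ (1 + G) ^ 2 := by gcongr; linarith
  have hFp := hF.pos (linf c)
  calc _ ≤ 2 * (40 * (F (linf c) * (1 + B) ^ (2 * n) * A ^ 2)) + 2 * (Cc ^ 2 * (3 * (3 * (8000 * K * G ^ 2 * A ^ 2)))) := by gcongr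
    _ = 80 * F (linf c) * 1 * (1 + B) ^ (2 * n) * A ^ 2 + (2 * Cc ^ 2 * (3 * (3 * (8000 * K)))) * G ^ 2 * 1 * A ^ 2 := by ring
    _ ≤ 80 * F (linf c) * (1 + G) ^ 2 * (1 + B) ^ (2 * n) * A ^ 2 + (1 + 2 * Cc ^ 2 * (3 * (3 * (8000 * K)))) * (1 + G) ^ 2 * (1 + B) ^ (2 * n) * A ^ 2 := by
        gcongr
        linarith
    _ = _ := by ring

theorem h_L2 {d : ℕ} (hd : d ≤ 3) (Cc : ℝ) :
    ∃ F, MF F ∧ ∀ c : Td d → ℝ, SP c → ∀ j,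
      hsNorm 0 (fun x => chemMu Cc c x * pd j c x) ^ 2 ≤ F (linf c) * linf (gn c) ^ 2 * hsNorm 2 c ^ 2 := by
  refine ⟨fun m => 32 * ((1 + max m 0) ^ 2) ^ 2 + (1 + 2 * Cc ^ 2 * (3 * (3 * 1600))), ?_, ?_⟩
  · exact ((MF.const (by norm_num)).mul ((MF.lin.pow 2).pow 2)).add (MF.const (by nlinarith [sq_nonneg Cc]))
  intro c hc j
  set B := hsNorm 2 c
  set G := linf (gn c)
  set M := linf c
  have hM : 0 ≤ M := linf_nonneg _
  simp only [max_eq_left hM]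
  have hB : 0 ≤ B := hs_nonneg _ _
  have hG : 0 ≤ G := linf_nonneg _
  have hm := hc.chemMu Cc
  have L2 : ∀ {f : Td d → ℝ}, SP f → hsNorm 0 f ^ 2 = ∫ x, f x ^ 2 ∂(muB d) := by
    intro f hf
    have := hf.hs 0
    rw [wt_zero_eq, SL_one_real hf.cont hf.2] at this
    exact ((ENNReal.ofReal_eq_ofReal_iff (integral_nonneg fun _ => sq_nonneg _) (by positivity)).1 this).symm
  have i0 : ∫ x, c x ^ 2 ∂(muB d) ≤ B ^ 2 := by
    rw [← L2 hc]
    have := hs_mono (show (0:ℝ) ≤ 2 by norm_num) hc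
    have := hs_nonneg 0 c
    gcongr
  have i1 : ∫ x, lap c x ^ 2 ∂(muB d) ≤ 3 * (3 * (1600 * B ^ 2)) := by
    have h3 : (d : ℝ) ≤ 3 := by exact_mod_cast hd
    have cc : ∀ i, Continuous (pd i (pd i c)) := fun i => ((hc.pd i).pd i).cont
    have cl := hc.lap.cont
    have : ∫ x, lap c x ^ 2 ∂(muB d) ≤ ∫ x, d * ∑ i, pd i (pd i c) x ^ 2 ∂(muB d) := by
      refine integral_mono (int_of_cont (by fun_prop)) (int_of_cont (by fun_prop)) fun x => ?_
      have := sq_sum_le_card_mul_sum_sq (s := Finset.univ) (f := fun i => pd i (pd i c) x)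
      simpa [lap] using this
    refine this.trans ?_
    rw [integral_const_mul, integral_finsetSum _ (fun i _ => int_of_cont (by have := cc i; fun_prop))]
    have : ∑ i, ∫ x, pd i (pd i c) x ^ 2 ∂(muB d) ≤ 3 * (1600 * B ^ 2) := by
      refine (Finset.sum_le_sum fun i _ => int_pd2_sq hc i i).trans ?_
      simp only [Finset.sum_const, Finset.card_univ, Fintype.card_fin, nsmul_eq_mul]
      gcongr
    have h0 : 0 ≤ ∑ i, ∫ x, pd i (pd i c) x ^ 2 ∂(muB d) := Finset.sum_nonneg fun i _ => integral_nonneg fun _ => sq_nonneg _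
    gcongr
  have i2 : ∫ x, chemMu Cc c x ^ 2 ∂(muB d) ≤ 32 * ((1 + M) ^ 2) ^ 2 * B ^ 2 + 2 * Cc ^ 2 * (3 * (3 * (1600 * B ^ 2))) := by
    have c1 := hc.cont
    have c2 := hc.lap.cont
    have c3 := hm.cont
    have : ∫ x, chemMu Cc c x ^ 2 ∂(muB d) ≤ ∫ x, 32 * ((1 + M) ^ 2) ^ 2 * c x ^ 2 + 2 * Cc ^ 2 * lap c x ^ 2 ∂(muB d) := by
      refine integral_mono (int_of_cont (by fun_prop)) (int_of_cont (by fun_prop)) fun x => ?_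
      have hx := le_linf hc.cont hc.2 x
      have h1 : (c x ^ 2 - 1) ^ 2 ≤ ((1 + M) ^ 2) ^ 2 := by
        have : c x ^ 2 ≤ M ^ 2 := sq_le_sq' (by linarith [neg_abs_le (c x)]) ((le_abs_self _).trans hx)
        refine sq_le_sq' ?_ ?_ <;> nlinarith [sq_nonneg (c x)]
      have h2 : (4 * c x ^ 3 - 4 * c x) ^ 2 ≤ 16 * ((1 + M) ^ 2) ^ 2 * c x ^ 2 := by
        calc _ = 16 * (c x ^ 2 - 1) ^ 2 * c x ^ 2 := by ring
          _ ≤ _ := by gcongr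
      unfold chemMu
      simp only
      nlinarith [sq_nonneg ((4 * c x ^ 3 - 4 * c x) + Cc * lap c x)]
    refine this.trans ?_
    rw [integral_add (int_of_cont (by fun_prop)) (int_of_cont (by fun_prop)), integral_const_mul, integral_const_mul]
    gcongr
  rw [L2 (hm.mul (hc.pd j))]
  have c3 := hm.cont
  have c4 := (hc.pd j).cont
  have : ∫ x, (chemMu Cc c x * pd j c x) ^ 2 ∂(muB d) ≤ ∫ x, G ^ 2 * chemMu Cc c x ^ 2 ∂(muB d) := by
    refine integral_mono (int_of_cont (by fun_prop)) (int_of_cont (by fun_prop)) fun x => ?_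
    have hx := pd_le_linf hc j x
    have : pd j c x ^ 2 ≤ G ^ 2 := sq_le_sq' (by linarith [neg_abs_le (pd j c x)]) ((le_abs_self _).trans hx)
    simp only [mul_pow]
    rw [mul_comm]
    gcongr
  refine this.trans ?_
  rw [integral_const_mul]
  calc _ ≤ G ^ 2 * (32 * ((1 + M) ^ 2) ^ 2 * B ^ 2 + 2 * Cc ^ 2 * (3 * (3 * (1600 * B ^ 2)))) := by gcongr
    _ ≤ _ := by nlinarith [mul_nonneg (sq_nonneg G) (sq_nonneg B)]

theorem Tm_sub {d : ℕ} {a : Td d → ℝ} (ha : Continuous a) {K : ℝ} (hK : ∀ x, |a x| ≤ K)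
    {u v : (Fin d → ℤ) → ℂ} (hu : Summable fun k => ‖u k‖ ^ 2) (hv : Summable fun k => ‖v k‖ ^ 2) (k : Fin d → ℤ) :
    Tm a (fun l => u l - v l) k = Tm a u k - Tm a v k := by
  unfold Tm
  rw [← (Tm_summable ha hK hu k).tsum_sub (Tm_summable ha hK hv k)]
  congr 1; funext l; ring

theorem fCoeff_sub {d : ℕ} {f g : Td d → ℝ} (hf : Continuous f) (hg : Continuous g) (k : Fin d → ℤ) :
    fCoeff (fun x => f x - g x) k = fCoeff f k - fCoeff g k := by
  rw [fCoeff_eq_fc, fCoeff_eq_fc, fCoeff_eq_fc,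
    ← fc_sub (f := fun x => (f x : ℂ)) (g := fun x => (g x : ℂ)) (Complex.continuous_ofReal.comp hf) (Complex.continuous_ofReal.comp hg)]
  congr 1; funext x; push_cast; rfl

theorem sq_summable_add {ι : Type*} {u v : ι → ℂ} (hu : Summable fun k => ‖u k‖ ^ 2) (hv : Summable fun k => ‖v k‖ ^ 2) :
    Summable fun k => ‖u k - v k‖ ^ 2 := by
  refine Summable.of_nonneg_of_le (fun k => by positivity) (fun k => ?_) ((hu.mul_left 2).add (hv.mul_left 2))
  have := norm_sub_le (u k) (v k)
  have := pow_le_pow_left₀ (norm_nonneg _) this 2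
  nlinarith [sq_nonneg (‖u k‖ - ‖v k‖)]

theorem sq_tsum_sub {ι : Type*} {u v : ι → ℂ} (hu : Summable fun k => ‖u k‖ ^ 2) (hv : Summable fun k => ‖v k‖ ^ 2) :
    ∑' k, ‖u k - v k‖ ^ 2 ≤ 2 * ∑' k, ‖u k‖ ^ 2 + 2 * ∑' k, ‖v k‖ ^ 2 := by
  rw [← tsum_mul_left, ← tsum_mul_left, ← (hu.mul_left 2).tsum_add (hv.mul_left 2)]
  refine (sq_summable_add hu hv).tsum_le_tsum (fun k => ?_) ((hu.mul_left 2).add (hv.mul_left 2))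
  have := norm_sub_le (u k) (v k)
  have := pow_le_pow_left₀ (norm_nonneg _) this 2
  nlinarith [sq_nonneg (‖u k‖ - ‖v k‖)]

theorem energy {d : ℕ} {a : Td d → ℝ} (ha : Continuous a) {K m : ℝ} (hK : ∀ x, |a x| ≤ K) (hm0 : 0 < m) (hm : ∀ x, m ≤ a x)
    {g h : Fin d → Td d → ℝ} (hg : ∀ j, Continuous (g j)) (pg : ∀ j, TPer (g j)) (hh : ∀ j, Continuous (h j)) (ph : ∀ j, TPer (h j))
    {w : (Fin d → ℤ) → ℝ} {W : ℝ} (hw : ∀ k, |w k| ≤ W)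
    (orth : ∀ k, ∑ j, (starRingEnd ℂ) (fCoeff (g j) k) * fc (fun x => (a x : ℂ) * ((g j x - h j x : ℝ) : ℂ)) k = 0)
    {e y : Fin d → ℝ} (he : ∀ j, 0 ≤ e j) (hy : ∀ j, 0 ≤ y j)
    (h1 : ∀ j, SL (fun _ => 1) (Er a w (fun x => ((g j x - h j x : ℝ) : ℂ))) ≤ ENNReal.ofReal (e j))
    (h2 : ∀ j, SL (fun k => w k ^ 2) (fCoeff (h j)) ≤ ENNReal.ofReal (y j)) :
    ∑ j, ∑' k, w k ^ 2 * ‖fCoeff (g j) k‖ ^ 2 ≤ 2 / m ^ 2 * ∑ j, (K ^ 2 * y j + e j) := by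
  set V := fun j x => ((g j x - h j x : ℝ) : ℂ) with hV
  have mV : ∀ j, MemLp (V j) 2 (muB d) := fun j =>
    memLp_per (f := fun x => g j x - h j x) ((hg j).sub (hh j)) (fun x k => by simp only [pg j x k, ph j x k])
  set u := fun j k => (w k : ℂ) * fCoeff (g j) k with hu
  set z := fun j k => (w k : ℂ) * fCoeff (h j) k with hz
  have su : ∀ j, Summable fun k => ‖u j k‖ ^ 2 := fun j =>
    summable_weight hw (parseval_sq (memLp_per (hg j) (pg j))).summable
  have sz : ∀ j, Summable fun k => ‖z j k‖ ^ 2 := fun j =>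
    summable_weight hw (parseval_sq (memLp_per (hh j) (ph j))).summable
  have sE : ∀ j, Summable fun k => ‖Er a w (V j) k‖ ^ 2 := fun j => by
    have := SL_summable (fun _ => zero_le_one) (ne_top_of_le_ne_top ENNReal.ofReal_ne_top (h1 j))
    simpa only [one_mul] using this
  have bE : ∀ j, ∑' k, ‖Er a w (V j) k‖ ^ 2 ≤ e j := fun j => by
    have := SL_le_real (fun _ => zero_le_one) (he j) (h1 j)
    simpa only [one_mul] using this
  have bz : ∀ j, ∑' k, ‖z j k‖ ^ 2 ≤ y j := fun j => by
    have := SL_le_real (fun k => sq_nonneg _) (hy j) (h2 j)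
    simpa [hz, mul_pow] using this
  have sT := fun j => (Tm_bound ha hK (sz j)).1
  have bT := fun j => (Tm_bound ha hK (sz j)).2
  have split : ∀ j k, (w k : ℂ) * fc (fun x => (a x : ℂ) * V j x) k = Tm a (u j) k - Tm a (z j) k + Er a w (V j) k := by
    intro j k
    rw [Er_split ha hK hw (mV j) k, ← Tm_sub ha hK (su j) (sz j)]
    congr 2
    funext l
    have : fc (V j) l = fCoeff (g j) l - fCoeff (h j) l := by
      rw [← fCoeff_sub (hg j) (hh j)]; rfl
    rw [this]
    simp only [hu, hz]
    ring
  have key : ∀ k, ∑ j, ((starRingEnd ℂ) (u j k) * Tm a (u j) k).re ≤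
      ∑ j, (m / 2 * ‖u j k‖ ^ 2 + 1 / (2 * m) * ‖Tm a (z j) k - Er a w (V j) k‖ ^ 2) := by
    intro k
    have e0 : ∑ j, (starRingEnd ℂ) (u j k) * (Tm a (u j) k - Tm a (z j) k + Er a w (V j) k) = 0 := by
      have := orth k
      calc _ = (w k : ℂ) ^ 2 * ∑ j, (starRingEnd ℂ) (fCoeff (g j) k) * fc (fun x => (a x : ℂ) * V j x) k := by
            rw [Finset.mul_sum]
            refine Finset.sum_congr rfl fun j _ => ?_
            rw [← split j k]
            simp only [hu, map_mul, Complex.conj_ofReal]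
            ring
        _ = 0 := by rw [this, mul_zero]
    have e1 : ∑ j, (starRingEnd ℂ) (u j k) * Tm a (u j) k = ∑ j, (starRingEnd ℂ) (u j k) * (Tm a (z j) k - Er a w (V j) k) := by
      rw [← sub_eq_zero, ← Finset.sum_sub_distrib, ← e0]
      refine Finset.sum_congr rfl fun j _ => ?_
      ring
    rw [← Complex.re_sum, e1, Complex.re_sum]
    refine Finset.sum_le_sum fun j _ => ?_
    refine (Complex.re_le_norm _).trans ?_
    rw [norm_mul, RCLike.norm_conj]
    set X := ‖u j k‖
    set Y := ‖Tm a (z j) k - Er a w (V j) k‖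
    have : m / 2 * X ^ 2 + 1 / (2 * m) * Y ^ 2 - X * Y = (m * X - Y) ^ 2 / (2 * m) := by field_simp; ring
    have : 0 ≤ (m * X - Y) ^ 2 / (2 * m) := by positivity
    linarith
  have sS : ∀ j, Summable fun k => ‖Tm a (z j) k - Er a w (V j) k‖ ^ 2 := fun j => sq_summable_add (sT j) (sE j)
  have co := fun j => Tm_coercive ha hK hm (su j)
  have t1 : ∑ j, m * ∑' k, ‖u j k‖ ^ 2 ≤ ∑' k, ∑ j, ((starRingEnd ℂ) (u j k) * Tm a (u j) k).re := by
    rw [Summable.tsum_finsetSum (fun j _ => (co j).1)]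
    exact Finset.sum_le_sum fun j _ => (co j).2
  have ss : ∀ j, Summable fun k => (m / 2 * ‖u j k‖ ^ 2 + 1 / (2 * m) * ‖Tm a (z j) k - Er a w (V j) k‖ ^ 2) :=
    fun j => ((su j).mul_left _).add ((sS j).mul_left _)
  have t2 := Summable.tsum_le_tsum key (summable_sum fun j _ => (co j).1) (summable_sum fun j _ => ss j)
  rw [Summable.tsum_finsetSum (fun j _ => ss j)] at t2
  have t3 : ∀ j, ∑' k, (m / 2 * ‖u j k‖ ^ 2 + 1 / (2 * m) * ‖Tm a (z j) k - Er a w (V j) k‖ ^ 2) ≤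
      m / 2 * ∑' k, ‖u j k‖ ^ 2 + 1 / m * (K ^ 2 * y j + e j) := by
    intro j
    rw [((su j).mul_left _).tsum_add ((sS j).mul_left _), tsum_mul_left, tsum_mul_left]
    have q := sq_tsum_sub (sT j) (sE j)
    have q2 : K ^ 2 * ∑' k, ‖z j k‖ ^ 2 ≤ K ^ 2 * y j := mul_le_mul_of_nonneg_left (bz j) (sq_nonneg K)
    have q3 : ∑' k, ‖Tm a (z j) k - Er a w (V j) k‖ ^ 2 ≤ 2 * (K ^ 2 * y j + e j) := by linarith [bT j, bE j]
    have q4 : 1 / (2 * m) * ∑' k, ‖Tm a (z j) k - Er a w (V j) k‖ ^ 2 ≤ 1 / (2 * m) * (2 * (K ^ 2 * y j + e j)) := by gcongr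
    have q5 : 1 / (2 * m) * (2 * (K ^ 2 * y j + e j)) = 1 / m * (K ^ 2 * y j + e j) := by field_simp
    linarith
  have t4 := (t1.trans t2).trans (Finset.sum_le_sum fun j _ => t3 j)
  rw [Finset.sum_add_distrib, ← Finset.mul_sum, ← Finset.mul_sum, ← Finset.mul_sum] at t4
  have eu : ∀ j k, ‖u j k‖ ^ 2 = w k ^ 2 * ‖fCoeff (g j) k‖ ^ 2 := fun j k => by
    simp [hu, mul_pow]
  simp only [eu] at t4
  set S := ∑ j, ∑' k, w k ^ 2 * ‖fCoeff (g j) k‖ ^ 2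
  set T := ∑ j, (K ^ 2 * y j + e j)
  have t5 : m / 2 * S ≤ 1 / m * T := by linarith
  have t6 : 2 / m * (m / 2 * S) ≤ 2 / m * (1 / m * T) := by gcongr
  have e6 : 2 / m * (m / 2 * S) = S := by field_simp
  have e7 : 2 / m * (1 / m * T) = 2 / m ^ 2 * T := by field_simp
  linarith

theorem interp {d : ℕ} {s R θ : ℝ} (hs : 0 ≤ s) (hR : 1 ≤ R) (hθ : 1 ≤ θ) {n : ℕ} (hn : 2 * s - 1 ≤ n) (k : Fin d → ℤ) :
    wR s R k ^ 2 * (jb k)⁻¹ ≤ θ⁻¹ * wR s R k ^ 2 + θ ^ n := by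
  have hJ := jb_ge_one k
  have hJ0 := jb_pos k
  rcases le_total θ (jb k) with h | h
  · have h1 : (jb k)⁻¹ ≤ θ⁻¹ := inv_anti₀ (by linarith) h
    have h2 : 0 ≤ θ ^ n := by positivity
    have := mul_le_mul_of_nonneg_left h1 (sq_nonneg (wR s R k))
    linarith
  · have h1 : wR s R k ^ 2 * (jb k)⁻¹ ≤ jb k ^ (2 * s - 1) := by
      rw [Real.rpow_sub hJ0, Real.rpow_one, div_eq_mul_inv]
      have h3 := pow_le_pow_left₀ (wR_pos hR k).le (wR_le_jb hs hR k) 2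
      have h4 : (jb k ^ s) ^ 2 = jb k ^ (2 * s) := by
        rw [← Real.rpow_natCast, ← Real.rpow_mul hJ0.le]; congr 1; push_cast; ring
      rw [h4] at h3
      gcongr
    have h2 : jb k ^ (2 * s - 1) ≤ jb k ^ (n : ℝ) := Real.rpow_le_rpow_of_exponent_le hJ hn
    rw [Real.rpow_natCast] at h2
    have h3 : jb k ^ n ≤ θ ^ n := by gcongr
    have h4 : 0 ≤ θ⁻¹ * wR s R k ^ 2 := by positivity
    linarith

theorem orth_of_eq {d : ℕ} {a : Td d → ℝ} (ha : SP a) {q : Td d → ℝ} (hq : ContDiff ℝ 2 q) (pq : TPer q)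
    {h : Fin d → Td d → ℝ} (hh : ∀ j, SP (h j))
    (eqn : ∀ x, ∑ i, pd i (fun y => a y * pd i q y) x = ∑ i, pd i (fun y => a y * h i y) x) (k : Fin d → ℤ) :
    ∑ j, (starRingEnd ℂ) (fCoeff (pd j q) k) * fc (fun x => (a x : ℂ) * ((pd j q x - h j x : ℝ) : ℂ)) k = 0 := by
  have c1 : ∀ i, ContDiff ℝ 1 (pd i q) := fun i => contDiff_pd hq (by norm_num) i
  have cP : ∀ i, ContDiff ℝ 1 (fun y => a y * pd i q y) := fun i => ha.c1.mul (c1 i)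
  have pP : ∀ i, TPer (fun y => a y * pd i q y) := fun i x k => by simp only [ha.2 x k, pq.pd i x k]
  have sQ : ∀ i, SP (fun y => a y * h i y) := fun i => ha.mul (hh i)
  have e1 : fCoeff (fun x => ∑ i, pd i (fun y => a y * pd i q y) x) k = fCoeff (fun x => ∑ i, pd i (fun y => a y * h i y) x) k := by
    rw [funext eqn]
  rw [fCoeff_sum _ (fun i => (contDiff_pd (cP i) (m := 0) (by norm_num) i).continuous), fCoeff_sum _ (fun i => ((sQ i).pd i).cont)] at e1
  simp only [fCoeff_pd (cP _) (pP _), fCoeff_pd (sQ _).c1 (sQ _).2] at e1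
  have e2 : ∀ j, fc (fun x => (a x : ℂ) * ((pd j q x - h j x : ℝ) : ℂ)) k = fCoeff (fun y => a y * pd j q y) k - fCoeff (fun y => a y * h j y) k := by
    intro j
    rw [← fCoeff_sub (cP j).continuous (sQ j).cont, fCoeff_eq_fc]
    congr 1; funext x; push_cast; ring
  have e3 : ∀ j, fCoeff (pd j q) k = 2 * Real.pi * Complex.I * k j * fCoeff q k := fun j =>
    fCoeff_pd (hq.of_le (by norm_num)) pq j k
  simp only [e2, e3]
  rw [← sub_eq_zero, ← Finset.sum_sub_distrib] at e1
  calc _ = - (starRingEnd ℂ) (fCoeff q k) * ∑ i, (2 * Real.pi * Complex.I * k i * fCoeff (fun y => a y * pd i q y) k - 2 * Real.pi * Complex.I * k i * fCoeff (fun y => a y * h i y) k) := by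
        rw [Finset.mul_sum]
        refine Finset.sum_congr rfl fun j _ => ?_
        simp only [map_mul, Complex.conj_I, Complex.conj_ofReal, map_ofNat, map_intCast]
        ring
    _ = 0 := by rw [e1, mul_zero]

theorem SL_vsub {d : ℕ} {W : (Fin d → ℤ) → ℝ} (h : ∀ k, 0 ≤ W k) (u v : (Fin d → ℤ) → ℂ) :
    SL W (fun k => u k - v k) ≤ 2 * SL W u + 2 * SL W v := by
  have h1 := SL_vadd h u (fun k => - v k)
  have h2 : SL W (fun k => - v k) = SL W v := by simp only [SL, norm_neg]
  rw [h2] at h1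
  simpa only [sub_eq_add_neg] using h1

theorem sum_const_le {d : ℕ} (hd : d ≤ 3) {X : ℝ} (hX : 0 ≤ X) : ∑ _j : Fin d, X ≤ 3 * X := by
  rw [Finset.sum_const, Finset.card_univ, Fintype.card_fin, nsmul_eq_mul]
  have : (d : ℝ) ≤ 3 := by exact_mod_cast hd
  gcongr

theorem core_est {d : ℕ} (hd : d ≤ 3) {s : ℝ} (hs : 0 ≤ s) {n : ℕ} (hn : 2 * s - 1 ≤ n)
    {a : Td d → ℝ} (ha : SP a) {K m : ℝ} (hK : ∀ x, |a x| ≤ K) (hm0 : 0 < m) (hm : ∀ x, m ≤ a x)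
    {q : Td d → ℝ} (hq : ContDiff ℝ 2 q) (pq : TPer q) {h : Fin d → Td d → ℝ} (hh : ∀ j, SP (h j))
    (eqn : ∀ x, ∑ i, pd i (fun y => a y * pd i q y) x = ∑ i, pd i (fun y => a y * h i y) x)
    {Xa Xb y0 y θ C1 C2 : ℝ} (hXa : 0 ≤ Xa) (hXb : 0 ≤ Xb) (hy0 : 0 ≤ y0) (hy : 0 ≤ y) (hθ : 1 ≤ θ)
    (hC1 : C1 = 686 * (max 1 s * 2 ^ s) ^ 2) (hC2 : C2 = 686 * (2 ^ s) ^ 2)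
    (bXa : SL (wt 2) (nz (fCoeff a)) ≤ ENNReal.ofReal Xa)
    (bXb : SL (wt (s + 3 / 2)) (nz (fCoeff a)) ≤ ENNReal.ofReal Xb)
    (by0 : ∀ j, hsNorm 0 (h j) ^ 2 ≤ y0) (bys : ∀ j, hsNorm s (h j) ^ 2 ≤ y)
    (bθ : 8 * C1 / m ^ 2 * Xa ≤ θ) (j : Fin d) :
    SL (wt s) (fCoeff (pd j q)) ≤ ENNReal.ofReal (12 / m ^ 2 * (K ^ 2 * y + C1 * (Xa * (θ ^ n * ((12 * K ^ 2 / m ^ 2 + 2) * y0)))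
      + C2 * (((12 * K ^ 2 / m ^ 2 + 2) * y0) * Xb)) + 3 * y) := by
  have hC1' : 0 ≤ C1 := by rw [hC1]; positivity
  have hC2' : 0 ≤ C2 := by rw [hC2]; positivity
  have orth := orth_of_eq ha hq pq hh eqn
  have cg : ∀ j, Continuous (pd j q) := fun j => (contDiff_pd hq (m := 1) (by norm_num) j).continuous
  have pg : ∀ j, TPer (pd j q) := fun j => pq.pd j
  have sg : ∀ j, Summable fun k => ‖fCoeff (pd j q) k‖ ^ 2 := fun j => (parseval_sq (memLp_per (cg j) (pg j))).summable
  set V := fun j x => ((pd j q x - h j x : ℝ) : ℂ) with hV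
  have fV : ∀ j, fc (V j) = fun k => fCoeff (pd j q) k - fCoeff (h j) k := fun j => by
    funext k; rw [← fCoeff_sub (cg j) (hh j).cont]; rfl
  -- the case of weight one
  have z1 : ∀ j, SL (fun _ => 1) (Er a (fun _ => 1) (V j)) ≤ ENNReal.ofReal 0 := fun j => by
    have : Er a (fun _ => 1) (V j) = fun _ => 0 := by
      funext k; simp [Er]
    rw [this]; simp [SL]
  have b1 : ∀ j, SL (fun _ => 1) (fCoeff (h j)) ≤ ENNReal.ofReal y0 := fun j => by
    have := (hh j).hs 0
    rw [wt_zero_eq d] at this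
    rw [this]; exact ENNReal.ofReal_le_ofReal (by0 j)
  have E0 := energy ha.cont hK hm0 hm cg pg (fun j => (hh j).cont) (fun j => (hh j).2) (w := fun _ => 1) (W := 1)
    (by simp) orth (e := fun _ => 0) (y := fun _ => y0) (fun _ => le_rfl) (fun _ => hy0) z1
    (fun j => by simpa only [one_pow] using b1 j)
  simp only [one_pow, one_mul, add_zero] at E0
  have E1 : ∀ j, ∑' k, ‖fCoeff (pd j q) k‖ ^ 2 ≤ 6 * K ^ 2 / m ^ 2 * y0 := fun j => by
    have t1 := Finset.single_le_sum (f := fun j => ∑' k, ‖fCoeff (pd j q) k‖ ^ 2)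
      (fun i _ => tsum_nonneg fun k => by positivity) (Finset.mem_univ j)
    have t2 := sum_const_le hd (X := K ^ 2 * y0) (by positivity)
    have t3 : 2 / m ^ 2 * ∑ _j : Fin d, K ^ 2 * y0 ≤ 2 / m ^ 2 * (3 * (K ^ 2 * y0)) := by gcongr
    have t4 : 2 / m ^ 2 * (3 * (K ^ 2 * y0)) = 6 * K ^ 2 / m ^ 2 * y0 := by ring
    linarith
  set L := (12 * K ^ 2 / m ^ 2 + 2) * y0 with hL
  have hL0 : 0 ≤ L := by positivity
  have VL : ∀ j, SL (fun _ => 1) (fc (V j)) ≤ ENNReal.ofReal L := fun j => by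
    rw [fV j]
    refine (SL_vsub (fun _ => zero_le_one) _ _).trans ?_
    have e : L = 2 * (6 * K ^ 2 / m ^ 2 * y0) + 2 * y0 := by rw [hL]; ring
    rw [e]
    refine eb_add (by positivity) (by positivity) (eb_two ?_) (eb_two (b1 j))
    rw [SL_eq_ofReal (fun _ => zero_le_one) (by simpa only [one_mul] using sg j)]
    simp only [one_mul]
    exact ENNReal.ofReal_le_ofReal (E1 j)
  refine SL_sup fun R hR => ?_
  have hw := wR_abs_le (d := d) hs hR
  set U := fun j => ∑' k, wR s R k ^ 2 * ‖fCoeff (pd j q) k‖ ^ 2 with hU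
  have hU0 : ∀ j, 0 ≤ U j := fun j => tsum_nonneg fun k => by positivity
  have gU : ∀ j, SL (fun k => wR s R k ^ 2) (fCoeff (pd j q)) = ENNReal.ofReal (U j) := fun j => by
    refine SL_eq_ofReal (fun _ => sq_nonneg _) ?_
    have := summable_weight hw (sg j)
    simpa [mul_pow] using this
  have hy1 : ∀ j, SL (fun k => wR s R k ^ 2) (fCoeff (h j)) ≤ ENNReal.ofReal y := fun j => by
    refine (SL_mono (wR_sq_le hs hR) _).trans ?_
    rw [(hh j).hs s]; exact ENNReal.ofReal_le_ofReal (bys j)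
  have hθ0 : 0 < θ := by linarith
  have VJ : ∀ j, SL (fun l => wR s R l ^ 2 * (jb l)⁻¹) (fc (V j)) ≤ ENNReal.ofReal (θ⁻¹ * (2 * U j + 2 * y) + θ ^ n * L) := fun j => by
    refine (SL_mono (fun k => interp hs hR hθ hn k) _).trans ?_
    rw [SL_add (fun k => by positivity) (fun k => by positivity), SL_const_mul _ (by positivity)]
    have e : SL (fun _ => θ ^ n) (fc (V j)) = ENNReal.ofReal (θ ^ n) * SL (fun _ => 1) (fc (V j)) := by
      rw [← SL_const_mul _ (by positivity)]; simp only [mul_one]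
    rw [e]
    have := hU0 j
    refine eb_add (by positivity) (by positivity) (eb_cmul (by positivity) ?_) (eb_cmul (by positivity) (VL j))
    rw [fV j]
    refine (SL_vsub (fun _ => sq_nonneg _) _ _).trans ?_
    exact eb_add (by positivity) (by positivity) (eb_two (gU j).le) (eb_two (hy1 j))
  set e := fun j => C1 * (Xa * (θ⁻¹ * (2 * U j + 2 * y) + θ ^ n * L)) + C2 * (L * Xb) with he
  have he0 : ∀ j, 0 ≤ e j := fun j => by
    have := hU0 j
    simp only [he]; positivity
  have z2 : ∀ j, SL (fun _ => 1) (Er a (wR s R) (V j)) ≤ ENNReal.ofReal (e j) := fun j => by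
    refine (comm_est hd hs hR (Or.inl rfl) a (V j)).trans ?_
    rw [wt_zero_eq d, sub_zero, ← hC1, ← hC2]
    have := hU0 j
    exact eb_add (by positivity) (by positivity) (eb_cmul hC1' (eb_mul hXa bXa (VJ j))) (eb_cmul hC2' (eb_mul hL0 (VL j) bXb))
  have E2 := energy ha.cont hK hm0 hm cg pg (fun j => (hh j).cont) (fun j => (hh j).2) (w := wR s R)
    hw orth (e := e) (y := fun _ => y) he0 (fun _ => hy) z2 hy1
  rw [gU j]
  refine ENNReal.ofReal_le_ofReal ?_
  set N := K ^ 2 * y + C1 * (Xa * (θ ^ n * L)) + C2 * (L * Xb) with hN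
  have hN0 : 0 ≤ N := by positivity
  have E3 : 2 / m ^ 2 * ∑ j, (K ^ 2 * y + e j) ≤ ∑ j, (2 / m ^ 2 * N + 1 / 2 * (U j + y)) := by
    rw [Finset.mul_sum]
    refine Finset.sum_le_sum fun j _ => ?_
    have t : 8 * C1 / m ^ 2 * Xa * θ⁻¹ ≤ 1 := by
      rw [← div_eq_mul_inv, div_le_one hθ0]; exact bθ
    have t2 := mul_le_mul_of_nonneg_right t (add_nonneg (hU0 j) hy)
    have t3 : 2 / m ^ 2 * (K ^ 2 * y + e j) = 2 / m ^ 2 * N + 1 / 2 * (8 * C1 / m ^ 2 * Xa * θ⁻¹ * (U j + y)) := by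
      simp only [he, hN]; ring
    rw [t3]; linarith
  have E4 := E2.trans E3
  have E5 : ∑ j, (2 / m ^ 2 * N + 1 / 2 * (U j + y)) = ∑ _j : Fin d, 2 / m ^ 2 * N + 1 / 2 * (∑ j, U j + ∑ _j : Fin d, y) := by
    rw [Finset.sum_add_distrib, ← Finset.mul_sum (f := fun j => U j + y), Finset.sum_add_distrib]
  rw [E5] at E4
  have t1 := Finset.single_le_sum (f := U) (fun i _ => hU0 i) (Finset.mem_univ j)
  have t2 := sum_const_le hd (X := 2 / m ^ 2 * N) (by positivity)
  have t3 := sum_const_le hd hy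
  have t4 : 12 / m ^ 2 * N = 2 * (3 * (2 / m ^ 2 * N)) := by ring
  change ∑ j, U j ≤ _ at E4
  linarith

theorem final_arith {S X G B A : ℝ} {n : ℕ} (hX : 1 ≤ X) (hG : 0 ≤ G) (hB : 0 ≤ B) (hA : 0 ≤ A)
    (hS : S ≤ 3 * (X * ((1 + G) ^ 2 * (1 + B) ^ (2 * n + 2) * A ^ 2))) :
    Real.sqrt S ≤ 3 * X * (1 + G) * (1 + B) ^ (n + 1) * A := by
  refine Real.sqrt_le_iff.2 ⟨by positivity, hS.trans ?_⟩
  have e : (3 * X * (1 + G) * (1 + B) ^ (n + 1) * A) ^ 2 = 9 * (X * (X * ((1 + G) ^ 2 * (1 + B) ^ (2 * n + 2) * A ^ 2))) := by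
    ring
  rw [e]
  have hP : 0 ≤ X * ((1 + G) ^ 2 * (1 + B) ^ (2 * n + 2) * A ^ 2) := by positivity
  have := mul_le_mul_of_nonneg_right hX hP
  linarith

set_option maxHeartbeats 800000

/-- `H^s` estimate for the pressure: for `s ≥ 0`, if
`div((1/η(c))∇p) = div((1/η(c))μ(c)∇c)` on `T^d`, then
`‖∇p‖_{H^s} ≤ F(‖c‖_{L^∞})(1+‖∇c‖_{L^∞})(1+‖c‖_{H²})^{⌊2s⌋+1}‖c‖_{H^{s+2}}`
for some increasing function `F` depending on `η, C, s, d`. -/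
theorem pressure_Hs_estimate (d : ℕ) (hd : d = 2 ∨ d = 3) (lam Lam Cc s : ℝ)
    (hlam : 0 < lam) (hLam : lam ≤ Lam) (hCc : 0 < Cc) (hs : 0 ≤ s)
    (η : ℝ → ℝ) (hη : ContDiff ℝ (⊤ : ℕ∞) η) (hηb : ∀ r, lam ≤ η r ∧ η r ≤ Lam) :
    ∃ F : ℝ → ℝ, (MonotoneOn F (Set.Ici 0)) ∧ (∀ r, 0 < F r) ∧
      ∀ c q : Td d → ℝ, ContDiff ℝ (⊤ : ℕ∞) c → TPer c → InHs (s + 2) c →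
        ContDiff ℝ 2 q → TPer q →
        (∀ x, (∑ i, pd i (fun y => (1 / η (c y)) * pd i q y) x)
            = ∑ i, pd i (fun y => (1 / η (c y)) * chemMu Cc c y * pd i c y) x) →
        Real.sqrt (∑ i, (hsNorm s (pd i q))^2)
          ≤ F (linf c) * (1 + linf (gn c)) *
              (1 + hsNorm 2 c) ^ ((⌊2 * s⌋).toNat + 1) * hsNorm (s + 2) c := by

  have hd3 : d ≤ 3 := by rcases hd with h | h <;> omega
  have hLam0 : 0 < Lam := lt_of_lt_of_le hlam hLam
  set n := (⌊2 * s⌋).toNat with hn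
  have hn1 : 2 * s < n + 1 := by
    have h1 := Int.lt_floor_add_one (2 * s)
    have h2 : (⌊2 * s⌋ : ℝ) ≤ (n : ℝ) := by
      have : ⌊2 * s⌋ ≤ (n : ℤ) := Int.self_le_toNat _
      exact_mod_cast this
    linarith
  set m : ℝ := 1 / Lam with hm
  set K : ℝ := 1 / lam with hK
  have hm0 : 0 < m := by positivity
  have hφ : ContDiff ℝ (⊤ : ℕ∞) (fun t => 1 / η t) :=
    contDiff_const.div hη (fun t => (lt_of_lt_of_le hlam (hηb t).1).ne')
  obtain ⟨Fa, hFa, ba⟩ := comp_base d hφ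
  obtain ⟨Fb, hFb, bb⟩ := comp_est hd3 n (s + 3 / 2) (by linarith) hφ
  obtain ⟨Fh, hFh, bh⟩ := h_est hd3 Cc hs n (by linarith)
  obtain ⟨F0, hF0, b0⟩ := h_L2 hd3 Cc
  set C1 : ℝ := 686 * (max 1 s * 2 ^ s) ^ 2 with hC1
  set C2 : ℝ := 686 * (2 ^ s) ^ 2 with hC2
  have h2s : (1:ℝ) ≤ 2 ^ s := Real.one_le_rpow (by norm_num) hs
  have hC1' : 1 ≤ C1 := by
    have : (1:ℝ) ≤ (max 1 s * 2 ^ s) ^ 2 := one_le_pow₀ (one_le_mul_of_one_le_of_one_le (le_max_left _ _) h2s)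
    rw [hC1]; linarith
  have hC2' : 1 ≤ C2 := by
    have : (1:ℝ) ≤ (2 ^ s) ^ 2 := one_le_pow₀ h2s
    rw [hC2]; linarith
  clear_value C1 C2 n m K
  set κ : ℝ := 12 * K ^ 2 / m ^ 2 + 2 with hκ
  have hκ1 : 1 ≤ κ := by
    have : 0 ≤ 12 * K ^ 2 / m ^ 2 := by positivity
    linarith
  set δ : ℝ := 1 + 8 * C1 / m ^ 2 with hδ
  have hδ1 : 1 ≤ δ := by
    have : 0 ≤ 8 * C1 / m ^ 2 := by positivity
    linarith
  have hδ2 : 8 * C1 / m ^ 2 ≤ δ := by linarith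
  have hmm : 0 ≤ 12 / m ^ 2 := by positivity
  have hMF : MF (fun r => (1 + 12 / m ^ 2) * ((1 + K ^ 2) * Fh r + C1 * (Fa r * ((δ * Fa r) ^ n * (κ * F0 r))) + C2 * (κ * F0 r * Fb r)) + 3 * Fh r) := by
    have f0 := (MF.const hκ1).mul hF0
    exact ((MF.const (by linarith)).mul ((((MF.const (by nlinarith [sq_nonneg K])).mul hFh).add
      ((MF.const hC1').mul (hFa.mul ((((MF.const hδ1).mul hFa).pow n).mul f0)))).add
      ((MF.const hC2').mul (f0.mul hFb)))).add ((MF.const (by norm_num)).mul hFh)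
  set F1 : ℝ → ℝ := fun r => (1 + 12 / m ^ 2) * ((1 + K ^ 2) * Fh r + C1 * (Fa r * ((δ * Fa r) ^ n * (κ * F0 r))) + C2 * (κ * F0 r * Fb r)) + 3 * Fh r with hF1
  have hMF3 : MF (fun r => 3 * F1 r) := (MF.const (by norm_num)).mul hMF
  refine ⟨fun r => 3 * F1 r, fun x _ y _ hxy => hMF3.1 hxy, fun r => hMF3.pos r, ?_⟩
  intro c q hc pc _ hq pq eqn
  have sc : SP c := ⟨hc, pc⟩
  have sa : SP (fun x => 1 / η (c x)) := SP.comp (φ := fun t => 1 / η t) hφ sc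
  have hh : ∀ j, SP (fun x => chemMu Cc c x * pd j c x) := fun j => (sc.chemMu Cc).mul (sc.pd j)
  set M := linf c
  set G := linf (gn c)
  set B := hsNorm 2 c
  set A := hsNorm (s + 2) c
  have hG : 0 ≤ G := linf_nonneg _
  have hB : 0 ≤ B := hs_nonneg _ _
  have hA : 0 ≤ A := hs_nonneg _ _
  have hBA : B ≤ A := hs_mono (by linarith) sc
  have hA' : hsNorm (max (s + 3 / 2) 2) c ≤ A := hs_mono (max_le (by linarith) (by linarith)) sc
  have hFa0 := hFa.pos M
  have hFb0 := hFb.pos M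
  have hFh0 := hFh.pos M
  have hF00 := hF0.pos M
  have hFa1 := hFa.2 M
  have hB2 : B ^ 2 ≤ (1 + B) ^ 2 := by gcongr; linarith
  have hθ1 : 1 ≤ δ * Fa M * (1 + B) ^ 2 :=
    one_le_mul_of_one_le_of_one_le (one_le_mul_of_one_le_of_one_le hδ1 hFa1) (one_le_pow₀ (by linarith))
  have core := core_est hd3 hs (n := n) (by linarith) sa (K := K) (m := m)
    (fun x => by
      have := hηb (c x)
      rw [abs_of_pos (by have := lt_of_lt_of_le hlam this.1; positivity), hK]
      exact one_div_le_one_div_of_le hlam this.1) hm0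
    (fun x => by
      have := hηb (c x)
      rw [hm]
      exact one_div_le_one_div_of_le (lt_of_lt_of_le hlam this.1) this.2)
    hq pq hh (fun x => by simpa only [mul_assoc] using eqn x)
    (Xa := Fa M * B ^ 2) (Xb := Fb M * (1 + B) ^ (2 * n) * A ^ 2) (y0 := F0 M * G ^ 2 * B ^ 2)
    (y := Fh M * (1 + G) ^ 2 * (1 + B) ^ (2 * n) * A ^ 2) (θ := δ * Fa M * (1 + B) ^ 2)
    (by positivity) (by positivity) (by positivity) (by positivity) hθ1 hC1 hC2 (ba c sc)
    ((bb c sc).trans (ENNReal.ofReal_le_ofReal (by gcongr; exact hs_nonneg _ _)))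
    (b0 c sc) (bh c sc)
    (by
      calc 8 * C1 / m ^ 2 * (Fa M * B ^ 2) ≤ δ * (Fa M * (1 + B) ^ 2) := by gcongr
        _ = _ := by ring)
  set P : ℝ := (1 + G) ^ 2 * (1 + B) ^ (2 * n + 2) * A ^ 2 with hP
  have hP0 : 0 ≤ P := by positivity
  have y1 : Fh M * (1 + G) ^ 2 * (1 + B) ^ (2 * n) * A ^ 2 ≤ Fh M * P := by
    rw [hP, show Fh M * (1 + G) ^ 2 * (1 + B) ^ (2 * n) * A ^ 2 = Fh M * ((1 + G) ^ 2 * (1 + B) ^ (2 * n) * A ^ 2) by ring]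
    gcongr <;> linarith
  have y2 : Fa M * B ^ 2 * ((δ * Fa M * (1 + B) ^ 2) ^ n * (κ * (F0 M * G ^ 2 * B ^ 2))) ≤ Fa M * ((δ * Fa M) ^ n * (κ * F0 M)) * P := by
    calc Fa M * B ^ 2 * ((δ * Fa M * (1 + B) ^ 2) ^ n * (κ * (F0 M * G ^ 2 * B ^ 2)))
        = Fa M * ((δ * Fa M) ^ n * (κ * F0 M)) * (G ^ 2 * ((1 + B) ^ (2 * n) * B ^ 2) * B ^ 2) := by
          rw [mul_pow (δ * Fa M), ← pow_mul]; ring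
      _ ≤ Fa M * ((δ * Fa M) ^ n * (κ * F0 M)) * ((1 + G) ^ 2 * ((1 + B) ^ (2 * n) * (1 + B) ^ 2) * A ^ 2) := by
          gcongr <;> linarith
      _ = _ := by rw [hP, pow_add]
  have y3 : κ * (F0 M * G ^ 2 * B ^ 2) * (Fb M * (1 + B) ^ (2 * n) * A ^ 2) ≤ κ * F0 M * Fb M * P := by
    calc _ = κ * F0 M * Fb M * (G ^ 2 * ((1 + B) ^ (2 * n) * B ^ 2) * A ^ 2) := by ring
      _ ≤ κ * F0 M * Fb M * ((1 + G) ^ 2 * ((1 + B) ^ (2 * n) * (1 + B) ^ 2) * A ^ 2) := by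
          gcongr <;> linarith
      _ = _ := by rw [hP, pow_add]
  have hY : ∀ j, hsNorm s (pd j q) ^ 2 ≤ F1 M * P := by
    intro j
    have h1 : SL (wt s) (fCoeff (pd j q)) ≤ ENNReal.ofReal (F1 M * P) := by
      refine (core j).trans (ENNReal.ofReal_le_ofReal ?_)
      have hN : K ^ 2 * (Fh M * (1 + G) ^ 2 * (1 + B) ^ (2 * n) * A ^ 2) + C1 * (Fa M * B ^ 2 * ((δ * Fa M * (1 + B) ^ 2) ^ n * (κ * (F0 M * G ^ 2 * B ^ 2)))) + C2 * (κ * (F0 M * G ^ 2 * B ^ 2) * (Fb M * (1 + B) ^ (2 * n) * A ^ 2)) ≤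
        (1 + K ^ 2) * (Fh M * P) + C1 * (Fa M * ((δ * Fa M) ^ n * (κ * F0 M)) * P) + C2 * (κ * F0 M * Fb M * P) := by
        gcongr
        linarith
      calc _ ≤ (1 + 12 / m ^ 2) * ((1 + K ^ 2) * (Fh M * P) + C1 * (Fa M * ((δ * Fa M) ^ n * (κ * F0 M)) * P) + C2 * (κ * F0 M * Fb M * P)) + 3 * (Fh M * P) := by
            gcongr
            linarith
        _ = F1 M * P := by rw [hF1]; ring
    have h2 := SL_le_real (fun k => (wt_pos s k).le) (mul_nonneg (hMF.pos M).le hP0) h1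
    rw [hsNorm, Real.sq_sqrt]
    · exact h2
    · exact tsum_nonneg fun k => mul_nonneg (wt_pos s k).le (by positivity)
  have hF1M := hMF.2 M
  have hS : ∑ i, hsNorm s (pd i q) ^ 2 ≤ 3 * (F1 M * P) :=
    (Finset.sum_le_sum fun i _ => hY i).trans (sum_const_le hd3 (mul_nonneg (by linarith) hP0))
  have hF1M0 : 0 < F1 M := by linarith
  exact final_arith hF1M hG hB hA hS
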